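/- Fix p > 1. As R → 0⁺ the functionals F_R Γ-converge, with respect to L¹ convergence on the class 𝓜 of bounded measurable subsets of ℝ², to the L¹-lower semicontinuous envelope F̄₀ of F₀. Precisely, for every sequence R_h → 0⁺ and every E ∈ 𝓜: (i) for every sequence E_h ∈ 𝓜 with E_h → E in L¹ one has F̄₀(E) ≤ liminf_{h→∞} F_{R_h}(E_h); (ii) there exists a sequence E_h ∈ 𝓜 with E_h → E in L¹ and limsup_{h→∞} F_{R_h}(E_h) ≤ F̄₀(E). -/

import Mathlib

open Set Metric MeasureTheory Filter Topology ENNReal NNReal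

noncomputable section

open scoped Classical

abbrev En (n : ℕ) := EuclideanSpace ℝ (Fin n)

def sphereCond (n : ℕ) (R : ℝ) (E : Set (En n)) : Prop :=
  ∀ p ∈ frontier E, ∃ p' p'' : En n, dist p p' = R ∧ dist p p'' = R ∧
    ball p' R ⊆ E ∧ ball p'' R ∩ E = ∅

def UR (n : ℕ) (R : ℝ) : Set (Set (En n)) :=
  {E | IsClosed E ∧ Bornology.IsBounded E ∧ sphereCond n R E}

def mk2 (x z : ℝ) : En 2 := (WithLp.equiv 2 (Fin 2 → ℝ)).symm ![x, z]

/-- `f` is of class `C^{1,1}` on `S ⊆ ℝ`. -/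
def C11OnR (f : ℝ → ℝ) (S : Set ℝ) : Prop :=
  (∀ x ∈ S, DifferentiableAt ℝ f x) ∧ ∃ C : ℝ≥0, LipschitzOnWith C (deriv f) S

/-- `κ` is a curvature function of `∂E`. -/
def IsCurvFun (E : Set (En 2)) (κ : En 2 → ℝ) : Prop :=
  ∀ (g : En 2 ≃ᵢ En 2) (ρ r : ℝ), 0 < ρ → 0 < r → ∀ f : ℝ → ℝ,
    C11OnR f (Ioo (-ρ) ρ) →
    (E ∩ (g '' {q | ∃ x ∈ Ioo (-ρ) ρ, ∃ z ∈ Ioo (-r) r, q = mk2 x z})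
      = g '' {q | ∃ x ∈ Ioo (-ρ) ρ, ∃ z ∈ Ioo (-r) r, z ≤ f x ∧ q = mk2 x z}) →
    ∀ x ∈ Ioo (-ρ) ρ, |f x| < r → DifferentiableAt ℝ (deriv f) x →
      κ (g (mk2 x (f x))) = deriv (deriv f) x / (1 + deriv f x ^ 2) ^ ((3 : ℝ) / 2)

def L1Conv (F : ℕ → Set (En 2)) (E : Set (En 2)) : Prop :=
  Tendsto (fun h => ∫ x, |(F h).indicator (fun _ => (1:ℝ)) x - E.indicator (fun _ => (1:ℝ)) x|)
    atTop (𝓝 0)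

/-- The class of bounded measurable subsets of the plane. -/
def MM : Set (Set (En 2)) := {E | MeasurableSet E ∧ Bornology.IsBounded E}

/-- `F_R(E) = ∫_{∂E} (1 + |κ_E|^p) dH¹` if `E ∈ 𝒰_R`, `+∞` otherwise (the integral does
not depend on the choice of the curvature function, so we take the infimum over all of them). -/
def FR (p R : ℝ) (E : Set (En 2)) : ℝ≥0∞ :=
  if E ∈ UR 2 R then
    ⨅ κ ∈ {κ : En 2 → ℝ | IsCurvFun E κ},
      ∫⁻ q in frontier E, ENNReal.ofReal (1 + |κ q| ^ p) ∂(μH[(1 : ℝ)])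
  else ⊤

/-- `E` is a compact set, equal to the closure of its interior, whose boundary is
(locally the graph of) a `C²` curve. -/
def IsC2Set (E : Set (En 2)) : Prop :=
  IsCompact E ∧ E = closure (interior E) ∧
  ∀ p ∈ frontier E, ∃ (g : En 2 ≃ᵢ En 2) (ρ r : ℝ) (f : ℝ → ℝ), 0 < ρ ∧ 0 < r ∧
    ContDiffOn ℝ 2 f (Ioo (-ρ) ρ) ∧ g (mk2 0 0) = p ∧
    E ∩ (g '' {q | ∃ x ∈ Ioo (-ρ) ρ, ∃ z ∈ Ioo (-r) r, q = mk2 x z})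
      = g '' {q | ∃ x ∈ Ioo (-ρ) ρ, ∃ z ∈ Ioo (-r) r, z ≤ f x ∧ q = mk2 x z}

def F0 (p : ℝ) (E : Set (En 2)) : ℝ≥0∞ :=
  if IsC2Set E then
    ⨅ κ ∈ {κ : En 2 → ℝ | IsCurvFun E κ},
      ∫⁻ q in frontier E, ENNReal.ofReal (1 + |κ q| ^ p) ∂(μH[(1 : ℝ)])
  else ⊤

/-- The lower semicontinuous envelope of `F₀` with respect to `L¹` convergence. -/
def F0bar (p : ℝ) (E : Set (En 2)) : ℝ≥0∞ :=
  ⨅ (A : ℕ → Set (En 2)) (_ : ∀ h, A h ∈ MM) (_ : L1Conv A E),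
    liminf (fun h => F0 p (A h)) atTop

/-! ### Coordinates and orthonormal frames in the plane -/

@[simp] lemma mk2_zero (x z : ℝ) : mk2 x z 0 = x := rfl

@[simp] lemma mk2_one (x z : ℝ) : mk2 x z 1 = z := rfl

lemma En2_ext {p q : En 2} (h0 : p 0 = q 0) (h1 : p 1 = q 1) : p = q := by
  ext i; fin_cases i <;> assumption

lemma mk2_eta (q : En 2) : mk2 (q 0) (q 1) = q := En2_ext rfl rfl

lemma dist_sq (p q : En 2) : dist p q ^ 2 = (p 0 - q 0) ^ 2 + (p 1 - q 1) ^ 2 := by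
  rw [EuclideanSpace.dist_eq, Real.sq_sqrt (by positivity), Fin.sum_univ_two, Real.dist_eq,
    Real.dist_eq, sq_abs, sq_abs]

lemma continuous_mk2 : Continuous fun v : ℝ × ℝ => mk2 v.1 v.2 := by
  refine (PiLp.continuous_toLp 2 _).comp (continuous_pi fun i => ?_)
  fin_cases i
  · exact continuous_fst
  · exact continuous_snd

/-- `n` is a unit vector. -/
def UnitV (n : En 2) : Prop := n 0 ^ 2 + n 1 ^ 2 = 1

/-- The point with coordinates `(x, z)` in the positively oriented orthonormal frame with
origin `p` and second vector `n`. -/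
def ptF (p n : En 2) (x z : ℝ) : En 2 :=
  mk2 (p 0 + x * n 1 + z * n 0) (p 1 - x * n 0 + z * n 1)

/-- First coordinate of `q` in the frame at `p` with second vector `n`. -/
def XF (p n q : En 2) : ℝ := (q 0 - p 0) * n 1 - (q 1 - p 1) * n 0

/-- Second coordinate of `q` in the frame at `p` with second vector `n`. -/
def ZF (p n q : En 2) : ℝ := (q 0 - p 0) * n 0 + (q 1 - p 1) * n 1

@[simp] lemma ptF_zero (p n : En 2) (x z : ℝ) : ptF p n x z 0 = p 0 + x * n 1 + z * n 0 := rfl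

@[simp] lemma ptF_one (p n : En 2) (x z : ℝ) : ptF p n x z 1 = p 1 - x * n 0 + z * n 1 := rfl

lemma XF_ptF {p n : En 2} (hn : UnitV n) (x z : ℝ) : XF p n (ptF p n x z) = x := by
  unfold UnitV at hn; simp only [XF, ptF_zero, ptF_one]; linear_combination x * hn

lemma ZF_ptF {p n : En 2} (hn : UnitV n) (x z : ℝ) : ZF p n (ptF p n x z) = z := by
  unfold UnitV at hn; simp only [ZF, ptF_zero, ptF_one]; linear_combination z * hn

lemma ptF_XF_ZF {p n : En 2} (hn : UnitV n) (q : En 2) : ptF p n (XF p n q) (ZF p n q) = q := by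
  unfold UnitV at hn
  refine En2_ext ?_ ?_
  · simp only [XF, ZF, ptF_zero]; linear_combination (q 0 - p 0) * hn
  · simp only [XF, ZF, ptF_one]; linear_combination (q 1 - p 1) * hn

lemma dist_ptF_sq {p n : En 2} (hn : UnitV n) (x z x' z' : ℝ) :
    dist (ptF p n x z) (ptF p n x' z') ^ 2 = (x - x') ^ 2 + (z - z') ^ 2 := by
  unfold UnitV at hn
  rw [dist_sq]; simp only [ptF_zero, ptF_one]
  linear_combination ((x - x') ^ 2 + (z - z') ^ 2) * hn

lemma dist_sq_frame {p n : En 2} (hn : UnitV n) (q q' : En 2) :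
    dist q q' ^ 2 = (XF p n q - XF p n q') ^ 2 + (ZF p n q - ZF p n q') ^ 2 := by
  rw [← dist_ptF_sq hn, ptF_XF_ZF hn, ptF_XF_ZF hn]

lemma abs_XF_sub_le {p n : En 2} (hn : UnitV n) (q q' : En 2) :
    |XF p n q - XF p n q'| ≤ dist q q' := by
  apply abs_le_of_sq_le_sq _ dist_nonneg
  rw [dist_sq_frame hn]; nlinarith [sq_nonneg (ZF p n q - ZF p n q')]

lemma abs_ZF_sub_le {p n : En 2} (hn : UnitV n) (q q' : En 2) :
    |ZF p n q - ZF p n q'| ≤ dist q q' := by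
  apply abs_le_of_sq_le_sq _ dist_nonneg
  rw [dist_sq_frame hn]; nlinarith [sq_nonneg (XF p n q - XF p n q')]

lemma continuous_coord (i : Fin 2) : Continuous fun q : En 2 => q i := by fun_prop

lemma continuous_XF (p n : En 2) : Continuous (XF p n) := by
  unfold XF; fun_prop

lemma continuous_ZF (p n : En 2) : Continuous (ZF p n) := by
  unfold ZF; fun_prop

lemma continuous_ptF (p n : En 2) : Continuous fun v : ℝ × ℝ => ptF p n v.1 v.2 := by
  unfold ptF
  exact continuous_mk2.comp
    (f := fun v : ℝ × ℝ => (p 0 + v.1 * n 1 + v.2 * n 0, p 1 - v.1 * n 0 + v.2 * n 1))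
    (by fun_prop)

lemma ptF_ptF (p n : En 2) (a b x z : ℝ) :
    ptF (ptF p n a b) n x z = ptF p n (a + x) (b + z) := by
  refine En2_ext ?_ ?_ <;> simp only [ptF_zero, ptF_one] <;> ring

lemma ptF_origin (p n : En 2) : ptF p n 0 0 = p := by
  refine En2_ext ?_ ?_ <;> simp

/-- The isometry of the plane attached to a frame. -/
def frameIso (p n : En 2) (hn : UnitV n) : En 2 ≃ᵢ En 2 :=
  IsometryEquiv.mk' (fun v => ptF p n (v 0) (v 1)) (fun q => mk2 (XF p n q) (ZF p n q))
    (fun q => by simp [ptF_XF_ZF hn])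
    (Isometry.of_dist_eq fun v w => by
      rw [← abs_of_nonneg (dist_nonneg (x := v) (y := w)),
        ← abs_of_nonneg (dist_nonneg (x := ptF p n (v 0) (v 1)))]
      apply (sq_eq_sq_iff_abs_eq_abs _ _).1
      rw [dist_ptF_sq hn, dist_sq])

lemma frameIso_mk2 (p n : En 2) (hn : UnitV n) (x z : ℝ) :
    frameIso p n hn (mk2 x z) = ptF p n x z := rfl

/-- The set identity expressing that `E` is a subgraph in a rectangle, stated pointwise. -/
lemma subgraph_iff (E : Set (En 2)) (g : En 2 ≃ᵢ En 2) (ρ r : ℝ) (f : ℝ → ℝ) :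
    (E ∩ (g '' {q | ∃ x ∈ Ioo (-ρ) ρ, ∃ z ∈ Ioo (-r) r, q = mk2 x z})
      = g '' {q | ∃ x ∈ Ioo (-ρ) ρ, ∃ z ∈ Ioo (-r) r, z ≤ f x ∧ q = mk2 x z}) ↔
    ∀ x ∈ Ioo (-ρ) ρ, ∀ z ∈ Ioo (-r) r, (g (mk2 x z) ∈ E ↔ z ≤ f x) := by
  constructor
  · intro h x hx z hz
    constructor
    · intro hm
      have : g (mk2 x z) ∈ E ∩ (g '' {q | ∃ x ∈ Ioo (-ρ) ρ, ∃ z ∈ Ioo (-r) r, q = mk2 x z}) :=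
        ⟨hm, _, ⟨x, hx, z, hz, rfl⟩, rfl⟩
      rw [h] at this
      obtain ⟨_, ⟨x', hx', z', hz', hle, rfl⟩, he⟩ := this
      have he := g.injective he
      have h0 : x' = x := by simpa using congrArg (fun v : En 2 => v 0) he
      have h1 : z' = z := by simpa using congrArg (fun v : En 2 => v 1) he
      rwa [← h0, ← h1]
    · intro hle
      have : g (mk2 x z) ∈
          g '' {q | ∃ x ∈ Ioo (-ρ) ρ, ∃ z ∈ Ioo (-r) r, z ≤ f x ∧ q = mk2 x z} :=
        ⟨_, ⟨x, hx, z, hz, hle, rfl⟩, rfl⟩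
      rw [← h] at this
      exact this.1
  · intro h
    ext q
    constructor
    · rintro ⟨hq, _, ⟨x, hx, z, hz, rfl⟩, rfl⟩
      exact ⟨_, ⟨x, hx, z, hz, (h x hx z hz).1 hq, rfl⟩, rfl⟩
    · rintro ⟨_, ⟨x, hx, z, hz, hle, rfl⟩, rfl⟩
      exact ⟨(h x hx z hz).2 hle, _, ⟨x, hx, z, hz, rfl⟩, rfl⟩

lemma g_mk2_dist_sq (g : En 2 ≃ᵢ En 2) (x z x' z' : ℝ) :
    dist (g (mk2 x z)) (g (mk2 x' z')) ^ 2 = (x - x') ^ 2 + (z - z') ^ 2 := by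
  rw [g.dist_eq, dist_sq]; simp

/-! ### Normals and graph charts of sets satisfying the sphere condition -/

/-- `n` is a unit outer normal at `q`, and both tangent balls of radius `R` are admissible. -/
def SphereN (E : Set (En 2)) (R : ℝ) (q n : En 2) : Prop :=
  UnitV n ∧ ∀ y, (dist y q ^ 2 < -(2 * R * ZF q n y) → y ∈ E) ∧
    (dist y q ^ 2 < 2 * R * ZF q n y → y ∉ E)

/-- Inner product of two vectors of the plane. -/
def dotE (n m : En 2) : ℝ := n 0 * m 0 + n 1 * m 1

/-- Inner product of `n` with the first vector of the frame of second vector `m`. -/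
def crossE (n m : En 2) : ℝ := n 0 * m 1 - n 1 * m 0

lemma dotE_sq_add_crossE_sq {n m : En 2} (hn : UnitV n) (hm : UnitV m) :
    crossE n m ^ 2 + dotE n m ^ 2 = 1 := by
  unfold UnitV at *; unfold dotE crossE
  linear_combination (m 0 ^ 2 + m 1 ^ 2) * hn + hm

lemma mem_ball_sq {p y : En 2} {R : ℝ} (hR : 0 < R) : y ∈ ball p R ↔ dist y p ^ 2 < R ^ 2 := by
  rw [mem_ball]
  exact (sq_lt_sq₀ dist_nonneg hR.le).symm

lemma exists_sphereN {E : Set (En 2)} {R : ℝ} (hR : 0 < R) (hE : sphereCond 2 R E) {q : En 2}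
    (hq : q ∈ frontier E) : ∃ n, SphereN E R q n := by
  obtain ⟨a, b, ha, hb, hin, hout⟩ := hE q hq
  have ha2 : (q 0 - a 0) ^ 2 + (q 1 - a 1) ^ 2 = R ^ 2 := by rw [← dist_sq, ha]
  have hb2 : (q 0 - b 0) ^ 2 + (q 1 - b 1) ^ 2 = R ^ 2 := by rw [← dist_sq, hb]
  have key : 4 * R ^ 2 ≤ (a 0 - b 0) ^ 2 + (a 1 - b 1) ^ 2 := by
    by_contra! hlt
    have hm : mk2 ((a 0 + b 0) / 2) ((a 1 + b 1) / 2) ∈ ball b R ∩ E := by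
      refine ⟨?_, hin ?_⟩
      · rw [mem_ball_sq hR, dist_sq]; simp only [mk2_zero, mk2_one]; nlinarith
      · rw [mem_ball_sq hR, dist_sq]; simp only [mk2_zero, mk2_one]; nlinarith
    rw [hout] at hm; exact hm
  have hsum : (a 0 + b 0 - 2 * q 0) ^ 2 + (a 1 + b 1 - 2 * q 1) ^ 2 ≤ 0 := by nlinarith
  have h0 : a 0 = 2 * q 0 - b 0 := by
    have : a 0 + b 0 - 2 * q 0 = 0 := by
      apply pow_eq_zero_iff (two_ne_zero) |>.1
      nlinarith [sq_nonneg (a 0 + b 0 - 2 * q 0), sq_nonneg (a 1 + b 1 - 2 * q 1)]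
    linarith
  have h1 : a 1 = 2 * q 1 - b 1 := by
    have : a 1 + b 1 - 2 * q 1 = 0 := by
      apply pow_eq_zero_iff (two_ne_zero) |>.1
      nlinarith [sq_nonneg (a 0 + b 0 - 2 * q 0), sq_nonneg (a 1 + b 1 - 2 * q 1)]
    linarith
  have hz : ∀ y : En 2, R * ZF q (mk2 ((b 0 - q 0) / R) ((b 1 - q 1) / R)) y
      = (y 0 - q 0) * (b 0 - q 0) + (y 1 - q 1) * (b 1 - q 1) := by
    intro y; simp only [ZF, mk2_zero, mk2_one]; field_simp
  refine ⟨mk2 ((b 0 - q 0) / R) ((b 1 - q 1) / R), ?_, fun y => ⟨fun h => hin ?_, fun h hy => ?_⟩⟩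
  · unfold UnitV; simp only [mk2_zero, mk2_one]; field_simp; linarith
  · rw [mem_ball_sq hR, dist_sq, h0, h1]
    rw [mul_assoc, hz, dist_sq] at h
    nlinarith
  · have : y ∈ ball b R ∩ E := by
      refine ⟨?_, hy⟩
      rw [mem_ball_sq hR, dist_sq]
      rw [mul_assoc, hz, dist_sq] at h
      nlinarith
    rw [hout] at this; exact this

lemma SphereN.le_dotE {E : Set (En 2)} {R : ℝ} {p q n m : En 2}
    (hp : SphereN E R p n) (hq : SphereN E R q m) :
    2 * R ^ 2 - dist p q ^ 2 ≤ 2 * R ^ 2 * dotE m n := by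
  obtain ⟨hn, hp⟩ := hp
  obtain ⟨hm, hq⟩ := hq
  unfold UnitV at hn hm
  have h1 : 4 * R ^ 2 ≤ (q 0 - p 0 - R * (m 0 + n 0)) ^ 2 + (q 1 - p 1 - R * (m 1 + n 1)) ^ 2 := by
    by_contra! hlt
    refine (hp (mk2 ((q 0 + p 0 - R * m 0 + R * n 0) / 2) ((q 1 + p 1 - R * m 1 + R * n 1) / 2))).2
      ?_ ((hq _).1 ?_)
    · rw [dist_sq]; simp only [ZF, mk2_zero, mk2_one]; nlinarith
    · rw [dist_sq]; simp only [ZF, mk2_zero, mk2_one]; nlinarith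
  have h2 : 4 * R ^ 2 ≤ (q 0 - p 0 + R * (m 0 + n 0)) ^ 2 + (q 1 - p 1 + R * (m 1 + n 1)) ^ 2 := by
    by_contra! hlt
    refine (hq (mk2 ((q 0 + p 0 + R * m 0 - R * n 0) / 2) ((q 1 + p 1 + R * m 1 - R * n 1) / 2))).2
      ?_ ((hp _).1 ?_)
    · rw [dist_sq]; simp only [ZF, mk2_zero, mk2_one]; nlinarith
    · rw [dist_sq]; simp only [ZF, mk2_zero, mk2_one]; nlinarith
  rw [dist_sq]; unfold dotE
  nlinarith

lemma SphereN.abs_ZF_le {E : Set (En 2)} {R : ℝ} (hE : IsClosed E) {q q' n : En 2}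
    (hq : SphereN E R q n) (hq' : q' ∈ frontier E) :
    |2 * R * ZF q n q'| ≤ dist q' q ^ 2 := by
  rw [abs_le]
  constructor
  · by_contra! h
    have ho : IsOpen {y : En 2 | dist y q ^ 2 < -(2 * R * ZF q n y)} := by
      have := continuous_ZF q n
      exact isOpen_lt (by fun_prop) (by fun_prop)
    have hsub : {y : En 2 | dist y q ^ 2 < -(2 * R * ZF q n y)} ⊆ E := fun y hy => (hq.2 y).1 hy
    have : q' ∈ interior E := interior_maximal hsub ho (by simp only [mem_ofPred_eq]; linarith)
    exact hq'.2 this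
  · by_contra! h
    exact (hq.2 q').2 h (hE.frontier_subset hq')

lemma ZF_ptF_eq (p n m : En 2) (x z x' z' : ℝ) :
    ZF (ptF p n x z) m (ptF p n x' z') = (x' - x) * crossE m n + (z' - z) * dotE m n := by
  simp only [ZF, ptF_zero, ptF_one, crossE, dotE]; ring

lemma XF_ptF_eq (p n m : En 2) (x z x' z' : ℝ) :
    XF (ptF p n x z) m (ptF p n x' z') = (x' - x) * dotE m n - (z' - z) * crossE m n := by
  simp only [XF, ptF_zero, ptF_one, crossE, dotE]; ring

lemma hasDerivAt_of_quadratic {f : ℝ → ℝ} {x s C δ : ℝ} (hδ : 0 < δ)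
    (h : ∀ y, |y - x| < δ → |f y - f x - s * (y - x)| ≤ C * (y - x) ^ 2) : HasDerivAt f s x := by
  rw [hasDerivAt_iff_isLittleO]
  have h1 : (fun y => f y - f x - (y - x) • s) =O[𝓝 x] fun y => (y - x) ^ 2 := by
    refine Asymptotics.IsBigO.of_bound C ?_
    filter_upwards [Metric.ball_mem_nhds x hδ] with y hy
    rw [mem_ball, Real.dist_eq] at hy
    rw [Real.norm_eq_abs, Real.norm_eq_abs, abs_of_nonneg (sq_nonneg (y - x)), smul_eq_mul,
      mul_comm (y - x) s]
    exact h y hy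
  refine h1.trans_isLittleO ?_
  have h2 : (fun y : ℝ => (y - x) ^ 2) = fun y => (y - x) * (y - x) := by ext; ring
  have h3 : (fun y : ℝ => y - x) =o[𝓝 x] fun _ => (1 : ℝ) := by
    rw [Asymptotics.isLittleO_one_iff]
    have : Tendsto (fun y : ℝ => y - x) (𝓝 x) (𝓝 (x - x)) :=
      (continuous_id.sub continuous_const).tendsto x
    simpa using this
  rw [h2]
  simpa using h3.mul_isBigO (Asymptotics.isBigO_refl (fun y : ℝ => y - x) (𝓝 x))

lemma exists_mem_frontier {X : Type*} [TopologicalSpace X] {s E : Set X} (hs : IsPreconnected s)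
    (h1 : (s ∩ E).Nonempty) (h2 : (s ∩ Eᶜ).Nonempty) : (s ∩ frontier E).Nonempty := by
  by_contra hne
  rw [not_nonempty_iff_eq_empty] at hne
  have hnf : ∀ x ∈ s, x ∉ frontier E := fun x hx hf => by
    have : x ∈ s ∩ frontier E := ⟨hx, hf⟩
    rw [hne] at this; exact this
  have hcov : ∀ x ∈ s, x ∈ interior E ∨ x ∈ (closure E)ᶜ := fun x hx => by
    by_contra! h
    exact hnf x hx ⟨not_not.1 h.2, h.1⟩
  obtain ⟨x, hxs, hxE⟩ := h1
  obtain ⟨y, hys, hyE⟩ := h2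
  obtain ⟨z, -, hz1, hz2⟩ := hs _ _ isOpen_interior isClosed_closure.isOpen_compl hcov
    ⟨x, hxs, (hcov x hxs).resolve_right fun h => h (subset_closure hxE)⟩
    ⟨y, hys, (hcov y hys).resolve_left fun h => hyE (interior_subset h)⟩
  exact hz2 (subset_closure (interior_subset hz1))

/-- `E` is a subgraph of a `C^{1,1}` function `f` in the square of half-side `R / 4` of the frame
at `p` with vertical direction `n`. -/
structure IsChart (E : Set (En 2)) (R : ℝ) (p n : En 2) (f : ℝ → ℝ) : Prop where
  unit : UnitV n
  mem_iff : ∀ x z, |x| < R / 4 → |z| < R / 4 → (ptF p n x z ∈ E ↔ z ≤ f x)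
  frontier_iff : ∀ x z, |x| < R / 4 → |z| < R / 4 → (ptF p n x z ∈ frontier E ↔ z = f x)
  abs_le : ∀ x, |x| < R / 4 → |f x| ≤ |x|
  diff : ∀ x, |x| < R / 4 → HasDerivAt f (deriv f x) x
  deriv_le : ∀ x, |x| < R / 4 → |deriv f x| ≤ 1
  lip : ∀ x y, |x| < R / 4 → |y| < R / 4 → |deriv f x - deriv f y| ≤ 4 / R * |x - y|
  normal : ∀ x, |x| < R / 4 → ∀ m, SphereN E R (ptF p n x (f x)) m →
    0 < dotE m n ∧ crossE m n = -(deriv f x * dotE m n)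

lemma exists_chart {E : Set (En 2)} {R : ℝ} (hR : 0 < R) (hE : IsClosed E)
    (hS : sphereCond 2 R E) {p : En 2} (hp : p ∈ frontier E) : ∃ n f, IsChart E R p n f := by
  obtain ⟨n, hn⟩ := exists_sphereN hR hS hp
  have hu := hn.1
  have hpd : ∀ x z, dist (ptF p n x z) p ^ 2 = x ^ 2 + z ^ 2 := by
    intro x z
    conv_lhs => rw [← ptF_origin p n, ptF_ptF, dist_ptF_sq hu]
    ring
  have hdot : ∀ x z m, |x| < R / 4 → |z| < R / 4 → SphereN E R (ptF p n x z) m →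
      15 / 16 ≤ dotE m n := by
    intro x z m hx hz hm
    have h1 := hn.le_dotE hm
    rw [dist_comm, hpd] at h1
    rw [abs_lt] at hx hz
    have : (15 / 16) * (2 * R ^ 2) ≤ 2 * R ^ 2 * dotE m n := by nlinarith
    have hR2 : 0 < 2 * R ^ 2 := by positivity
    nlinarith
  have hcross : ∀ x z, |x| < R / 4 → |z| < R / 4 → ptF p n x z ∈ frontier E →
      ∀ z', |z'| < R / 4 → (z' < z → ptF p n x z' ∈ E) ∧ (z < z' → ptF p n x z' ∉ E) := by
    intro x z hx hz hq z' hz'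
    obtain ⟨m, hm⟩ := exists_sphereN hR hS hq
    have hd := hdot x z m hx hz hm
    rw [abs_lt] at hx hz hz'
    constructor
    · intro hlt
      refine (hm.2 _).1 ?_
      rw [dist_ptF_sq hu, ZF_ptF_eq]
      nlinarith [mul_pos hR (sub_pos.2 hlt), mul_le_mul_of_nonneg_left hd
        (mul_pos hR (sub_pos.2 hlt)).le]
    · intro hlt
      refine (hm.2 _).2 ?_
      rw [dist_ptF_sq hu, ZF_ptF_eq]
      nlinarith [mul_pos hR (sub_pos.2 hlt), mul_le_mul_of_nonneg_left hd
        (mul_pos hR (sub_pos.2 hlt)).le]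
  have hex : ∀ x, ∃ z, |x| < R / 4 → |z| ≤ |x| ∧ ptF p n x z ∈ frontier E := by
    intro x
    by_cases hx : |x| < R / 4
    swap
    · exact ⟨0, fun h => absurd h hx⟩
    rcases eq_or_ne x 0 with rfl | hx0
    · exact ⟨0, fun _ => ⟨by simp, by rwa [ptF_origin]⟩⟩
    have hxp : 0 < |x| := abs_pos.2 hx0
    have hZ : ∀ z, ZF p n (ptF p n x z) = z := fun z => ZF_ptF hu x z
    have hin : ptF p n x (-|x|) ∈ E := by
      refine (hn.2 _).1 ?_
      rw [hpd, hZ, ← sq_abs x]; nlinarith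
    have hout : ptF p n x |x| ∉ E := by
      refine (hn.2 _).2 ?_
      rw [hpd, hZ, ← sq_abs x]; nlinarith
    have hc : Continuous fun z => ptF p n x z :=
      (continuous_ptF p n).comp (f := fun z => (x, z)) (by fun_prop)
    have hpre : IsPreconnected ((fun z => ptF p n x z) '' Icc (-|x|) |x|) :=
      isPreconnected_Icc.image _ hc.continuousOn
    have hle : -|x| ≤ |x| := by linarith
    obtain ⟨_, ⟨z, hz, rfl⟩, hf⟩ := exists_mem_frontier hpre
      ⟨_, ⟨_, left_mem_Icc.2 hle, rfl⟩, hin⟩ ⟨_, ⟨_, right_mem_Icc.2 hle, rfl⟩, hout⟩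
    exact ⟨z, fun _ => ⟨abs_le.2 hz, hf⟩⟩
  choose f hf using hex
  have hfx : ∀ x, |x| < R / 4 → |f x| < R / 4 := fun x hx => (hf x hx).1.trans_lt hx
  have hquad : ∀ x, |x| < R / 4 → ∀ m, SphereN E R (ptF p n x (f x)) m → ∀ y, |y| < R / 4 →
      |f y - f x - (-(crossE m n / dotE m n)) * (y - x)| ≤ 2 / R * (y - x) ^ 2 := by
    intro x hx m hm y hy
    have hd := hdot x (f x) m hx (hfx x hx) hm
    have h1 := hm.abs_ZF_le hE (hf y hy).2
    rw [dist_ptF_sq hu, ZF_ptF_eq] at h1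
    have h2 := dotE_sq_add_crossE_sq hm.1 hu
    have hfx' := hfx x hx
    have hfy' := hfx y hy
    set α := crossE m n
    set β := dotE m n
    set u := y - x with hu
    set v := f y - f x with hv
    have hα : |α| ≤ 3 / 8 := by
      apply abs_le_of_sq_le_sq _ (by norm_num)
      nlinarith
    have hub : |u| ≤ R / 2 := by
      rw [abs_lt] at hx hy; rw [abs_le]; constructor <;> linarith
    have hvb : |v| ≤ R / 2 := by
      rw [abs_lt] at hfx' hfy'; rw [abs_le]; constructor <;> linarith
    have hbd : |u * α + v * β| * (2 * R) ≤ |u| ^ 2 + |v| ^ 2 := by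
      rw [sq_abs, sq_abs]
      rw [abs_mul, abs_of_pos (by positivity : 0 < 2 * R)] at h1
      linarith
    have hvu : |v| ≤ |u| := by
      have h3 : |v| * β ≤ |u * α + v * β| + |u| * |α| := by
        have : v * β = (u * α + v * β) - u * α := by ring
        calc |v| * β = |v * β| := by rw [abs_mul, abs_of_nonneg (a := β) (by linarith)]
          _ = |(u * α + v * β) - u * α| := by rw [← this]
          _ ≤ _ := by rw [← abs_mul]; exact abs_sub _ _
      have h4 : |u * α + v * β| * (2 * R) ≤ (|u| + |v|) / 4 * (2 * R) := by
        nlinarith [abs_nonneg u, abs_nonneg v]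
      have h5 := le_of_mul_le_mul_right h4 (by positivity)
      nlinarith [abs_nonneg u, abs_nonneg v]
    have h6 : |u * α + v * β| * R ≤ u ^ 2 := by
      have : |v| ^ 2 ≤ |u| ^ 2 := pow_le_pow_left₀ (abs_nonneg _) hvu 2
      rw [← sq_abs u]; nlinarith
    have h7 : v - (-(α / β)) * u = (u * α + v * β) / β := by
      field_simp; ring
    rw [h7, abs_div, abs_of_nonneg (a := β) (by linarith), div_le_iff₀ (by linarith),
      div_mul_eq_mul_div, div_mul_eq_mul_div, le_div_iff₀ hR]
    nlinarith [sq_nonneg u]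
  have hder : ∀ x, |x| < R / 4 → ∀ m, SphereN E R (ptF p n x (f x)) m →
      HasDerivAt f (-(crossE m n / dotE m n)) x := by
    intro x hx m hm
    refine hasDerivAt_of_quadratic (δ := R / 4 - |x|) (C := 2 / R) (by linarith) fun y hy => ?_
    refine hquad x hx m hm y ?_
    have : |y| ≤ |y - x| + |x| := by
      calc |y| = |y - x + x| := by ring_nf
        _ ≤ _ := abs_add_le _ _
    linarith
  have hquad' : ∀ x, |x| < R / 4 → ∀ y, |y| < R / 4 →
      |f y - f x - deriv f x * (y - x)| ≤ 2 / R * (y - x) ^ 2 := by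
    intro x hx y hy
    obtain ⟨m, hm⟩ := exists_sphereN hR hS (hf x hx).2
    rw [(hder x hx m hm).deriv]
    exact hquad x hx m hm y hy
  refine ⟨n, f, hu, ?_, ?_, fun x hx => (hf x hx).1, ?_, ?_, ?_, ?_⟩
  · intro x z hx hz
    have hc := hcross x (f x) hx (hfx x hx) (hf x hx).2 z hz
    constructor
    · intro h; by_contra! hlt; exact hc.2 hlt h
    · intro h
      rcases h.eq_or_lt with rfl | h
      · exact hE.frontier_subset (hf x hx).2
      · exact hc.1 h
  · intro x z hx hz
    constructor
    · intro h
      by_contra hne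
      rcases lt_or_gt_of_ne hne with hlt | hlt
      · have hmid : |(z + f x) / 2| < R / 4 := by
          have := hfx x hx
          rw [abs_lt] at *; constructor <;> linarith
        exact (hcross x z hx hz h _ hmid).2 (by linarith)
          ((hcross x (f x) hx (hfx x hx) (hf x hx).2 _ hmid).1 (by linarith))
      · have hmid : |(z + f x) / 2| < R / 4 := by
          have := hfx x hx
          rw [abs_lt] at *; constructor <;> linarith
        exact (hcross x (f x) hx (hfx x hx) (hf x hx).2 _ hmid).2 (by linarith)
          ((hcross x z hx hz h _ hmid).1 (by linarith))
    · rintro rfl; exact (hf x hx).2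
  · intro x hx
    obtain ⟨m, hm⟩ := exists_sphereN hR hS (hf x hx).2
    rw [(hder x hx m hm).deriv]; exact hder x hx m hm
  · intro x hx
    obtain ⟨m, hm⟩ := exists_sphereN hR hS (hf x hx).2
    have hd := hdot x (f x) m hx (hfx x hx) hm
    have h2 := dotE_sq_add_crossE_sq hm.1 hu
    rw [(hder x hx m hm).deriv, abs_neg, abs_div, abs_of_nonneg (a := dotE m n) (by linarith),
      div_le_one (by linarith)]
    apply abs_le_of_sq_le_sq _ (by linarith)
    nlinarith
  · intro x y hx hy
    rcases eq_or_ne x y with rfl | hne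
    · simp
    have h1 := hquad' x hx y hy
    have h2 := hquad' y hy x hx
    have hpos : 0 < |x - y| := abs_pos.2 (sub_ne_zero.2 hne)
    have h3 : |deriv f x - deriv f y| * |x - y| ≤ 4 / R * |x - y| * |x - y| := by
      rw [← abs_mul]
      have : (deriv f x - deriv f y) * (x - y)
          = (f y - f x - deriv f x * (y - x)) + (f x - f y - deriv f y * (x - y)) := by ring
      rw [this]
      refine (abs_add_le _ _).trans ((add_le_add h1 h2).trans (le_of_eq ?_))
      rw [mul_assoc, abs_mul_abs_self]; ring
    exact le_of_mul_le_mul_right h3 hpos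
  · intro x hx m hm
    have hd := hdot x (f x) m hx (hfx x hx) hm
    refine ⟨by linarith, ?_⟩
    rw [(hder x hx m hm).deriv]
    field_simp

/-! ### Curvature: intrinsic characterisation, uniqueness and existence -/

/-- Near `p` the boundary of `E` osculates, to second order, the disk of curvature `k` with outer
normal `N`. -/
def OscAt (E : Set (En 2)) (p N : En 2) (k : ℝ) : Prop :=
  UnitV N ∧ ∀ ε, 0 < ε → ∀ᶠ q in 𝓝 p, ((k / 2 + ε) * dist q p ^ 2 < ZF p N q → q ∉ E) ∧
    (ZF p N q < (k / 2 - ε) * dist q p ^ 2 → q ∈ E)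

lemma eventually_mul_lt {a : ℝ} (ha : 0 < a) (C : ℝ) : ∀ᶠ s in 𝓝[>] (0 : ℝ), C * s < a := by
  have h : Tendsto (fun s : ℝ => C * s) (𝓝[>] 0) (𝓝 (C * 0)) :=
    ((continuous_const.mul continuous_id).tendsto 0).mono_left nhdsWithin_le_nhds
  rw [mul_zero] at h
  exact h.eventually (gt_mem_nhds ha)

lemma OscAt.normal_unique {E : Set (En 2)} {p N M : En 2} {k l : ℝ} (h1 : OscAt E p N k)
    (h2 : OscAt E p M l) : N = M := by
  obtain ⟨hN, h1⟩ := h1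
  obtain ⟨hM, h2⟩ := h2
  unfold UnitV at hN hM
  by_contra hne
  set w0 := N 0 - M 0 with hw0
  set w1 := N 1 - M 1 with hw1
  have hw : 0 < w0 ^ 2 + w1 ^ 2 := by
    by_contra! hle
    have h0 : w0 = 0 := by nlinarith [sq_nonneg w0, sq_nonneg w1]
    have h1 : w1 = 0 := by nlinarith [sq_nonneg w0, sq_nonneg w1]
    exact hne (En2_ext (by linarith) (by linarith))
  have hc : Tendsto (fun s : ℝ => mk2 (p 0 + s * w0) (p 1 + s * w1)) (𝓝[>] 0) (𝓝 p) := by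
    have : Continuous fun s : ℝ => mk2 (p 0 + s * w0) (p 1 + s * w1) :=
      continuous_mk2.comp (f := fun s : ℝ => (p 0 + s * w0, p 1 + s * w1)) (by fun_prop)
    have h := (this.tendsto 0).mono_left (nhdsWithin_le_nhds (s := Ioi 0))
    simpa [mk2_eta] using h
  have e1 := hc.eventually (h1 1 one_pos)
  have e2 := hc.eventually (h2 1 one_pos)
  have e3 := eventually_mul_lt (show (0 : ℝ) < 1 / 2 by norm_num) (k / 2 + 1)
  have e4 := eventually_mul_lt (show (0 : ℝ) < 1 / 2 by norm_num) (-(l / 2 - 1))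
  obtain ⟨s, hs1, hs2, hs3, hs4, hs⟩ :=
    (e1.and (e2.and (e3.and (e4.and self_mem_nhdsWithin)))).exists
  have hs : 0 < s := hs
  have hp : 0 < s * (w0 ^ 2 + w1 ^ 2) := mul_pos hs hw
  refine hs1.1 ?_ (hs2.2 ?_)
  · rw [dist_sq]; simp only [ZF, mk2_zero, mk2_one]
    have : N 0 * w0 + N 1 * w1 = (w0 ^ 2 + w1 ^ 2) / 2 := by
      rw [hw0, hw1]; linear_combination hN / 2 - hM / 2
    nlinarith
  · rw [dist_sq]; simp only [ZF, mk2_zero, mk2_one]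
    have : M 0 * w0 + M 1 * w1 = -(w0 ^ 2 + w1 ^ 2) / 2 := by
      rw [hw0, hw1]; linear_combination hN / 2 - hM / 2
    nlinarith

lemma OscAt.le_of_same_normal {E : Set (En 2)} {p N : En 2} {k l : ℝ} (h1 : OscAt E p N k)
    (h2 : OscAt E p N l) : l ≤ k := by
  obtain ⟨hN, h1⟩ := h1
  obtain ⟨-, h2⟩ := h2
  by_contra! hlt
  set c := (k + l) / 4 with hcdef
  set ε := (l - k) / 8 with hε
  have hεp : 0 < ε := by rw [hε]; linarith
  have hc : Tendsto (fun s : ℝ => ptF p N s (c * s ^ 2)) (𝓝[>] 0) (𝓝 p) := by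
    have : Continuous fun s : ℝ => ptF p N s (c * s ^ 2) :=
      (continuous_ptF p N).comp (f := fun s : ℝ => (s, c * s ^ 2)) (by fun_prop)
    have h := (this.tendsto 0).mono_left (nhdsWithin_le_nhds (s := Ioi 0))
    simpa [ptF_origin] using h
  have e1 := hc.eventually (h1 ε hεp)
  have e2 := hc.eventually (h2 ε hεp)
  have e3 := eventually_mul_lt hεp ((k / 2 + ε) * c ^ 2)
  have e4 := eventually_mul_lt hεp (-((l / 2 - ε) * c ^ 2))
  have e5 := eventually_mul_lt one_pos 1
  obtain ⟨s, hs1, hs2, hs3, hs4, hs5, hs⟩ :=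
    (e1.and (e2.and (e3.and (e4.and (e5.and self_mem_nhdsWithin))))).exists
  have hs : 0 < s := hs
  have hd : dist (ptF p N s (c * s ^ 2)) p ^ 2 = s ^ 2 + (c * s ^ 2) ^ 2 := by
    conv_lhs => rw [← ptF_origin p N, ptF_ptF, dist_ptF_sq hN]
    ring
  have hs2p : 0 < s ^ 2 := by positivity
  have hmul : ∀ C, C * s < ε → C * s ^ 2 < ε := by
    intro C hC
    rcases le_or_gt C 0 with h | h <;> nlinarith
  have g3 := mul_lt_mul_of_pos_right (hmul _ hs3) hs2p
  have g4 := mul_lt_mul_of_pos_right (hmul _ hs4) hs2p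
  have hk : k / 2 + ε = c - ε := by rw [hcdef, hε]; ring
  have hl : l / 2 - ε = c + ε := by rw [hcdef, hε]; ring
  refine hs1.1 ?_ (hs2.2 ?_)
  · rw [hd, ZF_ptF hN]
    rw [hk] at g3 ⊢
    nlinarith
  · rw [hd, ZF_ptF hN]
    rw [hl] at g4 ⊢
    nlinarith

lemma OscAt.unique {E : Set (En 2)} {p N M : En 2} {k l : ℝ} (h1 : OscAt E p N k)
    (h2 : OscAt E p M l) : k = l := by
  obtain rfl := h1.normal_unique h2
  exact le_antisymm (h2.le_of_same_normal h1) (h1.le_of_same_normal h2)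

/-- Second order Taylor expansion with Peano remainder. -/
lemma eventually_taylor_two {f : ℝ → ℝ} {x₀ c : ℝ} (hf : ∀ᶠ x in 𝓝 x₀, DifferentiableAt ℝ f x)
    (hc : HasDerivAt (deriv f) c x₀) {ε : ℝ} (hε : 0 < ε) :
    ∀ᶠ x in 𝓝 x₀, |f x - f x₀ - deriv f x₀ * (x - x₀) - c / 2 * (x - x₀) ^ 2|
      ≤ ε * (x - x₀) ^ 2 := by
  have h1 : ∀ᶠ x in 𝓝 x₀, |deriv f x - deriv f x₀ - c * (x - x₀)| ≤ ε * |x - x₀| := by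
    rw [hasDerivAt_iff_isLittleO] at hc
    filter_upwards [hc.def hε] with x hx
    simpa [Real.norm_eq_abs, mul_comm] using hx
  obtain ⟨δ, hδ, hball⟩ := Metric.eventually_nhds_iff.1 (hf.and h1)
  refine Metric.eventually_nhds_iff.2 ⟨δ, hδ, fun x hx => ?_⟩
  have hφ : ∀ y ∈ closedBall x₀ |x - x₀|, HasDerivWithinAt
      (fun y => f y - deriv f x₀ * (y - x₀) - c / 2 * (y - x₀) ^ 2)
      (deriv f y - deriv f x₀ - c * (y - x₀)) (closedBall x₀ |x - x₀|) y := by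
    intro y hy
    have hy' : dist y x₀ < δ := (mem_closedBall.1 hy).trans_lt (by rwa [← Real.dist_eq])
    have hd := (hball hy').1.hasDerivAt
    have hid : HasDerivAt (fun y : ℝ => y - x₀) 1 y := (hasDerivAt_id y).sub_const x₀
    refine HasDerivAt.hasDerivWithinAt ?_
    refine ((hd.sub (hid.const_mul (deriv f x₀))).sub
      ((hid.pow 2).const_mul (c / 2))).congr_deriv ?_
    push_cast; ring
  have hb : ∀ y ∈ closedBall x₀ |x - x₀|, ‖deriv f y - deriv f x₀ - c * (y - x₀)‖
      ≤ ε * |x - x₀| := by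
    intro y hy
    have hy1 := mem_closedBall.1 hy
    have hy' : dist y x₀ < δ := hy1.trans_lt (by rwa [← Real.dist_eq])
    rw [Real.dist_eq] at hy1
    exact (hball hy').2.trans (mul_le_mul_of_nonneg_left hy1 hε.le)
  have := (convex_closedBall x₀ |x - x₀|).norm_image_sub_le_of_norm_hasDerivWithin_le hφ hb
    (mem_closedBall_self (abs_nonneg _)) (y := x) (by rw [mem_closedBall, Real.dist_eq])
  simp only [sub_self, mul_zero, Real.norm_eq_abs] at this
  rw [mul_assoc, abs_mul_abs_self] at this
  convert this using 2 <;> ring_nf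

lemma quadratic_remainder {c B ε h t : ℝ} (hε : 0 < ε) (hB : |B| ≤ 1 / 2)
    (hB' : |B| * (|c| + 2 * ε) ≤ ε / 2) (ht : c / 2 * h ^ 2 + B * t + ε * h ^ 2 < t) :
    c / 2 * h ^ 2 + ε / 2 * h ^ 2 < t := by
  by_contra! hle
  have hc1 := le_abs_self c
  have hc2 := neg_abs_le c
  have hh := sq_nonneg h
  have hBt : |B * t| = |B| * |t| := abs_mul _ _
  have hBt1 := neg_abs_le (B * t)
  rw [hBt] at hBt1
  have ht' : |t| ≤ (|c| + 2 * ε) * h ^ 2 := by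
    rcases le_or_gt 0 t with h0 | h0
    · rw [abs_of_nonneg h0]; nlinarith
    · rw [abs_of_neg h0] at hBt1 ⊢
      nlinarith
  have : |B| * |t| ≤ ε / 2 * h ^ 2 := by
    calc |B| * |t| ≤ |B| * ((|c| + 2 * ε) * h ^ 2) :=
          mul_le_mul_of_nonneg_left ht' (abs_nonneg _)
      _ = |B| * (|c| + 2 * ε) * h ^ 2 := by ring
      _ ≤ _ := mul_le_mul_of_nonneg_right hB' hh
  nlinarith

/-- Curvature of the graph of `f` at `x`, for the outer normal pointing upwards. -/
def curvGraph (f : ℝ → ℝ) (x : ℝ) : ℝ :=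
  deriv (deriv f) x / (1 + deriv f x ^ 2) ^ ((3 : ℝ) / 2)

lemma osculating_pointwise {c d W ε h t F : ℝ} (hW0 : 1 ≤ W) (hWsq : W ^ 2 = 1 + d ^ 2)
    (hε : 0 < ε) (hB1 : |c / (2 * W ^ 2) * (2 * d * h + t)| ≤ 1 / 2)
    (hB2 : |c / (2 * W ^ 2) * (2 * d * h + t)| * (|c| + 2 * ε) ≤ ε / 2)
    (hF : |F - d * h - c / 2 * h ^ 2| ≤ ε / 2 * h ^ 2) :
    ((c / W ^ 3 / 2 + ε) * (h ^ 2 + (t + d * h) ^ 2) < t / W → ¬ t + d * h ≤ F) ∧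
    (t / W < (c / W ^ 3 / 2 - ε) * (h ^ 2 + (t + d * h) ^ 2) → t + d * h ≤ F) := by
  have hWp : 0 < W := by linarith
  have hexp : c / W ^ 3 / 2 * (h ^ 2 + (t + d * h) ^ 2) * W
      = c / 2 * h ^ 2 + c / (2 * W ^ 2) * (2 * d * h + t) * t := by
    have : h ^ 2 + (t + d * h) ^ 2 = W ^ 2 * h ^ 2 + (2 * d * h + t) * t := by
      rw [hWsq]; ring
    rw [this]; field_simp
  have hWε : ε * h ^ 2 ≤ ε * (h ^ 2 + (t + d * h) ^ 2) * W := by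
    have h6 : ε * h ^ 2 ≤ ε * (h ^ 2 + (t + d * h) ^ 2) :=
      mul_le_mul_of_nonneg_left (le_add_of_nonneg_right (sq_nonneg _)) hε.le
    have h7 : 0 ≤ ε * (h ^ 2 + (t + d * h) ^ 2) := by positivity
    exact h6.trans (le_mul_of_one_le_right h7 hW0)
  rw [abs_le] at hF
  constructor
  · intro hlt hle
    rw [lt_div_iff₀ hWp, add_mul, add_mul, hexp] at hlt
    have := quadratic_remainder (h := h) (t := t) hε hB1 hB2 (by linarith)
    linarith [hF.2]
  · intro hlt
    rw [div_lt_iff₀ hWp, sub_mul, sub_mul, hexp] at hlt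
    have := quadratic_remainder (c := -c) (h := h) (t := -t) hε hB1 (by rwa [abs_neg])
      (by linarith)
    linarith [hF.1]

lemma oscAt_of_subgraph {E : Set (En 2)} (g : En 2 ≃ᵢ En 2) {ρ r : ℝ} {f : ℝ → ℝ}
    (hf : ∀ x ∈ Ioo (-ρ) ρ, DifferentiableAt ℝ f x)
    (hE : ∀ x ∈ Ioo (-ρ) ρ, ∀ z ∈ Ioo (-r) r, (g (mk2 x z) ∈ E ↔ z ≤ f x))
    {x₀ : ℝ} (hx₀ : x₀ ∈ Ioo (-ρ) ρ) (hr : |f x₀| < r) (hd : DifferentiableAt ℝ (deriv f) x₀) :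
    ∃ N, OscAt E (g (mk2 x₀ (f x₀))) N (curvGraph f x₀) := by
  set d := deriv f x₀ with hddef
  set c := deriv (deriv f) x₀ with hcdef
  set W := Real.sqrt (1 + d ^ 2) with hW
  have hWsq : W ^ 2 = 1 + d ^ 2 := Real.sq_sqrt (by positivity)
  have hW1 : 1 ≤ W := by rw [hW]; exact Real.one_le_sqrt.2 (by nlinarith [sq_nonneg d])
  have hW0 : 0 < W := by linarith
  have hκ : curvGraph f x₀ = c / W ^ 3 := by
    unfold curvGraph
    rw [← hddef, ← hcdef]
    congr 1
    rw [hW, Real.sqrt_eq_rpow, ← Real.rpow_mul_natCast (by positivity)]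
    norm_num
  set p := g (mk2 x₀ (f x₀)) with hp
  set b := g (mk2 (x₀ - d / W) (f x₀ + 1 / W)) with hb
  have hbp : dist b p ^ 2 = 1 := by
    rw [hb, hp, g_mk2_dist_sq]; field_simp; rw [hWsq]; ring
  set N := mk2 (b 0 - p 0) (b 1 - p 1) with hN
  have hZ : ∀ x z, ZF p N (g (mk2 x z)) = ((z - f x₀) - d * (x - x₀)) / W := by
    intro x z
    have h1 : dist (g (mk2 x z)) p ^ 2 = _ := g_mk2_dist_sq g x z x₀ (f x₀)
    have h2 : dist (g (mk2 x z)) b ^ 2 = _ :=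
      g_mk2_dist_sq g x z (x₀ - d / W) (f x₀ + 1 / W)
    have h4 : (d / W) ^ 2 + (1 / W) ^ 2 = 1 := by field_simp; rw [hWsq]; ring
    have h5 : ((z - f x₀) - d * (x - x₀)) / W = (z - f x₀) * (1 / W) - (d / W) * (x - x₀) := by
      field_simp
    rw [dist_sq] at h1 h2 hbp
    rw [h5]
    simp only [ZF, hN, mk2_zero, mk2_one]
    linear_combination h1 / 2 - h2 / 2 + hbp / 2 - h4 / 2
  refine ⟨N, ?_, fun ε hε => ?_⟩
  · unfold UnitV; simp only [hN, mk2_zero, mk2_one]; rw [← dist_sq]; exact hbp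
  have hX0 : g.symm p 0 = x₀ := by rw [hp]; simp
  have hZ0 : g.symm p 1 = f x₀ := by rw [hp]; simp
  have hX : Tendsto (fun q => g.symm q 0) (𝓝 p) (𝓝 x₀) := by
    have := ((continuous_coord 0).comp g.symm.continuous).tendsto p
    rwa [Function.comp_apply, hX0] at this
  have hZc : Tendsto (fun q => g.symm q 1) (𝓝 p) (𝓝 (f x₀)) := by
    have := ((continuous_coord 1).comp g.symm.continuous).tendsto p
    rwa [Function.comp_apply, hZ0] at this
  have ev1 := hX.eventually (isOpen_Ioo.mem_nhds hx₀)
  have ev2 := hZc.eventually (isOpen_Ioo.mem_nhds (abs_lt.1 hr))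
  have ev3 := hX.eventually (eventually_taylor_two
    (Filter.eventually_of_mem (isOpen_Ioo.mem_nhds hx₀) hf) hd.hasDerivAt (half_pos hε))
  have hBc : Tendsto (fun q => |c / (2 * W ^ 2) * (2 * d * (g.symm q 0 - x₀) +
      ((g.symm q 1 - f x₀) - d * (g.symm q 0 - x₀)))|) (𝓝 p) (𝓝 0) := by
    have h := ((((hX.sub_const x₀).const_mul (2 * d)).add
      ((hZc.sub_const (f x₀)).sub ((hX.sub_const x₀).const_mul d))).const_mul
      (c / (2 * W ^ 2))).abs
    simpa using h
  have hη : 0 < min (1 / 2) (ε / 2 / (|c| + 2 * ε)) := by positivity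
  have ev4 := hBc.eventually (gt_mem_nhds hη)
  filter_upwards [ev1, ev2, ev3, ev4] with q h1 h2 h3 h4
  have hq : q = g (mk2 (g.symm q 0) (g.symm q 1)) := by rw [mk2_eta]; simp
  generalize g.symm q 0 = x at h1 h2 h3 h4 hq
  generalize g.symm q 1 = z at h1 h2 h3 h4 hq
  have hB1 := h4.le.trans (min_le_left _ _)
  have hB2 := h4.le.trans (min_le_right _ _)
  rw [le_div_iff₀ (by positivity)] at hB2
  have hmem := hE x h1 z h2
  rw [← hq] at hmem
  have hd2 : dist q p ^ 2 = (x - x₀) ^ 2 + (z - f x₀) ^ 2 := by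
    rw [hq, hp, g_mk2_dist_sq]
  have hz2 : ZF p N q = ((z - f x₀) - d * (x - x₀)) / W := by rw [hq, hZ]
  rw [hd2, hz2, hκ, hmem]
  have key := osculating_pointwise (c := c) (d := d) (W := W) (ε := ε) (h := x - x₀)
    (t := (z - f x₀) - d * (x - x₀)) (F := f x - f x₀) hW1 hWsq hε hB1 hB2 h3
  simp only [sub_add_cancel, sub_le_sub_iff_right] at key
  exact key

lemma exists_isCurvFun (E : Set (En 2)) : ∃ κ, IsCurvFun E κ := by
  refine ⟨fun q => if h : ∃ k, ∃ N, OscAt E q N k then h.choose else 0, ?_⟩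
  intro g ρ r _ _ f hf hE x hx hfx hd
  rw [subgraph_iff] at hE
  obtain ⟨N, hN⟩ := oscAt_of_subgraph g hf.1 hE hx hfx hd
  have h : ∃ k, ∃ N, OscAt E (g (mk2 x (f x))) N k := ⟨_, N, hN⟩
  simp only [dif_pos h]
  obtain ⟨M, hM⟩ := h.choose_spec
  exact hM.unique hN

/-! ### Sets that are locally subgraphs of `C²` functions -/

lemma IsCurvFun.eq_curvGraph {E : Set (En 2)} {κ : En 2 → ℝ} (hκ : IsCurvFun E κ) {p n : En 2}
    (hn : UnitV n) {φ : ℝ → ℝ} {x₀ δ C : ℝ} (hδ : 0 < δ)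
    (hmem : ∀ x z, |x - x₀| < δ → |z - φ x₀| < δ → (ptF p n x z ∈ E ↔ z ≤ φ x))
    (hdiff : ∀ x, |x - x₀| < δ → DifferentiableAt ℝ φ x)
    (hlip : ∀ x y, |x - x₀| < δ → |y - x₀| < δ → |deriv φ x - deriv φ y| ≤ C * |x - y|)
    (hd : DifferentiableAt ℝ (deriv φ) x₀) : κ (ptF p n x₀ (φ x₀)) = curvGraph φ x₀ := by
  have hder : deriv (fun x => φ (x₀ + x) - φ x₀) = fun x => deriv φ (x₀ + x) := by
    ext x
    rw [deriv_sub_const, deriv_comp_const_add]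
  have key := hκ (frameIso (ptF p n x₀ (φ x₀)) n hn) δ δ hδ hδ (fun x => φ (x₀ + x) - φ x₀) ?_ ?_
    0 ⟨by linarith, hδ⟩ (by simpa using hδ) ?_
  · rw [hder, deriv_comp_const_add, frameIso_mk2, ptF_ptF] at key
    simpa [curvGraph] using key
  · refine ⟨fun x hx => ?_, C.toNNReal, LipschitzOnWith.of_dist_le_mul fun x hx y hy => ?_⟩
    · have h1 := hdiff (x₀ + x) (by rw [add_sub_cancel_left]; exact abs_lt.2 hx)
      exact (h1.hasDerivAt.comp_const_add x₀ x).differentiableAt.sub_const _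
    · rw [hder, Real.dist_eq, Real.dist_eq]
      have := hlip (x₀ + x) (x₀ + y) (by rw [add_sub_cancel_left]; exact abs_lt.2 hx)
        (by rw [add_sub_cancel_left]; exact abs_lt.2 hy)
      rw [add_sub_add_left_eq_sub] at this
      exact this.trans (mul_le_mul_of_nonneg_right (Real.le_coe_toNNReal C) (abs_nonneg _))
  · rw [subgraph_iff]
    intro x hx z hz
    rw [frameIso_mk2, ptF_ptF, hmem _ _ (by rw [add_sub_cancel_left]; exact abs_lt.2 hx)
      (by rw [add_sub_cancel_left]; exact abs_lt.2 hz), le_sub_iff_add_le']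
  · rw [hder]
    rw [← add_zero x₀] at hd
    exact (hd.hasDerivAt.comp_const_add x₀ 0).differentiableAt

/-- Near `q`, the set `E` is the subgraph of `φ` in the frame `p, n`. -/
def SubgraphAt (E : Set (En 2)) (q p n : En 2) (φ : ℝ → ℝ) : Prop :=
  UnitV n ∧ ContDiff ℝ 2 φ ∧ ∀ᶠ q' in 𝓝 q, (q' ∈ E ↔ ZF p n q' ≤ φ (XF p n q'))

lemma SubgraphAt.exists_box {E : Set (En 2)} {q p n : En 2} {φ : ℝ → ℝ}
    (h : SubgraphAt E q p n φ) : ∃ δ > 0, ∀ x z, |x - XF p n q| < δ → |z - ZF p n q| < δ →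
      (ptF p n x z ∈ E ↔ z ≤ φ x) := by
  obtain ⟨hn, -, he⟩ := h
  have ht := (continuous_ptF p n).tendsto (XF p n q, ZF p n q)
  simp only [ptF_XF_ZF hn] at ht
  obtain ⟨δ, hδ, hb⟩ := Metric.eventually_nhds_iff.1 (ht.eventually he)
  refine ⟨δ, hδ, fun x z hx hz => ?_⟩
  have := hb (y := (x, z)) (by rw [Prod.dist_eq]; exact max_lt hx hz)
  simpa [XF_ptF hn, ZF_ptF hn] using this

lemma SubgraphAt.curv_eq {E : Set (En 2)} {q p n : En 2} {φ : ℝ → ℝ}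
    (h : SubgraphAt E q p n φ) (hq : ZF p n q = φ (XF p n q)) {κ : En 2 → ℝ}
    (hκ : IsCurvFun E κ) : κ q = curvGraph φ (XF p n q) := by
  obtain ⟨δ, hδ, hb⟩ := h.exists_box
  obtain ⟨hn, hφ, -⟩ := h
  have hφ1 : ContDiff ℝ 1 (deriv φ) := by
    have h2 : ContDiff ℝ (1 + 1) φ := by norm_num; exact hφ
    exact (contDiff_succ_iff_deriv.1 h2).2.2
  obtain ⟨K, t, ht, hK⟩ := (hφ1.contDiffAt (x := XF p n q)).exists_lipschitzOnWith
  obtain ⟨δ', hδ', hb'⟩ := Metric.mem_nhds_iff.1 ht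
  have key := hκ.eq_curvGraph (p := p) (n := n) hn (φ := φ) (x₀ := XF p n q) (C := K)
    (lt_min hδ hδ')
    (fun x z hx hz => hb x z (hx.trans_le (min_le_left _ _))
      (by rw [hq]; exact hz.trans_le (min_le_left _ _)))
    (fun x _ => hφ.differentiable (by norm_num) x)
    (fun x y hx hy => by
      have := hK.dist_le_mul x (hb' (hx.trans_le (min_le_right _ _))) y
        (hb' (hy.trans_le (min_le_right _ _)))
      simpa [Real.dist_eq] using this)
    (hφ1.differentiable (by norm_num) _)
  rw [← hq, ptF_XF_ZF hn] at key
  exact key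

lemma SubgraphAt.zF_eq {E : Set (En 2)} {q p n : En 2} {φ : ℝ → ℝ}
    (h : SubgraphAt E q p n φ) (hq : q ∈ frontier E) : ZF p n q = φ (XF p n q) := by
  obtain ⟨hn, hφ, he⟩ := h
  have hc1 : Continuous fun q => φ (XF p n q) := hφ.continuous.comp (continuous_XF p n)
  have hc2 := continuous_ZF p n
  rcases lt_trichotomy (ZF p n q) (φ (XF p n q)) with hlt | heq | hlt
  · have h2 : ∀ᶠ q' in 𝓝 q, ZF p n q' < φ (XF p n q') :=
      (isOpen_lt hc2 hc1).mem_nhds hlt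
    have : q ∈ interior E := mem_interior_iff_mem_nhds.2
      ((he.and h2).mono fun q' hq' => hq'.1.2 hq'.2.le)
    exact absurd this hq.2
  · exact heq
  · have h2 : ∀ᶠ q' in 𝓝 q, φ (XF p n q') < ZF p n q' :=
      (isOpen_lt hc1 hc2).mem_nhds hlt
    have : ¬ q ∈ closure E := by
      rw [mem_closure_iff_frequently, not_frequently]
      exact (he.and h2).mono fun q' hq' hm => absurd (hq'.1.1 hm) (not_le.2 hq'.2)
    exact absurd hq.1 this

lemma isC2Set_of_subgraphAt {E : Set (En 2)} (hb : Bornology.IsBounded E)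
    (h : ∀ q, ∃ p n φ, SubgraphAt E q p n φ) : IsC2Set E := by
  have hcl : IsClosed E := by
    refine isClosed_of_closure_subset fun q hq => ?_
    by_contra hqE
    obtain ⟨p, n, φ, hn, hφ, he⟩ := h q
    have hlt : φ (XF p n q) < ZF p n q := by
      by_contra! hle
      exact hqE (he.self_of_nhds.2 hle)
    have h2 : ∀ᶠ q' in 𝓝 q, φ (XF p n q') < ZF p n q' :=
      (isOpen_lt (hφ.continuous.comp (continuous_XF p n)) (continuous_ZF p n)).mem_nhds hlt
    rw [mem_closure_iff_frequently] at hq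
    exact hq ((he.and h2).mono fun q' hq' hm => absurd (hq'.1.1 hm) (not_le.2 hq'.2))
  refine ⟨Metric.isCompact_of_isClosed_isBounded hcl hb, ?_, ?_⟩
  · refine Subset.antisymm (fun q hq => ?_) (closure_minimal interior_subset hcl)
    obtain ⟨p, n, φ, hs⟩ := h q
    obtain ⟨hn, hφ, he⟩ := hs
    have hle := he.self_of_nhds.1 hq
    have ht : Tendsto (fun t : ℝ => ptF p n (XF p n q) (ZF p n q - t)) (𝓝[>] 0) (𝓝 q) := by
      have : Continuous fun t : ℝ => ptF p n (XF p n q) (ZF p n q - t) :=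
        (continuous_ptF p n).comp (f := fun t : ℝ => (XF p n q, ZF p n q - t)) (by fun_prop)
      have h := (this.tendsto 0).mono_left (nhdsWithin_le_nhds (s := Ioi 0))
      simpa [ptF_XF_ZF hn] using h
    refine mem_closure_of_tendsto ht ?_
    filter_upwards [ht.eventually he.eventually_nhds, self_mem_nhdsWithin] with t h1 ht0
    have ht0 : 0 < t := ht0
    have h2 : ∀ᶠ q' in 𝓝 (ptF p n (XF p n q) (ZF p n q - t)), ZF p n q' < φ (XF p n q') := by
      refine (isOpen_lt (continuous_ZF p n) (hφ.continuous.comp (continuous_XF p n))).mem_nhds ?_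
      rw [Set.mem_ofPred_eq, Function.comp_apply, XF_ptF hn, ZF_ptF hn]
      linarith
    exact mem_interior_iff_mem_nhds.2 ((h1.and h2).mono fun q' hq' => hq'.1.2 hq'.2.le)
  · intro q hq
    obtain ⟨p, n, φ, hs⟩ := h q
    have hz := hs.zF_eq hq
    obtain ⟨δ, hδ, hbx⟩ := hs.exists_box
    obtain ⟨hn, hφ, -⟩ := hs
    refine ⟨frameIso q n hn, δ, δ, fun x => φ (XF p n q + x) - φ (XF p n q), hδ, hδ, ?_, ?_, ?_⟩
    · exact ((hφ.comp (contDiff_const.add contDiff_id)).sub contDiff_const).contDiffOn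
    · rw [frameIso_mk2, ptF_origin]
    · rw [subgraph_iff]
      intro x hx z hz'
      have hq' : ptF q n x z = ptF p n (XF p n q + x) (ZF p n q + z) := by
        rw [← ptF_ptF, ptF_XF_ZF hn]
      rw [frameIso_mk2, hq', hbx _ _ (by rw [add_sub_cancel_left]; exact abs_lt.2 hx)
        (by rw [add_sub_cancel_left]; exact abs_lt.2 hz'), le_sub_iff_add_le', ← hz]

/-! ### Compact sets with `C²` boundary satisfy the sphere condition for small radii -/

/-- `A` has interior and exterior tangent balls of radius `R` at `q`. -/
def SphereAt (A : Set (En 2)) (R : ℝ) (q : En 2) : Prop :=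
  ∃ p' p'' : En 2, dist q p' = R ∧ dist q p'' = R ∧ ball p' R ⊆ A ∧ ball p'' R ∩ A = ∅

lemma tangent_ball_aux {d K R W h k : ℝ} (hW : 1 ≤ W) (hWsq : W ^ 2 = 1 + d ^ 2) (hR : 0 < R)
    (hKR : 2 * K * R ≤ 1)
    (hb : (h - R * d / W) ^ 2 + (k + R / W) ^ 2 < R ^ 2) :
    |h| < 2 * R ∧ |k| < 2 * R ∧ K * h ^ 2 < d * h - k := by
  have hWp : 0 < W := by linarith
  have h1 : (R * d / W) ^ 2 + (R / W) ^ 2 = R ^ 2 := by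
    field_simp; rw [hWsq]; ring
  have a1 : |h - R * d / W| < R := abs_lt_of_sq_lt_sq (by nlinarith [sq_nonneg (k + R / W)]) hR.le
  have a2 : |k + R / W| < R := abs_lt_of_sq_lt_sq (by nlinarith [sq_nonneg (h - R * d / W)]) hR.le
  have a3 : |R * d / W| ≤ R := abs_le_of_sq_le_sq (by nlinarith [sq_nonneg (R / W)]) hR.le
  have a4 : |R / W| ≤ R := abs_le_of_sq_le_sq (by nlinarith [sq_nonneg (R * d / W)]) hR.le
  rw [abs_lt] at a1 a2
  rw [abs_le] at a3 a4
  refine ⟨abs_lt.2 ⟨by linarith, by linarith⟩, abs_lt.2 ⟨by linarith, by linarith⟩, ?_⟩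
  have h2 : h ^ 2 + k ^ 2 < 2 * R * ((d * h - k) / W) := by
    have : (h - R * d / W) ^ 2 + (k + R / W) ^ 2
        = h ^ 2 + k ^ 2 - 2 * R * ((d * h - k) / W) + ((R * d / W) ^ 2 + (R / W) ^ 2) := by
      ring
    rw [this, h1] at hb
    linarith
  have h3 : 0 < (d * h - k) / W := by
    by_contra! hle
    nlinarith [sq_nonneg h, sq_nonneg k]
  have h4 : 0 < d * h - k := by
    have := mul_pos h3 hWp
    rwa [div_mul_cancel₀ _ hWp.ne'] at this
  have h5 : (d * h - k) / W ≤ d * h - k := div_le_self h4.le hW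
  have h6 : h ^ 2 < 2 * R * (d * h - k) := by nlinarith [sq_nonneg k]
  rcases le_or_gt K 0 with hK | hK
  · nlinarith [sq_nonneg h]
  · calc K * h ^ 2 < K * (2 * R * (d * h - k)) := mul_lt_mul_of_pos_left h6 hK
      _ = 2 * K * R * (d * h - k) := by ring
      _ ≤ 1 * (d * h - k) := mul_le_mul_of_nonneg_right hKR h4.le
      _ = d * h - k := one_mul _

lemma sphereAt_of_graph {A : Set (En 2)} (g : En 2 ≃ᵢ En 2) {ρ r : ℝ} {f : ℝ → ℝ}
    (hA : ∀ x ∈ Ioo (-ρ) ρ, ∀ z ∈ Ioo (-r) r, (g (mk2 x z) ∈ A ↔ z ≤ f x))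
    {x₀ d K R : ℝ} (hR : 0 < R) (hKR : 2 * K * R ≤ 1) (hx : |x₀| + 2 * R ≤ ρ)
    (hz : |f x₀| + 2 * R ≤ r)
    (hq : ∀ y ∈ Ioo (-ρ) ρ, |f y - f x₀ - d * (y - x₀)| ≤ K * (y - x₀) ^ 2) :
    SphereAt A R (g (mk2 x₀ (f x₀))) := by
  set W := Real.sqrt (1 + d ^ 2) with hW
  have hWsq : W ^ 2 = 1 + d ^ 2 := Real.sq_sqrt (by positivity)
  have hW1 : 1 ≤ W := by rw [hW]; exact Real.one_le_sqrt.2 (by nlinarith [sq_nonneg d])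
  have hWp : 0 < W := by linarith
  have h1 : (R * d / W) ^ 2 + (R / W) ^ 2 = R ^ 2 := by
    field_simp; rw [hWsq]; ring
  have hx1 := neg_abs_le x₀
  have hx2 := le_abs_self x₀
  have hz1 := neg_abs_le (f x₀)
  have hz2 := le_abs_self (f x₀)
  refine ⟨g (mk2 (x₀ + R * d / W) (f x₀ - R / W)), g (mk2 (x₀ - R * d / W) (f x₀ + R / W)),
    ?_, ?_, ?_, ?_⟩
  · rw [← sq_eq_sq₀ dist_nonneg hR.le, g_mk2_dist_sq]; linarith
  · rw [← sq_eq_sq₀ dist_nonneg hR.le, g_mk2_dist_sq]; linarith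
  · intro q hqb
    obtain ⟨v, rfl⟩ := g.surjective q
    rw [← mk2_eta v] at hqb ⊢
    rw [mem_ball_sq hR, g_mk2_dist_sq] at hqb
    obtain ⟨b1, b2, b3⟩ := tangent_ball_aux (h := v 0 - x₀) (k := v 1 - f x₀) hW1 hWsq hR hKR
      (by convert hqb using 3 <;> ring)
    rw [abs_lt] at b1 b2
    have hv0 : v 0 ∈ Ioo (-ρ) ρ := ⟨by linarith, by linarith⟩
    refine (hA _ hv0 _ ⟨by linarith, by linarith⟩).2 ?_
    linarith [(abs_le.1 (hq _ hv0)).1]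
  · rw [← disjoint_iff_inter_eq_empty, Set.disjoint_left]
    intro q hqb
    obtain ⟨v, rfl⟩ := g.surjective q
    rw [← mk2_eta v] at hqb ⊢
    rw [mem_ball_sq hR, g_mk2_dist_sq] at hqb
    obtain ⟨b1, b2, b3⟩ := tangent_ball_aux (h := -(v 0 - x₀)) (k := -(v 1 - f x₀)) hW1 hWsq hR hKR
      (by convert hqb using 1; ring)
    rw [abs_lt] at b1 b2
    have hv0 : v 0 ∈ Ioo (-ρ) ρ := ⟨by linarith, by linarith⟩
    rw [hA _ hv0 _ ⟨by linarith, by linarith⟩, not_le]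
    linarith [(abs_le.1 (hq _ hv0)).2]

lemma exists_sphereAt_nhds {A : Set (En 2)} (hA : IsC2Set A) {p : En 2} (hp : p ∈ frontier A) :
    ∃ t ∈ 𝓝 p, ∃ R₀ > 0, ∀ q ∈ t ∩ frontier A, ∀ R, 0 < R → R ≤ R₀ → SphereAt A R q := by
  have hcl : IsClosed A := hA.1.isClosed
  obtain ⟨g, ρ, r, f, hρ, hr, hf, hgp, hE⟩ := hA.2.2 p hp
  rw [subgraph_iff] at hE
  have hfat : ∀ x ∈ Ioo (-ρ) ρ, ContDiffAt ℝ 2 f x := fun x hx =>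
    hf.contDiffAt (isOpen_Ioo.mem_nhds hx)
  -- points of the boundary lie on the graph
  have hgraph : ∀ x ∈ Ioo (-ρ) ρ, ∀ z ∈ Ioo (-r) r, g (mk2 x z) ∈ frontier A → z = f x := by
    intro x hx z hz hq
    have hle := (hE x hx z hz).1 (hcl.frontier_subset hq)
    refine le_antisymm hle ?_
    by_contra! hlt
    refine hq.2 (mem_interior_iff_mem_nhds.2 ?_)
    have hX : Tendsto (fun q => g.symm q 0) (𝓝 (g (mk2 x z))) (𝓝 x) := by
      have := ((continuous_coord 0).comp g.symm.continuous).tendsto (g (mk2 x z))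
      rwa [Function.comp_apply, g.symm_apply_apply] at this
    have hZ : Tendsto (fun q => g.symm q 1) (𝓝 (g (mk2 x z))) (𝓝 z) := by
      have := ((continuous_coord 1).comp g.symm.continuous).tendsto (g (mk2 x z))
      rwa [Function.comp_apply, g.symm_apply_apply] at this
    have hfX : Tendsto (fun q => f (g.symm q 0)) (𝓝 (g (mk2 x z))) (𝓝 (f x)) :=
      (hfat x hx).continuousAt.tendsto.comp hX
    filter_upwards [hX.eventually (isOpen_Ioo.mem_nhds hx), hZ.eventually
      (isOpen_Ioo.mem_nhds hz), hZ.eventually_lt hfX hlt] with q h1 h2 h3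
    have := (hE _ h1 _ h2).2 h3.le
    rwa [mk2_eta, g.apply_symm_apply] at this
  have h00 : (0 : ℝ) ∈ Ioo (-ρ) ρ := ⟨by linarith, hρ⟩
  have hf0 : f 0 = 0 := (hgraph 0 h00 0 ⟨by linarith, hr⟩ (by rwa [hgp])).symm
  have hd1 : ContDiffAt ℝ 1 (deriv f) 0 := 
    (hf.deriv_of_isOpen isOpen_Ioo (by norm_num)).contDiffAt (isOpen_Ioo.mem_nhds h00)
  obtain ⟨K, s, hs, hK⟩ := hd1.exists_lipschitzOnWith
  obtain ⟨δ, hδ, hδs⟩ := Metric.mem_nhds_iff.1 hs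
  set a := min δ ρ with ha
  have ha0 : 0 < a := lt_min hδ hρ
  have haρ : ∀ x ∈ Ioo (-a) a, x ∈ Ioo (-ρ) ρ := fun x hx =>
    ⟨by linarith [hx.1, min_le_right δ ρ], by linarith [hx.2, min_le_right δ ρ]⟩
  have hKa : ∀ x ∈ Ioo (-a) a, ∀ y ∈ Ioo (-a) a, |deriv f y - deriv f x| ≤ K * |y - x| := by
    have : ∀ x ∈ Ioo (-a) a, x ∈ s := fun x hx => hδs (by
      rw [mem_ball, Real.dist_eq, sub_zero]
      exact (abs_lt.2 hx).trans_le (min_le_left _ _))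
    intro x hx y hy
    simpa [Real.dist_eq] using hK.dist_le_mul y (this y hy) x (this x hx)
  have hquad : ∀ x ∈ Ioo (-a) a, ∀ y ∈ Ioo (-a) a,
      |f y - f x - deriv f x * (y - x)| ≤ K * (y - x) ^ 2 := by
    intro x hx y hy
    have hsub : uIcc x y ⊆ Ioo (-a) a := ordConnected_Ioo.uIcc_subset hx hy
    have hφ : ∀ u ∈ uIcc x y, HasDerivWithinAt (fun u => f u - deriv f x * (u - x))
        (deriv f u - deriv f x) (uIcc x y) u := by
      intro u hu
      have hd := ((hfat u (haρ u (hsub hu))).differentiableAt (by norm_num)).hasDerivAt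
      have hid : HasDerivAt (fun y : ℝ => y - x) 1 u := (hasDerivAt_id u).sub_const x
      exact ((hd.sub (hid.const_mul (deriv f x))).congr_deriv (by ring)).hasDerivWithinAt
    have hb : ∀ u ∈ uIcc x y, ‖deriv f u - deriv f x‖ ≤ K * |y - x| := fun u hu =>
      (hKa x hx u (hsub hu)).trans
        (mul_le_mul_of_nonneg_left (abs_sub_left_of_mem_uIcc hu) K.2)
    have := (convex_uIcc x y).norm_image_sub_le_of_norm_hasDerivWithin_le hφ hb
      left_mem_uIcc right_mem_uIcc
    simp only [sub_self, mul_zero, Real.norm_eq_abs] at this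
    rw [mul_assoc, abs_mul_abs_self] at this
    convert this using 2 <;> ring_nf
  have hcont : Tendsto (fun q => g.symm q 0) (𝓝 p) (𝓝 0) := by
    have := ((continuous_coord 0).comp g.symm.continuous).tendsto p
    rw [← hgp] at this ⊢
    rwa [Function.comp_apply, g.symm_apply_apply] at this
  have hcont1 : Tendsto (fun q => g.symm q 1) (𝓝 p) (𝓝 0) := by
    have := ((continuous_coord 1).comp g.symm.continuous).tendsto p
    rw [← hgp] at this ⊢
    rwa [Function.comp_apply, g.symm_apply_apply] at this
  refine ⟨_, inter_mem (hcont.eventually (Ioo_mem_nhds (show -(a / 2) < 0 by linarith)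
    (half_pos ha0))) (hcont1.eventually (Ioo_mem_nhds (show -(r / 2) < 0 by linarith)
    (half_pos hr))), min (a / 4) (min (r / 4) (1 / (2 * (K + 1)))), ?_, ?_⟩
  · have : (0 : ℝ) ≤ K := K.2
    positivity
  · rintro q ⟨⟨h1, h2⟩, hq⟩ R hR hRle
    have hqe : q = g (mk2 (g.symm q 0) (g.symm q 1)) := by rw [mk2_eta]; simp
    have h1 : g.symm q 0 ∈ Ioo (-(a / 2)) (a / 2) := h1
    have h2 : g.symm q 1 ∈ Ioo (-(r / 2)) (r / 2) := h2
    generalize g.symm q 0 = x at h1 hqe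
    generalize g.symm q 1 = z at h2 hqe
    have hxa : x ∈ Ioo (-a) a := ⟨by linarith [h1.1], by linarith [h1.2]⟩
    have hz := hgraph x (haρ x hxa) z ⟨by linarith [h2.1], by linarith [h2.2]⟩ (by rwa [← hqe])
    rw [hqe, hz]
    have hR1 := hRle.trans (min_le_left _ _)
    have hR2 := hRle.trans ((min_le_right _ _).trans (min_le_left _ _))
    have hR3 := hRle.trans ((min_le_right _ _).trans (min_le_right _ _))
    have hK0 : (0 : ℝ) ≤ K := K.2
    rw [le_div_iff₀ (by positivity)] at hR3
    refine sphereAt_of_graph g (ρ := a) (r := r) (K := K) (d := deriv f x)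
      (fun x hx => hE x (haρ x hx)) hR (by nlinarith) ?_ ?_ (hquad x hxa)
    · linarith [abs_lt.2 h1]
    · rw [← hz]; linarith [abs_lt.2 h2]

lemma exists_mem_UR {A : Set (En 2)} (hA : IsC2Set A) :
    ∃ R₀ > 0, ∀ R, 0 < R → R ≤ R₀ → A ∈ UR 2 R := by
  have hc : IsCompact (frontier A) := hA.1.of_isClosed_subset isClosed_frontier
    hA.1.isClosed.frontier_subset
  have : ∃ R₀ > 0, ∀ q ∈ frontier A, ∀ R, 0 < R → R ≤ R₀ → SphereAt A R q := by
    have h := hc.induction_on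
      (p := fun s => ∃ R₀ > 0, ∀ q ∈ s ∩ frontier A, ∀ R, 0 < R → R ≤ R₀ → SphereAt A R q)
      ⟨1, one_pos, by simp⟩
      (fun s t hst ⟨R₀, h0, h⟩ => ⟨R₀, h0, fun q hq => h q ⟨hst hq.1, hq.2⟩⟩)
      (fun s t ⟨R₁, h1, h1'⟩ ⟨R₂, h2, h2'⟩ => ⟨min R₁ R₂, lt_min h1 h2, fun q hq R hR hle =>
        hq.1.elim (fun h => h1' q ⟨h, hq.2⟩ R hR (hle.trans (min_le_left _ _)))
          (fun h => h2' q ⟨h, hq.2⟩ R hR (hle.trans (min_le_right _ _)))⟩)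
      (fun p hp => by
        obtain ⟨t, ht, h⟩ := exists_sphereAt_nhds hA hp
        exact ⟨t, mem_nhdsWithin_of_mem_nhds ht, h⟩)
    simpa using h
  obtain ⟨R₀, h0, h⟩ := this
  exact ⟨R₀, h0, fun R hR hle => ⟨hA.1.isClosed, hA.1.isBounded, fun q hq => h q hq R hR hle⟩⟩

/-! ### The `L¹` distance and the diagonal arguments -/

/-- The `L¹` distance between the characteristic functions of two sets. -/
def distL1 (A B : Set (En 2)) : ℝ :=
  ∫ x, |A.indicator (fun _ => (1 : ℝ)) x - B.indicator (fun _ => (1 : ℝ)) x|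

lemma distL1_nonneg (A B : Set (En 2)) : 0 ≤ distL1 A B :=
  integral_nonneg fun _ => abs_nonneg _

lemma distL1_self (A : Set (En 2)) : distL1 A A = 0 := by simp [distL1]

lemma integrable_indicator_of_mem_MM {A : Set (En 2)} (hA : A ∈ MM) :
    Integrable (A.indicator fun _ => (1 : ℝ)) :=
  (integrable_indicator_iff hA.1).2 (integrableOn_const hA.2.measure_lt_top.ne)

lemma distL1_triangle {A B C : Set (En 2)} (hA : A ∈ MM) (hB : B ∈ MM) (hC : C ∈ MM) :
    distL1 A C ≤ distL1 A B + distL1 B C := by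
  have iA := integrable_indicator_of_mem_MM hA
  have iB := integrable_indicator_of_mem_MM hB
  have iC := integrable_indicator_of_mem_MM hC
  exact (integral_mono (iA.sub iC).abs ((iA.sub iB).abs.add (iB.sub iC).abs)
    fun x => abs_sub_le _ _ _).trans_eq (integral_add (iA.sub iB).abs (iB.sub iC).abs)

lemma F0bar_le_liminf {p : ℝ} {E : Set (En 2)} (hE : E ∈ MM) {r : ℕ → ℝ} (hr : ∀ h, 0 < r h)
    (happrox : ∀ R > 0, ∀ F ∈ MM, FR p R F < ⊤ → ∀ δ > 0, ∃ A ∈ MM, distL1 A F ≤ δ ∧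
      F0 p A ≤ FR p R F + ENNReal.ofReal δ)
    {Eh : ℕ → Set (En 2)} (hEh : ∀ h, Eh h ∈ MM) (hconv : L1Conv Eh E) :
    F0bar p E ≤ liminf (fun h => FR p (r h) (Eh h)) atTop := by
  have hex : ∀ h : ℕ, ∃ A ∈ MM, distL1 A (Eh h) ≤ 1 / ((h : ℝ) + 1) ∧
      F0 p A ≤ FR p (r h) (Eh h) + ENNReal.ofReal (1 / ((h : ℝ) + 1)) := by
    intro h
    rcases lt_or_eq_of_le (le_top (a := FR p (r h) (Eh h))) with hlt | heq
    · exact happrox _ (hr h) _ (hEh h) hlt _ (by positivity)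
    · exact ⟨Eh h, hEh h, by rw [distL1_self]; positivity, by rw [heq]; simp⟩
  choose A hA hd hF using hex
  have h0 : Tendsto (fun h : ℕ => 1 / ((h : ℝ) + 1)) atTop (𝓝 0) :=
    tendsto_one_div_add_atTop_nhds_zero_nat
  have hAE : L1Conv A E := by
    have hconv' : Tendsto (fun h => distL1 (Eh h) E) atTop (𝓝 0) := hconv
    refine squeeze_zero (fun h => distL1_nonneg (A h) E)
      (fun h => (distL1_triangle (hA h) (hEh h) hE).trans (add_le_add_left (hd h) _)) ?_
    simpa using h0.add hconv'
  calc F0bar p E ≤ liminf (fun h => F0 p (A h)) atTop :=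
        iInf_le_of_le A (iInf_le_of_le hA (iInf_le_of_le hAE le_rfl))
    _ ≤ liminf ((fun h => FR p (r h) (Eh h)) + fun h : ℕ => ENNReal.ofReal (1 / ((h : ℝ) + 1)))
        atTop := liminf_le_liminf (Eventually.of_forall hF)
    _ = _ := ENNReal.liminf_add_of_right_tendsto_zero
        (by simpa using ENNReal.tendsto_ofReal h0) _

lemma exists_recovery_sequence {p : ℝ} {E : Set (En 2)} (hE : E ∈ MM) {r : ℕ → ℝ}
    (hr : ∀ h, 0 < r h) (hr0 : Tendsto r atTop (𝓝 0)) :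
    ∃ Eh : ℕ → Set (En 2), (∀ h, Eh h ∈ MM) ∧ L1Conv Eh E ∧
      limsup (fun h => FR p (r h) (Eh h)) atTop ≤ F0bar p E := by
  rcases eq_or_ne (F0bar p E) ⊤ with htop | htop
  · exact ⟨fun _ => E, fun _ => hE, by simp [L1Conv], by rw [htop]; exact le_top⟩
  have hex : ∀ k : ℕ, ∃ B ∈ MM, distL1 B E ≤ 1 / ((k : ℝ) + 1) ∧
      F0 p B < F0bar p E + ENNReal.ofReal (1 / ((k : ℝ) + 1)) := by
    intro k
    have hk : (0 : ℝ) < 1 / ((k : ℝ) + 1) := by positivity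
    have hlt : F0bar p E < F0bar p E + ENNReal.ofReal (1 / ((k : ℝ) + 1)) :=
      ENNReal.lt_add_right htop (by simpa using hk)
    obtain ⟨A, hA⟩ := iInf_lt_iff.1 (show (⨅ (A : ℕ → Set (En 2)) (_ : ∀ h, A h ∈ MM)
      (_ : L1Conv A E), liminf (fun h => F0 p (A h)) atTop) < _ from hlt)
    obtain ⟨hAM, hA⟩ := iInf_lt_iff.1 hA
    obtain ⟨hAE, hA⟩ := iInf_lt_iff.1 hA
    have hev : ∀ᶠ h in atTop, distL1 (A h) E < 1 / ((k : ℝ) + 1) :=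
      Tendsto.eventually (show Tendsto (fun h => distL1 (A h) E) atTop (𝓝 0) from hAE)
        (gt_mem_nhds hk)
    obtain ⟨h, h1, h2⟩ := ((frequently_lt_of_liminf_lt (by isBoundedDefault) hA).and_eventually
      hev).exists
    exact ⟨A h, hAM h, h2.le, h1⟩
  choose B hB hd hF using hex
  have hC2 : ∀ k, IsC2Set (B k) := fun k => by
    by_contra hcon
    have := hF k
    rw [F0, if_neg hcon] at this
    exact not_top_lt this
  choose R₀ hR₀ hUR using fun k => exists_mem_UR (hC2 k)
  set κ : ℕ → ℕ := fun h => Nat.findGreatest (fun k => r h ≤ R₀ k) h with hκ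
  have hrk : ∀ k, ∀ᶠ h in atTop, r h ≤ R₀ k := fun k =>
    (hr0.eventually (gt_mem_nhds (hR₀ k))).mono fun h hh => hh.le
  have hκ0 : ∀ᶠ h in atTop, r h ≤ R₀ (κ h) := (hrk 0).mono fun h hh =>
    Nat.findGreatest_spec (P := fun k => r h ≤ R₀ k) (Nat.zero_le h) hh
  have hκt : Tendsto κ atTop atTop := tendsto_atTop.2 fun k =>
    ((hrk k).and (eventually_ge_atTop k)).mono fun h hh => Nat.le_findGreatest hh.2 hh.1
  have h0 : Tendsto (fun h => 1 / ((κ h : ℝ) + 1)) atTop (𝓝 0) :=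
    tendsto_one_div_add_atTop_nhds_zero_nat.comp hκt
  refine ⟨fun h => B (κ h), fun h => hB _, ?_, ?_⟩
  · exact squeeze_zero (fun h => distL1_nonneg (B (κ h)) E) (fun h => hd (κ h)) h0
  · have hle : ∀ᶠ h in atTop, FR p (r h) (B (κ h)) ≤
        F0bar p E + ENNReal.ofReal (1 / ((κ h : ℝ) + 1)) := by
      filter_upwards [hκ0] with h hh
      have := (hF (κ h)).le
      rw [F0, if_pos (hC2 _)] at this
      rw [FR, if_pos (hUR _ _ (hr h) hh)]
      exact this
    have ht : Tendsto (fun h => F0bar p E + ENNReal.ofReal (1 / ((κ h : ℝ) + 1))) atTop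
        (𝓝 (F0bar p E)) := by
      simpa using tendsto_const_nhds.add (ENNReal.tendsto_ofReal h0)
    exact (limsup_le_limsup hle).trans ht.limsup_eq.le

/-! ### `C²` approximation of a `C^{1,1}` function, affine near the endpoints -/

lemma exists_continuous_approx {g : ℝ → ℝ} {a b L τ : ℝ} (hab : a < b) (hg : Measurable g)
    (hL0 : 0 ≤ L) (hL : ∀ x ∈ Ioo a b, |g x| ≤ L) (hτ : 0 < τ) :
    ∃ (h : ℝ → ℝ) (η : ℝ), Continuous h ∧ 0 < η ∧ η ≤ (b - a) / 3 ∧ (∀ x, |h x| ≤ L) ∧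
      (∀ x ≤ a + η, h x = 0) ∧ (∀ x, b - η ≤ x → h x = 0) ∧
      ∫ x in Ioo a b, |h x - g x| ≤ τ := by
  obtain ⟨η, hη, hη1, hη2⟩ : ∃ η > 0, η ≤ (b - a) / 6 ∧ L * (4 * η) ≤ τ / 2 := by
    refine ⟨min ((b - a) / 6) (τ / (8 * (L + 1))), ?_, min_le_left _ _, ?_⟩
    · have : 0 < b - a := sub_pos.2 hab
      positivity
    · have h1 := min_le_right ((b - a) / 6) (τ / (8 * (L + 1)))
      rw [le_div_iff₀ (by positivity)] at h1
      have h2 : 0 ≤ min ((b - a) / 6) (τ / (8 * (L + 1))) := by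
        have : 0 < b - a := sub_pos.2 hab
        positivity
      nlinarith
  set J := Ioo (a + 2 * η) (b - 2 * η) with hJ
  have hJs : J ⊆ Ioo a b := Ioo_subset_Ioo (by linarith) (by linarith)
  set G := J.indicator g with hG
  have hGL : ∀ x, |G x| ≤ L := by
    intro x
    by_cases hx : x ∈ J
    · rw [hG, indicator_of_mem hx]; exact hL x (hJs hx)
    · rw [hG, indicator_of_notMem hx, abs_zero]; exact hL0
  have hJf : volume J ≠ ⊤ := measure_Ioo_lt_top.ne
  have hGi : Integrable G := by
    rw [hG, integrable_indicator_iff measurableSet_Ioo]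
    refine Measure.integrableOn_of_bounded (M := L) hJf hg.aestronglyMeasurable ?_
    filter_upwards [ae_restrict_mem measurableSet_Ioo] with x hx using hL x (hJs hx)
  obtain ⟨h₀, -, hh₀, hc, hi⟩ := hGi.exists_hasCompactSupport_integral_sub_le (half_pos hτ)
  set c : ℝ → ℝ := fun x => max 0 (min 1 (min ((x - a - η) / η) ((b - η - x) / η))) with hcdef
  have hcc : Continuous c := by fun_prop
  have hc0 : ∀ x, 0 ≤ c x := fun x => le_max_left _ _
  have hc1 : ∀ x, c x ≤ 1 := fun x => max_le zero_le_one (min_le_left _ _)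
  have hcJ : ∀ x ∈ J, c x = 1 := by
    intro x hx
    have h1 : 1 ≤ (x - a - η) / η := by rw [le_div_iff₀ hη]; linarith [hx.1]
    have h2 : 1 ≤ (b - η - x) / η := by rw [le_div_iff₀ hη]; linarith [hx.2]
    rw [hcdef]
    simp only
    rw [min_eq_left (le_min h1 h2), max_eq_right zero_le_one]
  set h₁ : ℝ → ℝ := fun x => max (-L) (min L (h₀ x)) with hh₁
  have hh₁c : Continuous h₁ := by fun_prop
  have hh₁L : ∀ x, |h₁ x| ≤ L := fun x =>
    abs_le.2 ⟨le_max_left _ _, max_le (by linarith) (min_le_left _ _)⟩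
  have hh₁0 : ∀ x, |h₁ x| ≤ |h₀ x| := by
    intro x
    rw [abs_le]
    refine ⟨?_, max_le (by linarith [abs_nonneg (h₀ x)]) ((min_le_right _ _).trans (le_abs_self _))⟩
    rcases le_total L (h₀ x) with h | h
    · rw [hh₁]; simp only
      rw [min_eq_left h]
      linarith [le_max_right (-L) L, abs_nonneg (h₀ x)]
    · rw [hh₁]; simp only
      rw [min_eq_right h]
      linarith [le_max_right (-L) (h₀ x), neg_abs_le (h₀ x)]
  have hh₁g : ∀ x y, |y| ≤ L → |h₁ x - y| ≤ |y - h₀ x| := by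
    intro x y hy
    rw [abs_le] at hy
    rw [abs_sub_comm y]
    have := abs_max_sub_max_le_abs (min L (h₀ x)) (min L y) (-L)
    rw [min_eq_right hy.2, max_eq_left hy.1, max_comm] at this
    refine this.trans ?_
    have h2 := abs_min_sub_min_le_max L (h₀ x) L y
    rw [min_eq_right hy.2, sub_self, abs_zero, max_eq_right (abs_nonneg _)] at h2
    exact h2
  refine ⟨fun x => c x * h₁ x, η, hcc.mul hh₁c, hη, by linarith, fun x => ?_, fun x hx => ?_,
    fun x hx => ?_, ?_⟩
  · rw [abs_mul, abs_of_nonneg (hc0 x)]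
    exact (mul_le_of_le_one_left (abs_nonneg _) (hc1 x)).trans (hh₁L x)
  · have : c x = 0 := max_eq_left ((min_le_right _ _).trans ((min_le_left _ _).trans
      (div_nonpos_of_nonpos_of_nonneg (by linarith) hη.le)))
    simp only [this, zero_mul]
  · have : c x = 0 := max_eq_left ((min_le_right _ _).trans ((min_le_right _ _).trans
      (div_nonpos_of_nonpos_of_nonneg (by linarith) hη.le)))
    simp only [this, zero_mul]
  · have hpt : ∀ x ∈ Ioo a b, |c x * h₁ x - g x| ≤
        ‖G x - h₀ x‖ + (L - J.indicator (fun _ => L) x) := by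
      intro x hx
      rw [Real.norm_eq_abs]
      by_cases hxJ : x ∈ J
      · rw [hcJ x hxJ, one_mul, indicator_of_mem hxJ, sub_self, add_zero, hG, indicator_of_mem hxJ]
        exact hh₁g x _ (hL x hx)
      · rw [indicator_of_notMem hxJ, sub_zero, hG, indicator_of_notMem hxJ, zero_sub, abs_neg]
        refine (abs_sub _ _).trans (add_le_add ?_ (hL x hx))
        rw [abs_mul, abs_of_nonneg (hc0 x)]
        exact (mul_le_of_le_one_left (abs_nonneg _) (hc1 x)).trans (hh₁0 x)
    have i1 : Integrable (fun x => ‖G x - h₀ x‖) := (hGi.sub hi).norm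
    have j1 : IntegrableOn (fun _ : ℝ => L) (Ioo a b) := integrableOn_const measure_Ioo_lt_top.ne
    have j2 : IntegrableOn (J.indicator fun _ => L) (Ioo a b) :=
      ((integrable_indicator_iff measurableSet_Ioo).2 (integrableOn_const hJf)).integrableOn
    have i2 : IntegrableOn (fun x => L - J.indicator (fun _ => L) x) (Ioo a b) :=
      j1.sub j2
    have hmeas : Measurable fun x => c x * h₁ x - g x := (hcc.mul hh₁c).measurable.sub hg
    have i3 : IntegrableOn (fun x => |c x * h₁ x - g x|) (Ioo a b) := by
      refine Measure.integrableOn_of_bounded (M := 2 * L) measure_Ioo_lt_top.ne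
        hmeas.abs.aestronglyMeasurable ?_
      filter_upwards [ae_restrict_mem measurableSet_Ioo] with x hx
      rw [Real.norm_eq_abs, abs_abs]
      refine (abs_sub _ _).trans ?_
      rw [two_mul]
      refine add_le_add ?_ (hL x hx)
      rw [abs_mul, abs_of_nonneg (hc0 x)]
      exact (mul_le_of_le_one_left (abs_nonneg _) (hc1 x)).trans (hh₁L x)
    have e1 : ∫ x in Ioo a b, (L - J.indicator (fun _ => L) x) = L * (4 * η) := by
      rw [integral_sub j1 j2,
        setIntegral_indicator measurableSet_Ioo, inter_eq_right.2 hJs, setIntegral_const,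
        setIntegral_const, hJ, Measure.real, Measure.real, Real.volume_Ioo, Real.volume_Ioo,
        ENNReal.toReal_ofReal (by linarith), ENNReal.toReal_ofReal (by linarith)]
      simp only [smul_eq_mul]; ring
    calc ∫ x in Ioo a b, |c x * h₁ x - g x|
        ≤ ∫ x in Ioo a b, (‖G x - h₀ x‖ + (L - J.indicator (fun _ => L) x)) :=
          setIntegral_mono_on i3 (i1.integrableOn.add i2) measurableSet_Ioo hpt
      _ = (∫ x in Ioo a b, ‖G x - h₀ x‖) + ∫ x in Ioo a b, (L - J.indicator (fun _ => L) x) :=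
          integral_add i1.integrableOn i2
      _ ≤ τ / 2 + τ / 2 := by
          refine add_le_add (le_trans ?_ hh₀) (e1.le.trans hη2)
          exact setIntegral_le_integral i1 (Eventually.of_forall fun x => norm_nonneg _)
      _ = τ := by ring

/-- `F` is a `C²` approximation of `f` on `[a, b]`, affine and tangent to `f` near both ends. -/
structure IsArcApprox (f : ℝ → ℝ) (a b L ε : ℝ) (F : ℝ → ℝ) (η : ℝ) : Prop where
  smooth : ContDiff ℝ 2 F
  pos : 0 < η
  left : ∀ x ≤ a + η, F x = f a + deriv f a * (x - a)
  right : ∀ x, b - η ≤ x → F x = f b + deriv f b * (x - b)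
  deriv_close : ∀ x ∈ Icc a b, |deriv F x - deriv f x| ≤ ε
  close_left : ∀ x ∈ Icc a b, |F x - f x| ≤ ε * (x - a)
  close_right : ∀ x ∈ Icc a b, |F x - f x| ≤ ε * (b - x)
  second_le : ∀ x ∈ Icc a b, |deriv (deriv F) x| ≤ L + ε
  second_close : ∫ x in Ioo a b, |deriv (deriv F) x - deriv (deriv f) x| ≤ ε

lemma abs_sub_le_of_deriv_le {u u' : ℝ → ℝ} {a b C : ℝ}
    (hu : ∀ x ∈ Icc a b, HasDerivAt u (u' x) x) (hC : ∀ x ∈ Icc a b, |u' x| ≤ C) {x y : ℝ}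
    (hx : x ∈ Icc a b) (hy : y ∈ Icc a b) : |u y - u x| ≤ C * |y - x| :=
  (convex_Icc a b).norm_image_sub_le_of_norm_hasDerivWithin_le
    (fun x hx => (hu x hx).hasDerivWithinAt) hC hx hy

lemma exists_cutoff {a b : ℝ} (hab : a < b) : ∃ (S S' S'' : ℝ → ℝ) (M : ℝ), 0 ≤ M ∧
    (∀ x, HasDerivAt S (S' x) x) ∧ (∀ x, HasDerivAt S' (S'' x) x) ∧ Continuous S'' ∧
    (∀ x, |S x| ≤ 1) ∧ (∀ x ∈ Icc a b, |S' x| ≤ M) ∧ (∀ x ∈ Icc a b, |S'' x| ≤ M) ∧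
    (∀ x ≤ a + (b - a) / 3, S x = 0) ∧ (∀ x, b - (b - a) / 3 ≤ x → S x = 1) := by
  have hD : 0 < b - a := sub_pos.2 hab
  set S : ℝ → ℝ := fun x => Real.smoothTransition (3 * (x - a) / (b - a) - 1) with hS
  have hS2 : ContDiff ℝ 2 S :=
    (Real.smoothTransition.contDiff (n := 2)).comp (by fun_prop)
  have hS1 : ContDiff ℝ 1 (deriv S) := by
    have h2 : ContDiff ℝ (1 + 1) S := by norm_num; exact hS2
    exact (contDiff_succ_iff_deriv.1 h2).2.2
  have hS0 := (contDiff_one_iff_deriv.1 hS1).2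
  obtain ⟨M₁, h1⟩ := isCompact_Icc.exists_bound_of_continuousOn (s := Icc a b)
    hS1.continuous.continuousOn
  obtain ⟨M₂, h2⟩ := isCompact_Icc.exists_bound_of_continuousOn (s := Icc a b) hS0.continuousOn
  refine ⟨S, deriv S, deriv (deriv S), max M₁ M₂, ?_, fun x => ?_, fun x => ?_, hS0, fun x => ?_,
    fun x hx => (h1 x hx).trans (le_max_left _ _), fun x hx => (h2 x hx).trans (le_max_right _ _),
    fun x hx => ?_, fun x hx => ?_⟩
  · exact (norm_nonneg _).trans ((h1 a (left_mem_Icc.2 hab.le)).trans (le_max_left _ _))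
  · exact (hS2.differentiable (by norm_num) x).hasDerivAt
  · exact (hS1.differentiable (by norm_num) x).hasDerivAt
  · rw [abs_of_nonneg (Real.smoothTransition.nonneg _)]
    exact Real.smoothTransition.le_one _
  · refine Real.smoothTransition.zero_of_nonpos ?_
    rw [sub_nonpos, div_le_one hD]; linarith
  · refine Real.smoothTransition.one_of_one_le ?_
    rw [le_sub_iff_add_le, le_div_iff₀ hD]; linarith

lemma exists_isArcApprox {f : ℝ → ℝ} {a b L ε : ℝ} (hab : a < b) (hL0 : 0 ≤ L)
    (hf : ∀ x ∈ Icc a b, HasDerivAt f (deriv f x) x)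
    (hlip : ∀ x ∈ Icc a b, ∀ y ∈ Icc a b, |deriv f x - deriv f y| ≤ L * |x - y|) (hε : 0 < ε) :
    ∃ F η, IsArcApprox f a b L ε F η := by
  have hD : 0 < b - a := sub_pos.2 hab
  obtain ⟨S, S', S'', M, hM0, hS, hS', hSc, hS1, hSM, hSM', hSl, hSr⟩ := exists_cutoff hab
  set g := deriv (deriv f) with hg
  have hgm : Measurable g := measurable_deriv _
  have hlipw : LipschitzOnWith L.toNNReal (deriv f) (Icc a b) :=
    LipschitzOnWith.of_dist_le_mul fun x hx y hy => by
      rw [Real.dist_eq, Real.dist_eq, Real.coe_toNNReal _ hL0]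
      exact hlip x hx y hy
  have hgL : ∀ x ∈ Ioo a b, |g x| ≤ L := by
    intro x hx
    have := norm_deriv_le_of_lipschitzOn (Icc_mem_nhds hx.1 hx.2) hlipw
    rwa [Real.coe_toNNReal _ hL0] at this
  obtain ⟨K, hK, hK1⟩ : ∃ K, K = (2 + 2 * M * (b - a) + 2 * M) * (1 + (b - a)) ∧ 0 < K :=
    ⟨_, rfl, by positivity⟩
  obtain ⟨τ, hτ, hτK⟩ : ∃ τ > 0, τ * K = ε := ⟨ε / K, by positivity, by field_simp⟩
  obtain ⟨h, η, hh, hη, hηb, hhL, hhl, hhr, hhg⟩ := exists_continuous_approx hab hgm hL0 hgL hτ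
  set v : ℝ → ℝ := fun x => deriv f a + ∫ t in a..x, h t with hv
  have hvd : ∀ x, HasDerivAt v (h x) x := fun x =>
    (hh.integral_hasStrictDerivAt a x).hasDerivAt.const_add _
  have hvc : Continuous v := continuous_iff_continuousAt.2 fun x => (hvd x).continuousAt
  set G : ℝ → ℝ := fun x => f a + ∫ t in a..x, v t with hG
  have hGd : ∀ x, HasDerivAt G (v x) x := fun x =>
    (hvc.integral_hasStrictDerivAt a x).hasDerivAt.const_add _
  have hGa : G a = f a := by simp [hG]
  have hva : v a = deriv f a := by simp [hv]
  have hgi : IntegrableOn g (Ioo a b) := by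
    refine Measure.integrableOn_of_bounded (M := L) measure_Ioo_lt_top.ne
      hgm.aestronglyMeasurable ?_
    filter_upwards [ae_restrict_mem measurableSet_Ioo] with x hx using hgL x hx
  have hhi : IntegrableOn h (Ioo a b) :=
    (hh.integrableOn_Icc (a := a) (b := b)).mono_set Ioo_subset_Icc_self
  have hvf : ∀ x ∈ Icc a b, |v x - deriv f x| ≤ τ := by
    intro x hx
    have hac : AbsolutelyContinuousOnInterval (deriv f) a x :=
      (hlipw.mono (by rw [uIcc_of_le hx.1]; exact
        Icc_subset_Icc_right hx.2)).absolutelyContinuousOnInterval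
    have e1 : v x - deriv f x = ∫ t in Ioo a x, (h t - g t) := by
      have hs : Ioo a x ⊆ Ioo a b := Ioo_subset_Ioo_right hx.2
      rw [integral_sub (hhi.mono_set hs) (hgi.mono_set hs), ← integral_Ioc_eq_integral_Ioo,
        ← integral_Ioc_eq_integral_Ioo, ← intervalIntegral.integral_of_le hx.1,
        ← intervalIntegral.integral_of_le hx.1, hg, hac.integral_deriv_eq_sub, hv]
      ring
    rw [e1]
    refine (abs_integral_le_integral_abs (f := fun t => h t - g t)).trans (le_trans ?_ hhg)
    exact setIntegral_mono_set (hhi.sub hgi).norm (Eventually.of_forall fun _ => abs_nonneg _)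
      (Ioo_subset_Ioo_right hx.2).eventuallyLE
  have ha : a ∈ Icc a b := left_mem_Icc.2 hab.le
  have hb : b ∈ Icc a b := right_mem_Icc.2 hab.le
  obtain ⟨A, hA⟩ : ∃ A, A = f b - G b := ⟨_, rfl⟩
  obtain ⟨B, hB⟩ : ∃ B, B = deriv f b - v b := ⟨_, rfl⟩
  have hAle : |A| ≤ τ * (b - a) := by
    have := abs_sub_le_of_deriv_le (u := fun x => G x - f x) (u' := fun x => v x - deriv f x)
      (fun x hx => (hGd x).sub (hf x hx)) hvf ha hb
    simp only [hGa, sub_self, sub_zero] at this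
    rwa [abs_of_pos hD, abs_sub_comm, ← hA] at this
  have hBle : |B| ≤ τ := by rw [hB, abs_sub_comm]; exact hvf b hb
  have hABle : ∀ x ∈ Icc a b, |A + B * (x - b)| ≤ 2 * τ * (b - a) := by
    intro x hx
    have h1 : |x - b| ≤ b - a := by rw [abs_le]; constructor <;> linarith [hx.1, hx.2]
    calc |A + B * (x - b)| ≤ |A| + |B| * |x - b| := by rw [← abs_mul]; exact abs_add_le _ _
      _ ≤ τ * (b - a) + τ * (b - a) := add_le_add hAle (mul_le_mul hBle h1 (abs_nonneg _) hτ.le)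
      _ = _ := by ring
  set F : ℝ → ℝ := fun x => G x + S x * (A + B * (x - b)) with hF
  have hlin : ∀ x, HasDerivAt (fun x => A + B * (x - b)) B x := fun x =>
    ((((hasDerivAt_id x).sub_const b).const_mul B).const_add A).congr_deriv (by ring)
  have hF1 : ∀ x, HasDerivAt F (v x + (S' x * (A + B * (x - b)) + S x * B)) x := fun x =>
    (hGd x).add ((hS x).mul (hlin x))
  have hF1e : deriv F = fun x => v x + (S' x * (A + B * (x - b)) + S x * B) :=
    funext fun x => (hF1 x).deriv
  have hF2 : ∀ x, HasDerivAt (deriv F)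
      (h x + (S'' x * (A + B * (x - b)) + S' x * B + S' x * B)) x := fun x => by
    rw [hF1e]
    exact (hvd x).add (((hS' x).mul (hlin x)).add ((hS x).mul_const B))
  have hF2e : deriv (deriv F) = fun x => h x + (S'' x * (A + B * (x - b)) + S' x * B + S' x * B) :=
    funext fun x => (hF2 x).deriv
  have hS'c : Continuous S' := continuous_iff_continuousAt.2 fun x => (hS' x).continuousAt
  have hF2c : Continuous (deriv (deriv F)) := by
    rw [hF2e]; fun_prop
  have hFs : ContDiff ℝ 2 F := by
    have : ContDiff ℝ (1 + 1) F := contDiff_succ_iff_deriv.2 ⟨fun x => (hF1 x).differentiableAt,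
      by simp, contDiff_one_iff_deriv.2 ⟨fun x => (hF2 x).differentiableAt, hF2c⟩⟩
    norm_num at this
    exact this
  have hcorr : ∀ x ∈ Icc a b, |S'' x * (A + B * (x - b)) + S' x * B + S' x * B|
      ≤ τ * (2 * M * (b - a) + 2 * M) := by
    intro x hx
    have t1 : |S'' x * (A + B * (x - b))| ≤ M * (2 * τ * (b - a)) := by
      rw [abs_mul]; exact mul_le_mul (hSM' x hx) (hABle x hx) (abs_nonneg _) hM0
    have t2 : |S' x * B| ≤ M * τ := by
      rw [abs_mul]; exact mul_le_mul (hSM x hx) hBle (abs_nonneg _) hM0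
    calc _ ≤ |S'' x * (A + B * (x - b))| + |S' x * B| + |S' x * B| := abs_add_three _ _ _
      _ ≤ M * (2 * τ * (b - a)) + M * τ + M * τ := by gcongr
      _ = _ := by ring
  have hMD : 0 ≤ M * (b - a) := mul_nonneg hM0 hD.le
  have hclose : ∀ x ∈ Icc a b, |deriv F x - deriv f x| ≤ ε := by
    intro x hx
    have t1 : |S' x * (A + B * (x - b))| ≤ M * (2 * τ * (b - a)) := by
      rw [abs_mul]; exact mul_le_mul (hSM x hx) (hABle x hx) (abs_nonneg _) hM0
    have t2 : |S x * B| ≤ 1 * τ := by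
      rw [abs_mul]; exact mul_le_mul (hS1 x) hBle (abs_nonneg _) zero_le_one
    calc |deriv F x - deriv f x|
        = |(v x - deriv f x) + S' x * (A + B * (x - b)) + S x * B| := by
          rw [hF1e]; ring_nf
      _ ≤ |v x - deriv f x| + |S' x * (A + B * (x - b))| + |S x * B| := abs_add_three _ _ _
      _ ≤ τ + M * (2 * τ * (b - a)) + 1 * τ := by gcongr; exact hvf x hx
      _ = τ * (2 + 2 * M * (b - a)) := by ring
      _ ≤ τ * K := by
        refine mul_le_mul_of_nonneg_left ?_ hτ.le
        rw [hK]; nlinarith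
      _ = ε := hτK
  have hFa : F a = f a := by simp only [hF]; rw [hSl a (by linarith), hGa]; ring
  have hFb : F b = f b := by simp only [hF]; rw [hSr b (by linarith), hA]; ring
  have hFf : ∀ x ∈ Icc a b, HasDerivAt (fun x => F x - f x) (deriv F x - deriv f x) x :=
    fun x hx => (hF1 x).differentiableAt.hasDerivAt.sub (hf x hx)
  refine ⟨F, η, hFs, hη, fun x hx => ?_, fun x hx => ?_, hclose, fun x hx => ?_, fun x hx => ?_,
    fun x hx => ?_, ?_⟩
  · have hvx : ∀ y ≤ a + η, v y = deriv f a := by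
      intro y hy
      have : ∫ t in a..y, h t = 0 := intervalIntegral.integral_zero_ae
        (Eventually.of_forall fun t ht => hhl t (by
          rcases le_total a y with hay | hay
          · rw [uIoc_of_le hay] at ht; exact ht.2.trans hy
          · rw [uIoc_of_ge hay] at ht; linarith [ht.2]))
      simp [hv, this]
    have hGx : ∫ t in a..x, v t = deriv f a * (x - a) := by
      rw [intervalIntegral.integral_congr (g := fun _ => deriv f a) fun t ht => hvx t (by
        have := (ht.2 : t ≤ max a x)
        exact this.trans (max_le (by linarith) hx)), intervalIntegral.integral_const, smul_eq_mul]
      ring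
    simp only [hF, hG]
    rw [hSl x (by linarith), hGx]; ring
  · have hvx : ∀ y, b - η ≤ y → v y = v b := by
      intro y hy
      have : ∫ t in b..y, h t = 0 := intervalIntegral.integral_zero_ae
        (Eventually.of_forall fun t ht => hhr t (by
          rcases le_total b y with hay | hay
          · rw [uIoc_of_le hay] at ht; linarith [ht.1]
          · rw [uIoc_of_ge hay] at ht; linarith [ht.1]))
      simp only [hv]
      rw [← intervalIntegral.integral_add_adjacent_intervals (hh.intervalIntegrable a b)
        (hh.intervalIntegrable b y), this, add_zero]
    have hGx : ∫ t in b..x, v t = v b * (x - b) := by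
      rw [intervalIntegral.integral_congr (g := fun _ => v b) fun t ht => hvx t (by
        have := (ht.1 : min b x ≤ t)
        exact le_trans (le_min (by linarith) hx) this), intervalIntegral.integral_const,
        smul_eq_mul]
      ring
    have hGb : G x = G b + v b * (x - b) := by
      simp only [hG]
      rw [← intervalIntegral.integral_add_adjacent_intervals (hvc.intervalIntegrable a b)
        (hvc.intervalIntegrable b x), hGx, add_assoc]
    simp only [hF]
    rw [hSr x (by linarith), hGb, hA, hB]; ring
  · have := abs_sub_le_of_deriv_le hFf hclose ha hx
    rwa [hFa, sub_self, sub_zero, abs_of_nonneg (sub_nonneg.2 hx.1)] at this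
  · have := abs_sub_le_of_deriv_le hFf hclose hb hx
    rwa [hFb, sub_self, sub_zero, abs_sub_comm x b, abs_of_nonneg (sub_nonneg.2 hx.2)] at this
  · rw [hF2e]
    refine (abs_add_le _ _).trans (add_le_add (hhL x) ((hcorr x hx).trans ?_))
    rw [← hτK]
    refine mul_le_mul_of_nonneg_left ?_ hτ.le
    rw [hK]; nlinarith
  · have hpt : ∀ x ∈ Ioo a b, |deriv (deriv F) x - g x| ≤
        τ * (2 * M * (b - a) + 2 * M) + |h x - g x| := by
      intro x hx
      have := hcorr x (Ioo_subset_Icc_self hx)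
      calc |deriv (deriv F) x - g x|
          = |(S'' x * (A + B * (x - b)) + S' x * B + S' x * B) + (h x - g x)| := by
            rw [hF2e]; ring_nf
        _ ≤ _ := (abs_add_le _ _).trans (add_le_add_left this _)
    have i1 : IntegrableOn (fun x => |h x - g x|) (Ioo a b) := (hhi.sub hgi).abs
    have i2 : IntegrableOn (fun x => |deriv (deriv F) x - g x|) (Ioo a b) :=
      (((hF2c.integrableOn_Icc (a := a) (b := b)).mono_set Ioo_subset_Icc_self).sub hgi).abs
    have i0 : IntegrableOn (fun _ : ℝ => τ * (2 * M * (b - a) + 2 * M)) (Ioo a b) :=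
      integrableOn_const measure_Ioo_lt_top.ne
    calc ∫ x in Ioo a b, |deriv (deriv F) x - g x|
        ≤ ∫ x in Ioo a b, (τ * (2 * M * (b - a) + 2 * M) + |h x - g x|) :=
          setIntegral_mono_on i2 (i0.add i1) measurableSet_Ioo hpt
      _ = (b - a) * (τ * (2 * M * (b - a) + 2 * M)) + ∫ x in Ioo a b, |h x - g x| := by
          rw [integral_add i0 i1, setIntegral_const, Measure.real, Real.volume_Ioo,
            ENNReal.toReal_ofReal hD.le, smul_eq_mul]
      _ ≤ (b - a) * (τ * (2 * M * (b - a) + 2 * M)) + τ := by gcongr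
      _ = τ * ((b - a) * (2 * M * (b - a) + 2 * M) + 1) := by ring
      _ ≤ τ * K := by
        refine mul_le_mul_of_nonneg_left ?_ hτ.le
        rw [hK]; nlinarith
      _ = ε := hτK

/-- A piece of curve: the graph of `f` over `(a, b)` in the frame with origin `p` and vertical
direction `n`. -/
structure Arc where
  p : En 2
  n : En 2
  f : ℝ → ℝ
  a : ℝ
  b : ℝ

/-- The point of the curve with parameter `x`. -/
def Arc.pt (m : Arc) (x : ℝ) : En 2 := ptF m.p m.n x (m.f x)

/-- The open arc. -/
def Arc.curve (m : Arc) : Set (En 2) := m.pt '' Ioo m.a m.b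

/-- The boundary of `E` is decomposed into the finite set `K` and finitely many disjoint open
arcs with endpoints in `K`. -/
structure IsArcSystem (E : Set (En 2)) (R : ℝ) (K : Set (En 2)) (S : Set Arc) : Prop where
  finite_K : K.Finite
  K_subset : K ⊆ frontier E
  finite_S : S.Finite
  chart : ∀ m ∈ S, IsChart E R m.p m.n m.f
  lt : ∀ m ∈ S, m.a < m.b
  le_a : ∀ m ∈ S, -(R / 8) ≤ m.a
  b_le : ∀ m ∈ S, m.b ≤ R / 8
  pt_a : ∀ m ∈ S, m.pt m.a ∈ K
  pt_b : ∀ m ∈ S, m.pt m.b ∈ K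
  notMem_K : ∀ m ∈ S, ∀ x ∈ Ioo m.a m.b, m.pt x ∉ K
  disj : ∀ m ∈ S, ∀ m' ∈ S, m ≠ m' → Disjoint m.curve m'.curve
  cover : ∀ q ∈ frontier E, q ∈ K ∨ ∃ m ∈ S, q ∈ m.curve

lemma IsChart.continuousOn {E : Set (En 2)} {R : ℝ} {p n : En 2} {f : ℝ → ℝ}
    (h : IsChart E R p n f) : ContinuousOn (fun x => ptF p n x (f x)) (Ioo (-(R / 4)) (R / 4)) :=
  (continuous_ptF p n).comp_continuousOn (continuousOn_id.prodMk fun x hx =>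
    (h.diff x (abs_lt.2 hx)).continuousAt.continuousWithinAt)

lemma IsChart.pt_mem_frontier {E : Set (En 2)} {R : ℝ} {p n : En 2} {f : ℝ → ℝ}
    (h : IsChart E R p n f) {x : ℝ} (hx : |x| < R / 4) : ptF p n x (f x) ∈ frontier E :=
  (h.frontier_iff x _ hx ((h.abs_le x hx).trans_lt hx)).2 rfl

lemma IsChart.zF_eq {E : Set (En 2)} {R : ℝ} {p n q : En 2} {f : ℝ → ℝ}
    (h : IsChart E R p n f) (hq : q ∈ frontier E) (hx : |XF p n q| < R / 4)
    (hz : |ZF p n q| < R / 4) : ZF p n q = f (XF p n q) := by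
  rw [← ptF_XF_ZF (p := p) h.unit q] at hq
  exact (h.frontier_iff _ _ hx hz).1 hq

/-- A finite set of reals containing points on both sides of `x` has consecutive elements
around `x`. -/
lemma exists_consecutive {X : Set ℝ} (hX : X.Finite) {u v x : ℝ} (hu : u ∈ X) (hv : v ∈ X)
    (hux : u < x) (hxv : x < v) (hx : x ∉ X) :
    ∃ a ∈ X, ∃ b ∈ X, a < x ∧ x < b ∧ ∀ y ∈ Ioo a b, y ∉ X := by
  obtain ⟨a, ⟨haX, hax⟩, ha⟩ := exists_max_image (X ∩ Iio x) id (hX.inter_of_left _) ⟨u, hu, hux⟩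
  obtain ⟨b, ⟨hbX, hbx⟩, hb⟩ := exists_min_image (X ∩ Ioi x) id (hX.inter_of_left _) ⟨v, hv, hxv⟩
  refine ⟨a, haX, b, hbX, hax, hbx, fun y hy hyX => ?_⟩
  rcases lt_trichotomy y x with h | h | h
  · exact absurd (ha y ⟨hyX, h⟩) (not_le.2 hy.1)
  · exact hx (h ▸ hyX)
  · exact absurd (hb y ⟨hyX, h⟩) (not_le.2 hy.2)

lemma ptF_graph_injective {p n : En 2} (hn : UnitV n) (f : ℝ → ℝ) :
    Function.Injective fun x => ptF p n x (f x) := fun x y h => by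
  have := congrArg (XF p n) h
  simpa [XF_ptF hn] using this

lemma exists_isArcSystem {E : Set (En 2)} {R : ℝ} (hR : 0 < R) (hE : E ∈ UR 2 R) :
    ∃ K S, IsArcSystem E R K S := by
  obtain ⟨hEc, hEb, hES⟩ := hE
  have hcomp : IsCompact (frontier E) :=
    (isCompact_of_isClosed_isBounded hEc hEb).of_isClosed_subset isClosed_frontier
      (hEc.frontier_subset)
  have hch : ∀ p : En 2, ∃ n f, p ∈ frontier E → IsChart E R p n f := by
    intro p
    by_cases hp : p ∈ frontier E
    · obtain ⟨n, f, h⟩ := exists_chart hR hEc hES hp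
      exact ⟨n, f, fun _ => h⟩
    · exact ⟨0, 0, fun h => absurd h hp⟩
  choose n f hc using hch
  have hnhds : ∀ p ∈ frontier E, {q | |XF p (n p) q| < R / 8 ∧ |ZF p (n p) q| < R / 4} ∈ 𝓝 p := by
    intro p hp
    refine (((isOpen_lt (continuous_XF p (n p)).abs continuous_const).inter
      (isOpen_lt (continuous_ZF p (n p)).abs continuous_const))).mem_nhds ?_
    simp only [mem_inter_iff, Set.mem_ofPred_eq]
    have h1 : XF p (n p) p = 0 := by
      conv_lhs => rw [← ptF_origin p (n p)]
      rw [ptF_origin]; simp [XF]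
    have h2 : ZF p (n p) p = 0 := by simp [ZF]
    rw [h1, h2, abs_zero]
    constructor <;> positivity
  obtain ⟨t, ht, hcov⟩ := hcomp.elim_nhds_subcover _ hnhds
  have hct : ∀ p ∈ t, IsChart E R p (n p) (f p) := fun p hp => hc p (ht p hp)
  obtain ⟨e, he⟩ := Set.countable_iff_exists_injOn.1 t.countable_toSet
  obtain ⟨ψ, hψ⟩ : ∃ ψ : En 2 → ℝ → En 2, ψ = fun p x => ptF p (n p) x (f p x) := ⟨_, rfl⟩
  obtain ⟨A, hA⟩ : ∃ A : En 2 → Set (En 2),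
    A = fun p => {q | |XF p (n p) q| < R / 8 ∧ |ZF p (n p) q| < R / 4} := ⟨_, rfl⟩
  have hAo : ∀ p, IsOpen (A p) := fun p => by
    rw [hA]
    exact (isOpen_lt (continuous_XF p (n p)).abs continuous_const).inter
      (isOpen_lt (continuous_ZF p (n p)).abs continuous_const)
  obtain ⟨K, hK⟩ : ∃ K : Set (En 2), K = ⋃ p ∈ t, {ψ p (-(R / 8)), ψ p (R / 8)} := ⟨_, rfl⟩
  have hKf : K.Finite := by
    rw [hK]
    exact t.finite_toSet.biUnion fun p _ => by simp
  have hinj : ∀ p ∈ t, Function.Injective (ψ p) := fun p hp => by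
    rw [hψ]; exact ptF_graph_injective (hct p hp).unit _
  obtain ⟨X, hX⟩ : ∃ X : En 2 → Set ℝ, X = fun p => ψ p ⁻¹' K ∩ Icc (-(R / 8)) (R / 8) := ⟨_, rfl⟩
  have hXf : ∀ p ∈ t, (X p).Finite := fun p hp => by
    rw [hX]
    exact (hKf.preimage (hinj p hp).injOn).inter_of_left _
  have hfr : ∀ p ∈ t, ∀ x, |x| < R / 4 → ψ p x ∈ frontier E := fun p hp x hx => by
    rw [hψ]; exact (hct p hp).pt_mem_frontier hx
  have hXψ : ∀ p ∈ t, ∀ x, XF p (n p) (ψ p x) = x := fun p hp x => by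
    rw [hψ]; exact XF_ptF (hct p hp).unit _ _
  have hZψ : ∀ p ∈ t, ∀ x, ZF p (n p) (ψ p x) = f p x := fun p hp x => by
    rw [hψ]; exact ZF_ptF (hct p hp).unit _ _
  have hψA : ∀ p ∈ t, ∀ x, |x| < R / 8 → ψ p x ∈ A p := fun p hp x hx => by
    rw [hA]
    have h4 : |x| < R / 4 := by linarith
    simp only [Set.mem_ofPred_eq]
    rw [hXψ p hp, hZψ p hp]
    exact ⟨hx, ((hct p hp).abs_le x h4).trans_lt h4⟩
  have hAψ : ∀ p ∈ t, ∀ q ∈ frontier E, q ∈ A p → ψ p (XF p (n p) q) = q := by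
    intro p hp q hq hqA
    rw [hA] at hqA
    rw [hψ]
    simp only
    rw [← (hct p hp).zF_eq hq (by linarith [hqA.1]) hqA.2]
    exact ptF_XF_ZF (hct p hp).unit q
  have hclopen : ∀ p ∈ t, ∀ Γ : Set (En 2), IsPreconnected Γ → Γ ⊆ frontier E \ K →
      ∀ q ∈ Γ, q ∉ A p → ∀ q' ∈ Γ, q' ∉ A p := by
    intro p hp Γ hΓ hsub q hq hqA q' hq' hq'A
    obtain ⟨V, hV⟩ : ∃ V : Set (En 2),
      V = {q | |XF p (n p) q| ≤ R / 8 ∧ |ZF p (n p) q| ≤ 3 * R / 16}ᶜ := ⟨_, rfl⟩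
    have hVo : IsOpen V := by
      rw [hV]
      exact ((isClosed_le (continuous_XF p (n p)).abs continuous_const).inter
        (isClosed_le (continuous_ZF p (n p)).abs continuous_const)).isOpen_compl
    have hcovV : ∀ y ∈ Γ, y ∉ A p → y ∈ V := by
      intro y hy hyA
      by_contra hyV
      rw [hV, mem_compl_iff, not_not] at hyV
      obtain ⟨h1, h2⟩ := hyV
      have hz := (hct p hp).zF_eq (hsub hy).1 (by linarith) (by linarith)
      have hy' : y = ψ p (XF p (n p) y) := by
        rw [hψ]; simp only; rw [← hz]; exact (ptF_XF_ZF (hct p hp).unit y).symm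
      rcases h1.lt_or_eq with h | h
      · exact hyA (by rw [hA]; exact ⟨h, by linarith⟩)
      · refine (hsub hy).2 ?_
        rw [hK, mem_iUnion₂]
        refine ⟨p, hp, ?_⟩
        rcases abs_eq (by positivity : (0 : ℝ) ≤ R / 8) |>.1 h with h | h
        · rw [h] at hy'; right; exact hy'
        · rw [h] at hy'; left; exact hy'
    obtain ⟨y, hy, hyA, hyV⟩ := hΓ (A p) V (hAo p) hVo
      (fun y hy => (em (y ∈ A p)).imp id fun h => hcovV y hy h) ⟨q', hq', hq'A⟩
      ⟨q, hq, hcovV q hq hqA⟩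
    rw [hA] at hyA
    obtain ⟨h1, h2⟩ := hyA
    have hz := (hct p hp).zF_eq (hsub hy).1 (by linarith) (by linarith)
    rw [hV] at hyV
    refine hyV ⟨h1.le, ?_⟩
    rw [hz]
    linarith [(hct p hp).abs_le (XF p (n p) y) (by linarith)]
  obtain ⟨S, hS⟩ : ∃ S : Set Arc, S = {m | ∃ p ∈ t, ∃ a ∈ X p, ∃ b ∈ X p,
    m = ⟨p, n p, f p, a, b⟩ ∧ a < b ∧ (∀ x ∈ Ioo a b, x ∉ X p) ∧
      ∀ p' ∈ t, e p' < e p → ∀ x ∈ Ioo a b, ψ p x ∉ A p'} := ⟨_, rfl⟩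
  have hSf : S.Finite := by
    refine (t.finite_toSet.biUnion fun p hp => ((hXf p hp).prod (hXf p hp)).image
      fun ab => (⟨p, n p, f p, ab.1, ab.2⟩ : Arc)).subset ?_
    rw [hS]
    rintro m ⟨p, hp, a, ha, b, hb, rfl, -⟩
    exact mem_iUnion₂.2 ⟨p, hp, (a, b), ⟨ha, hb⟩, rfl⟩
  have hXI : ∀ p, ∀ x ∈ X p, ψ p x ∈ K ∧ -(R / 8) ≤ x ∧ x ≤ R / 8 := fun p x hx => by
    rw [hX] at hx; exact ⟨hx.1, hx.2⟩
  have hXn : ∀ p ∈ t, ∀ a ∈ X p, ∀ b ∈ X p, ∀ x ∈ Ioo a b, x ∉ X p → ψ p x ∉ K := by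
    intro p hp a ha b hb x hx hxX hxK
    refine hxX ?_
    rw [hX]
    exact ⟨hxK, by linarith [(hXI p a ha).2.1, hx.1], by linarith [(hXI p b hb).2.2, hx.2]⟩
  refine ⟨K, S, ⟨hKf, ?_, hSf, ?_, ?_, ?_, ?_, ?_, ?_, ?_, ?_, ?_⟩⟩
  · rw [hK]
    refine iUnion₂_subset fun p hp => ?_
    rintro q (rfl | rfl)
    · exact hfr p hp _ (by rw [abs_neg, abs_of_pos (by positivity)]; linarith)
    · exact hfr p hp _ (by rw [abs_of_pos (by positivity)]; linarith)
  · rw [hS]; rintro m ⟨p, hp, a, ha, b, hb, rfl, -⟩; exact hct p hp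
  · rw [hS]; rintro m ⟨p, hp, a, ha, b, hb, rfl, h, -⟩; exact h
  · rw [hS]; rintro m ⟨p, hp, a, ha, b, hb, rfl, -⟩; exact (hXI p a ha).2.1
  · rw [hS]; rintro m ⟨p, hp, a, ha, b, hb, rfl, -⟩; exact (hXI p b hb).2.2
  · rw [hS]; rintro m ⟨p, hp, a, ha, b, hb, rfl, -⟩
    have := (hXI p a ha).1
    rw [hψ] at this; exact this
  · rw [hS]; rintro m ⟨p, hp, a, ha, b, hb, rfl, -⟩
    have := (hXI p b hb).1
    rw [hψ] at this; exact this
  · rw [hS]; rintro m ⟨p, hp, a, ha, b, hb, rfl, hab, hn, -⟩ x hx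
    have := hXn p hp a ha b hb x hx (hn x hx)
    rw [hψ] at this; exact this
  · have hcase : ∀ p ∈ t, ∀ a ∈ X p, ∀ b ∈ X p, ∀ p', e p' < e p → p' ∈ t → ∀ a' ∈ X p',
        ∀ b' ∈ X p', (∀ p' ∈ t, e p' < e p → ∀ x ∈ Ioo a b, ψ p x ∉ A p') →
        Disjoint (Arc.curve ⟨p, n p, f p, a, b⟩) (Arc.curve ⟨p', n p', f p', a', b'⟩) := by
      intro p hp a ha b hb p' hlt hp' a' ha' b' hb' h
      rw [Set.disjoint_left]
      rintro q ⟨x, hx, rfl⟩ ⟨y, hy, hxy⟩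
      refine h p' hp' hlt x hx ?_
      have e1 : ψ p' y = ψ p x := by rw [hψ]; exact hxy
      rw [← e1]
      refine hψA p' hp' y (abs_lt.2 ⟨?_, ?_⟩)
      · linarith [(hXI p' a' ha').2.1, hy.1]
      · linarith [(hXI p' b' hb').2.2, hy.2]
    rw [hS]
    rintro m ⟨p, hp, a, ha, b, hb, rfl, hab, hn, hd⟩
      m' ⟨p', hp', a', ha', b', hb', rfl, hab', hn', hd'⟩
      hne
    rcases lt_trichotomy (e p) (e p') with h | h | h
    · exact (hcase p' hp' a' ha' b' hb' p h hp a ha b hb hd').symm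
    · obtain rfl := he hp hp' h
      rw [Set.disjoint_left]
      rintro q ⟨x, hx, rfl⟩ ⟨y, hy, hxy⟩
      have e1 : ψ p y = ψ p x := by rw [hψ]; exact hxy
      obtain rfl := hinj p hp e1
      have h1 : ¬ a' < a := fun h => hn' a ⟨h, hx.1.trans hy.2⟩ ha
      have h2 : ¬ a < a' := fun h => hn a' ⟨h, hy.1.trans hx.2⟩ ha'
      have h3 : ¬ b' < b := fun h => hn b' ⟨hx.1.trans hy.2, h⟩ hb'
      have h4 : ¬ b < b' := fun h => hn' b ⟨hy.1.trans hx.2, h⟩ hb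
      have ea : a = a' := le_antisymm (not_lt.1 h1) (not_lt.1 h2)
      have eb : b = b' := le_antisymm (not_lt.1 h3) (not_lt.1 h4)
      subst ea eb
      exact hne rfl
    · exact hcase p hp a ha b hb p' h hp' a' ha' b' hb' hd
  · intro q hq
    by_cases hqK : q ∈ K
    · exact Or.inl hqK
    right
    obtain ⟨p₀, hp₀, hqp₀⟩ := mem_iUnion₂.1 (hcov hq)
    obtain ⟨p, ⟨hp, hqA⟩, hmin⟩ := exists_min_image (↑t ∩ {p | q ∈ A p}) e
      (t.finite_toSet.inter_of_left _) ⟨p₀, hp₀, by rw [hA]; exact hqp₀⟩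
    have hqψ := hAψ p hp q hq hqA
    have hx8 : |XF p (n p) q| < R / 8 := by
      have : q ∈ A p := hqA
      rw [hA] at this; exact this.1
    obtain ⟨x, hx⟩ : ∃ x, x = XF p (n p) q := ⟨_, rfl⟩
    rw [← hx] at hqψ hx8
    have hxX : x ∉ X p := fun h => hqK (hqψ ▸ (hXI p x h).1)
    have hend : ∀ s, (s = -(R / 8) ∨ s = R / 8) → s ∈ X p := by
      intro s hs
      rw [hX]
      refine ⟨?_, by rcases hs with rfl | rfl <;> constructor <;> linarith⟩
      rw [mem_preimage, hK, mem_iUnion₂]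
      exact ⟨p, hp, by rcases hs with rfl | rfl <;> simp⟩
    obtain ⟨a, ha, b, hb, hax, hxb, hab⟩ := exists_consecutive (hXf p hp)
      (hend _ (Or.inl rfl)) (hend _ (Or.inr rfl)) (abs_lt.1 hx8).1 (abs_lt.1 hx8).2 hxX
    refine ⟨⟨p, n p, f p, a, b⟩, ?_, x, ⟨hax, hxb⟩, by rw [hψ] at hqψ; exact hqψ⟩
    rw [hS]
    refine ⟨p, hp, a, ha, b, hb, rfl, hax.trans hxb, hab, fun p' hp' hlt y hy => ?_⟩
    have hI : ∀ y ∈ Ioo a b, |y| < R / 8 := fun y hy => abs_lt.2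
      ⟨by linarith [(hXI p a ha).2.1, hy.1], by linarith [(hXI p b hb).2.2, hy.2]⟩
    have hpre : IsPreconnected (ψ p '' Ioo a b) := by
      refine isPreconnected_Ioo.image _ ?_
      rw [hψ]
      refine (hct p hp).continuousOn.mono fun y hy => abs_lt.1 ?_
      linarith [hI y hy]
    refine hclopen p' hp' _ hpre ?_ q ⟨x, ⟨hax, hxb⟩, hqψ⟩ ?_ _ ⟨y, hy, rfl⟩
    · rintro _ ⟨y, hy, rfl⟩
      exact ⟨hfr p hp y (by linarith [hI y hy]), hXn p hp a ha b hb y hy (hab y hy)⟩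
    · intro h
      exact absurd (hmin p' ⟨hp', h⟩) (not_le.2 hlt)

lemma SphereN.side {E : Set (En 2)} {R : ℝ} (hR : 0 < R) {k nk : En 2} (hk : SphereN E R k nk)
    {p n : En 2} {f : ℝ → ℝ} (hch : IsChart E R p n f) {c : ℝ} (hc : |c| < R / 4)
    (hpt : ptF p n c (f c) = k) {q : En 2} (hq : |2 * R * ZF k nk q| ≤ dist q k ^ 2)
    (hd : dist q k < R) (hne : q ≠ k) :
    (0 < XF k nk q ∧ c < XF p n q) ∨ (XF k nk q < 0 ∧ XF p n q < c) := by
  obtain ⟨hdot, hcross⟩ := hch.normal c hc nk (by rw [hpt]; exact hk)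
  have hder := hch.deriv_le c hc
  have hZk : ZF k nk k = 0 := by simp [ZF]
  have hXk : XF k nk k = 0 := by simp [XF]
  have hdec := dist_sq_frame hk.1 (p := k) q k
  rw [hZk, hXk, sub_zero, sub_zero] at hdec
  have hX : XF p n q = c + (XF k nk q * dotE nk n + ZF k nk q * crossE nk n) := by
    have h1 := XF_ptF_eq k nk n 0 0 (XF k nk q) (ZF k nk q)
    rw [ptF_XF_ZF hk.1, ptF_origin] at h1
    have h2 : XF p n q = XF p n k + XF k n q := by simp only [XF]; ring
    have h3 : XF p n k = c := by rw [← hpt]; exact XF_ptF hch.unit _ _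
    rw [h2, h3, h1]
    simp only [dotE, crossE]; ring
  rw [hcross] at hX
  obtain ⟨s, hs⟩ : ∃ s, s = XF k nk q := ⟨_, rfl⟩
  obtain ⟨t, ht⟩ : ∃ t, t = ZF k nk q := ⟨_, rfl⟩
  simp only [← hs, ← ht] at hX hdec hq ⊢
  have hd2 : s ^ 2 + t ^ 2 < R ^ 2 := by
    rw [← hdec]; exact pow_lt_pow_left₀ hd dist_nonneg two_ne_zero
  have hsR : |s| < R := abs_lt_of_sq_lt_sq (by nlinarith [sq_nonneg t]) hR.le
  have htR : |t| < R := abs_lt_of_sq_lt_sq (by nlinarith [sq_nonneg s]) hR.le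
  rw [hdec, abs_mul, abs_of_pos (by positivity : 0 < 2 * R)] at hq
  have h1 : R * |t| ≤ |s| * |s| := by
    have e1 := sq_abs t
    have e2 := sq_abs s
    nlinarith [abs_nonneg t]
  have hs0 : s ≠ 0 := by
    rintro rfl
    rw [abs_zero, mul_zero] at h1
    have ht0 : |t| = 0 := le_antisymm (by nlinarith) (abs_nonneg t)
    rw [abs_eq_zero] at ht0
    rw [ht0] at hdec
    refine hne (dist_eq_zero.1 (pow_eq_zero_iff two_ne_zero |>.1 ?_))
    rw [hdec]; ring
  have hts : |t| < |s| := by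
    have := abs_pos.2 hs0
    nlinarith
  have hcr : |t * -(deriv f c * dotE nk n)| < |s| * dotE nk n := by
    rw [abs_mul, abs_neg, abs_mul, abs_of_pos hdot, ← mul_assoc]
    refine mul_lt_mul_of_pos_right (lt_of_le_of_lt ?_ hts) hdot
    exact mul_le_of_le_one_right (abs_nonneg _) hder
  rw [abs_lt] at hcr
  rcases lt_or_gt_of_ne hs0 with h | h
  · right
    rw [abs_of_neg h] at hcr
    exact ⟨h, by linarith⟩
  · left
    rw [abs_of_pos h] at hcr
    exact ⟨h, by linarith⟩

lemma SphereN.zF_nonpos_iff {E : Set (En 2)} {R : ℝ} {k nk : En 2} (hk : SphereN E R k nk)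
    {p n : En 2} {f : ℝ → ℝ} (hch : IsChart E R p n f) {c : ℝ} (hc : |c| < R / 4)
    (hpt : ptF p n c (f c) = k) (q : En 2) :
    ZF k nk q ≤ 0 ↔ ZF p n q ≤ f c + deriv f c * (XF p n q - c) := by
  obtain ⟨hdot, hcross⟩ := hch.normal c hc nk (by rw [hpt]; exact hk)
  have h := ZF_ptF_eq p n nk c (f c) (XF p n q) (ZF p n q)
  rw [ptF_XF_ZF hch.unit, hpt] at h
  have e1 : crossE nk n = -(deriv f c * dotE nk n) := hcross
  have e2 : dotE nk n = dotE nk n := rfl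
  rw [h, e1]
  have e3 : (XF p n q - c) * -(deriv f c * dotE nk n) + (ZF p n q - f c) * dotE nk n
    = dotE nk n * (ZF p n q - (f c + deriv f c * (XF p n q - c))) := by ring
  rw [e3, mul_nonpos_iff_pos_imp_nonpos]
  constructor
  · intro h; linarith [h.1 hdot]
  · intro h
    exact ⟨fun _ => by linarith, fun h => by linarith⟩

lemma Arc.continuous_pt {E : Set (En 2)} {R : ℝ} {K : Set (En 2)} {S : Set Arc} (hR : 0 < R)
    (h : IsArcSystem E R K S) {m : Arc} (hm : m ∈ S) : ContinuousOn m.pt (Icc m.a m.b) :=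
  (h.chart m hm).continuousOn.mono fun x hx =>
    ⟨by linarith [h.le_a m hm, hx.1], by linarith [h.b_le m hm, hx.2]⟩

lemma IsArcSystem.abs_param_le {E : Set (En 2)} {R : ℝ} {K : Set (En 2)} {S : Set Arc}
    (h : IsArcSystem E R K S) {m : Arc} (hm : m ∈ S) {x : ℝ} (hx : x ∈ Icc m.a m.b) :
    |x| ≤ R / 8 :=
  abs_le.2 ⟨(h.le_a m hm).trans hx.1, hx.2.trans (h.b_le m hm)⟩

lemma IsArcSystem.mem_closure_curve {E : Set (En 2)} {R : ℝ} {K : Set (En 2)} {S : Set Arc}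
    (hR : 0 < R) (h : IsArcSystem E R K S) {m : Arc} (hm : m ∈ S) {k : En 2} (hk : k ∈ K)
    (hc : k ∈ closure m.curve) : k = m.pt m.a ∨ k = m.pt m.b := by
  have hcl : IsClosed (m.pt '' Icc m.a m.b) :=
    (isCompact_Icc.image_of_continuousOn (Arc.continuous_pt hR h hm)).isClosed
  obtain ⟨x, hx, rfl⟩ := hcl.closure_subset_iff.2 (image_mono Ioo_subset_Icc_self) hc
  rcases hx.1.eq_or_lt with rfl | h1
  · exact Or.inl rfl
  rcases hx.2.eq_or_lt with h2 | h2
  · exact Or.inr (by rw [h2])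
  · exact absurd hk (h.notMem_K m hm x ⟨h1, h2⟩)

lemma IsArcSystem.exists_arc_ends {E : Set (En 2)} {R : ℝ} {K : Set (En 2)} {S : Set Arc}
    (hR : 0 < R) (hE : E ∈ UR 2 R) (h : IsArcSystem E R K S) {k nk : En 2} (hk : k ∈ K)
    (hnk : SphereN E R k nk) :
    (∃ m ∈ S, m.pt m.a = k) ∧ ∃ m ∈ S, m.pt m.b = k := by
  obtain ⟨n, f, hch⟩ := exists_chart hR hE.1 hE.2.2 (h.K_subset hk)
  have hf0 : f 0 = 0 := by
    have := hch.abs_le 0 (by rw [abs_zero]; positivity)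
    rwa [abs_zero, abs_nonpos_iff] at this
  have h0 : ptF k n 0 (f 0) = k := by rw [hf0, ptF_origin]
  have hR4 : |(0 : ℝ)| < R / 4 := by rw [abs_zero]; positivity
  have hcont : ContinuousAt (fun x => ptF k n x (f x)) 0 :=
    hch.continuousOn.continuousAt (Ioo_mem_nhds (by linarith) (by linarith))
  have hinj := ptF_graph_injective (p := k) hch.unit f
  have hfreq : ∀ l : Filter ℝ, l.NeBot → l ≤ 𝓝[≠] 0 →
      ∃ m ∈ S, (k = m.pt m.a ∨ k = m.pt m.b) ∧ ∃ᶠ x in l, ptF k n x (f x) ∈ m.curve := by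
    intro l hl hle
    have hev : ∀ᶠ x in l, ∃ m ∈ S, ptF k n x (f x) ∈ m.curve := by
      refine hle ?_
      have e1 : ∀ᶠ x in 𝓝[≠] (0 : ℝ), |x| < R / 4 :=
        nhdsWithin_le_nhds ((continuous_abs.tendsto (0:ℝ)).eventually (gt_mem_nhds hR4))
      have e2 : ∀ᶠ x in 𝓝[≠] (0 : ℝ), x ∉ (fun x => ptF k n x (f x)) ⁻¹' K := by
        have hfin : ((fun x => ptF k n x (f x)) ⁻¹' K).Finite := h.finite_K.preimage hinj.injOn
        have := (hfin.subset (Set.sdiff_subset (t := {0}))).isClosed.isOpen_compl.mem_nhds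
          (x := (0 : ℝ)) (by simp)
        filter_upwards [nhdsWithin_le_nhds this, self_mem_nhdsWithin] with x hx hx0 hxK
        exact hx ⟨hxK, hx0⟩
      filter_upwards [e1, e2] with x h1 h2
      exact (h.cover _ (hch.pt_mem_frontier h1)).resolve_left h2
    have hex : ∃ m ∈ S, ∃ᶠ x in l, ptF k n x (f x) ∈ m.curve := by
      by_contra! hcon
      have := (Filter.eventually_all_finite h.finite_S).2 fun m hm =>
        hcon m hm
      obtain ⟨x, ⟨m, hm, hx⟩, hx'⟩ := (hev.and this).exists
      exact hx' m hm hx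
    obtain ⟨m, hm, hx⟩ := hex
    refine ⟨m, hm, h.mem_closure_curve hR hm hk ?_, hx⟩
    have ht : Tendsto (fun x => ptF k n x (f x)) l (𝓝 k) := by
      have := hcont.tendsto
      simp only [h0] at this
      exact this.mono_left (hle.trans nhdsWithin_le_nhds)
    exact mem_closure_of_frequently_of_tendsto hx ht
  have hgood : ∀ᶠ x in 𝓝 (0 : ℝ), |x| < R / 4 ∧ dist (ptF k n x (f x)) k < R := by
    refine ((continuous_abs.tendsto (0:ℝ)).eventually (gt_mem_nhds hR4)).and ?_
    have := hcont.tendsto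
    simp only [h0] at this
    exact this.eventually (ball_mem_nhds k hR)
  have hside : ∀ m ∈ S, ∀ c ∈ Icc m.a m.b, k = m.pt c → ∀ x, |x| < R / 4 → x ≠ 0 →
      dist (ptF k n x (f x)) k < R → ∀ y, ptF k n x (f x) = m.pt y →
      (0 < x ∧ c < y) ∨ (x < 0 ∧ y < c) := by
    intro m hm c hc hkc x hx hx0 hd y hy
    have hne : ptF k n x (f x) ≠ k := fun e => hx0 (hinj (e.trans h0.symm))
    have hq := hnk.abs_ZF_le hE.1 (hch.pt_mem_frontier hx)
    have s1 := hnk.side hR hch hR4 h0 hq hd hne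
    have hc4 : |c| < R / 4 := by linarith [h.abs_param_le hm hc]
    have s2 := hnk.side hR (h.chart m hm) hc4 hkc.symm hq hd hne
    rw [XF_ptF hch.unit] at s1
    have e : XF m.p m.n (ptF k n x (f x)) = y := by
      rw [hy]; exact XF_ptF (h.chart m hm).unit _ _
    rw [e] at s2
    rcases s1 with s1 | s1 <;> rcases s2 with s2 | s2
    · exact Or.inl ⟨s1.2, s2.2⟩
    · linarith [s1.1, s2.1]
    · linarith [s1.1, s2.1]
    · exact Or.inr ⟨s1.2, s2.2⟩
  constructor
  · obtain ⟨m, hm, hk', hx⟩ := hfreq (𝓝[>] 0) inferInstance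
      (nhdsWithin_mono _ fun x hx => ne_of_gt hx)
    refine ⟨m, hm, ?_⟩
    rcases hk' with hk' | hk'
    · exact hk'.symm
    obtain ⟨x, ⟨y, hy, hyx⟩, ⟨hx4, hxd⟩, hx0⟩ :=
      (hx.and_eventually ((hgood.filter_mono nhdsWithin_le_nhds).and self_mem_nhdsWithin)).exists
    have hx0' : 0 < x := hx0
    rcases hside m hm m.b (right_mem_Icc.2 (h.lt m hm).le) hk' x hx4 hx0'.ne' hxd y hyx.symm
      with s | s
    · linarith [s.2, hy.2]
    · linarith [s.1]
  · obtain ⟨m, hm, hk', hx⟩ := hfreq (𝓝[<] 0) inferInstance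
      (nhdsWithin_mono _ fun x hx => ne_of_lt hx)
    refine ⟨m, hm, ?_⟩
    rcases hk' with hk' | hk'
    swap
    · exact hk'.symm
    obtain ⟨x, ⟨y, hy, hyx⟩, ⟨hx4, hxd⟩, hx0⟩ :=
      (hx.and_eventually ((hgood.filter_mono nhdsWithin_le_nhds).and self_mem_nhdsWithin)).exists
    have hx0' : x < 0 := hx0
    rcases hside m hm m.a (left_mem_Icc.2 (h.lt m hm).le) hk' x hx4 hx0'.ne hxd y hyx.symm
      with s | s
    · linarith [s.1]
    · linarith [s.2, hy.1]

lemma IsArcSystem.min_le_dist {E : Set (En 2)} {R : ℝ} {K : Set (En 2)} {S : Set Arc}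
    (hR : 0 < R) (h : IsArcSystem E R K S) {m : Arc} (hm : m ∈ S) {x : ℝ} (hx : x ∈ Icc m.a m.b)
    {q : En 2} (hq : q ∈ frontier E) (hqm : q ∉ m.curve) :
    min (x - m.a) (m.b - x) ≤ dist (m.pt x) q := by
  have hch := h.chart m hm
  have hX := abs_XF_sub_le (p := m.p) hch.unit (m.pt x) q
  have hZ := abs_ZF_sub_le (p := m.p) hch.unit (m.pt x) q
  have e1 : XF m.p m.n (m.pt x) = x := XF_ptF hch.unit _ _
  have e2 : ZF m.p m.n (m.pt x) = m.f x := ZF_ptF hch.unit _ _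
  rw [e1] at hX
  rw [e2] at hZ
  have hx8 := h.abs_param_le hm hx
  have hfx := hch.abs_le x (by linarith)
  have ha := h.le_a m hm
  have hb := h.b_le m hm
  have hmin : min (x - m.a) (m.b - x) ≤ R / 8 := by
    rcases le_total (x - m.a) (m.b - x) with hl | hl
    · rw [min_eq_left hl]; linarith
    · rw [min_eq_right hl]; linarith
  by_cases h1 : |XF m.p m.n q| < R / 4
  · by_cases h2 : |ZF m.p m.n q| < R / 4
    · have hz := hch.zF_eq hq h1 h2
      have hqe : m.pt (XF m.p m.n q) = q := by
        unfold Arc.pt; rw [← hz]; exact ptF_XF_ZF hch.unit q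
      have hnot : XF m.p m.n q ∉ Ioo m.a m.b := fun hI => hqm ⟨_, hI, hqe⟩
      rcases not_and_or.1 hnot with hI | hI
      · exact (min_le_left _ _).trans (by linarith [le_abs_self (x - XF m.p m.n q)])
      · exact (min_le_right _ _).trans (by linarith [neg_abs_le (x - XF m.p m.n q)])
    · have := abs_sub_abs_le_abs_sub (ZF m.p m.n q) (m.f x)
      rw [abs_sub_comm] at this
      linarith
  · have := abs_sub_abs_le_abs_sub (XF m.p m.n q) x
    rw [abs_sub_comm] at this
    linarith

/-- A thin region around the arc `m`, with corners at its endpoints. -/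
def Arc.lens (m : Arc) (ε : ℝ) : Set (En 2) :=
  {q | XF m.p m.n q ∈ Icc m.a m.b ∧ |ZF m.p m.n q - m.f (XF m.p m.n q)| ≤
    ε * min (XF m.p m.n q - m.a) (m.b - XF m.p m.n q)}

/-- The region between the arc `m` and the graph of `F`. -/
def Arc.wedge (m : Arc) (F : ℝ → ℝ) : Set (En 2) :=
  {q | XF m.p m.n q ∈ Ioo m.a m.b ∧
    ((m.f (XF m.p m.n q) < ZF m.p m.n q ∧ ZF m.p m.n q ≤ F (XF m.p m.n q)) ∨
      (F (XF m.p m.n q) < ZF m.p m.n q ∧ ZF m.p m.n q ≤ m.f (XF m.p m.n q)))}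

/-- The set obtained from `E` by replacing each arc `m ∈ S` of its boundary with the graph
of `F m`. -/
def replaceArcs (E : Set (En 2)) (S : Set Arc) (F : Arc → ℝ → ℝ) : Set (En 2) :=
  {q | ¬ (q ∈ E ↔ ∃ m ∈ S, q ∈ m.wedge (F m))}

/-- The boundary of `E` is decomposed into arcs, each of which is approximated by a `C²` one. -/
structure IsArcModif (E : Set (En 2)) (R : ℝ) (K : Set (En 2)) (S : Set Arc) (L ε : ℝ)
    (F : Arc → ℝ → ℝ) (η : Arc → ℝ) : Prop extends IsArcSystem E R K S where
  R_pos : 0 < R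
  mem_UR : E ∈ UR 2 R
  ε_pos : 0 < ε
  ε_le : ε ≤ 1 / 4
  approx : ∀ m ∈ S, IsArcApprox m.f m.a m.b L ε (F m) (η m)

lemma not_iff_between (z f F : ℝ) :
    ¬ (z ≤ f ↔ (f < z ∧ z ≤ F) ∨ (F < z ∧ z ≤ f)) ↔ z ≤ F := by
  rcases le_or_gt z f with h1 | h1 <;> rcases le_or_gt z F with h2 | h2 <;>
    simp [h1, h2, not_lt.2, not_le.2]

lemma between_iff_not_iff (z f F : ℝ) :
    ((f < z ∧ z ≤ F) ∨ (F < z ∧ z ≤ f)) ↔ ¬ (z ≤ f ↔ z ≤ F) := by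
  rcases le_or_gt z f with h1 | h1 <;> rcases le_or_gt z F with h2 | h2 <;>
    simp [h1, h2, not_lt.2, not_le.2]

section Modif

variable {E : Set (En 2)} {R : ℝ} {K : Set (En 2)} {S : Set Arc} {L ε : ℝ}
  {F : Arc → ℝ → ℝ} {η : Arc → ℝ}

lemma Arc.dist_pt {m : Arc} (hm : UnitV m.n) (q : En 2) :
    dist (m.pt (XF m.p m.n q)) q = |ZF m.p m.n q - m.f (XF m.p m.n q)| := by
  have h := dist_sq_frame (p := m.p) hm (m.pt (XF m.p m.n q)) q
  have e1 : XF m.p m.n (m.pt (XF m.p m.n q)) = XF m.p m.n q := XF_ptF hm _ _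
  have e2 : ZF m.p m.n (m.pt (XF m.p m.n q)) = m.f (XF m.p m.n q) := ZF_ptF hm _ _
  rw [e1, e2, sub_self, zero_pow two_ne_zero, zero_add, ← sq_abs (m.f _ - _), abs_sub_comm] at h
  exact (sq_eq_sq₀ dist_nonneg (abs_nonneg _)).1 h

lemma IsArcModif.abs_F_sub_le (h : IsArcModif E R K S L ε F η) {m : Arc} (hm : m ∈ S) {x : ℝ}
    (hx : x ∈ Icc m.a m.b) : |F m x - m.f x| ≤ ε * min (x - m.a) (m.b - x) := by
  rw [mul_min_of_nonneg _ _ h.ε_pos.le]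
  exact le_min ((h.approx m hm).close_left x hx) ((h.approx m hm).close_right x hx)

lemma IsArcModif.min_le (h : IsArcModif E R K S L ε F η) {m : Arc} (hm : m ∈ S) {x : ℝ} :
    min (x - m.a) (m.b - x) ≤ R / 8 := by
  have ha := h.le_a m hm
  have hb := h.b_le m hm
  rcases le_total (x - m.a) (m.b - x) with hl | hl
  · rw [min_eq_left hl]; linarith
  · rw [min_eq_right hl]; linarith

lemma IsArcModif.wedge_subset_lens (h : IsArcModif E R K S L ε F η) {m : Arc} (hm : m ∈ S) :
    m.wedge (F m) ⊆ m.lens ε := by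
  rintro q ⟨hX, hq⟩
  have hX' := Ioo_subset_Icc_self hX
  refine ⟨hX', le_trans ?_ (h.abs_F_sub_le hm hX')⟩
  rcases hq with hq | hq
  · rw [abs_of_nonneg (by linarith), abs_of_nonneg (by linarith)]; linarith
  · rw [abs_of_nonpos (by linarith), abs_of_nonpos (by linarith)]; linarith

lemma IsArcModif.isClosed_lens (h : IsArcModif E R K S L ε F η) {m : Arc} (hm : m ∈ S) :
    IsClosed (m.lens ε) := by
  have hc1 := continuous_XF m.p m.n
  have hc2 := continuous_ZF m.p m.n
  have hf : ContinuousOn m.f (Icc m.a m.b) := fun x hx =>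
    ((h.chart m hm).diff x
      (by linarith [h.abs_param_le hm hx, h.R_pos])).continuousAt.continuousWithinAt
  have hcomp : ContinuousOn (fun q => m.f (XF m.p m.n q)) (XF m.p m.n ⁻¹' Icc m.a m.b) :=
    hf.comp hc1.continuousOn fun q hq => hq
  have hg : ContinuousOn (fun q => |ZF m.p m.n q - m.f (XF m.p m.n q)| -
      ε * min (XF m.p m.n q - m.a) (m.b - XF m.p m.n q)) (XF m.p m.n ⁻¹' Icc m.a m.b) :=
    (hc2.continuousOn.sub hcomp).abs.sub (by fun_prop)
  have := hg.preimage_isClosed_of_isClosed (isClosed_Icc.preimage hc1) (isClosed_Iic (a := (0:ℝ)))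
  convert this using 1
  ext q
  simp only [Arc.lens, Set.mem_ofPred_eq, mem_inter_iff, mem_preimage, mem_Iic, sub_nonpos]

lemma IsArcModif.mem_lens_box (h : IsArcModif E R K S L ε F η) {m : Arc} (hm : m ∈ S) {q : En 2}
    (hq : q ∈ m.lens ε) : |XF m.p m.n q| < R / 4 ∧ |ZF m.p m.n q| < R / 4 := by
  obtain ⟨hX, hZ⟩ := hq
  have hR := h.R_pos
  have h8 := h.abs_param_le hm hX
  have hf := (h.chart m hm).abs_le _ (by linarith : |XF m.p m.n q| < R / 4)
  have hmin := h.min_le hm (x := XF m.p m.n q)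
  have := abs_sub_abs_le_abs_sub (ZF m.p m.n q) (m.f (XF m.p m.n q))
  have h1 := h.ε_pos
  have h2 := h.ε_le
  constructor
  · linarith
  · nlinarith

lemma IsArcModif.eq_end_of_notMem_Ioo (h : IsArcModif E R K S L ε F η) {m : Arc} (hm : m ∈ S)
    {q : En 2} (hq : q ∈ m.lens ε) (hX : XF m.p m.n q ∉ Ioo m.a m.b) :
    q = m.pt m.a ∨ q = m.pt m.b := by
  obtain ⟨hI, hZ⟩ := hq
  have hu := (h.chart m hm).unit
  have hd := Arc.dist_pt hu q
  have hcase : XF m.p m.n q = m.a ∨ XF m.p m.n q = m.b := by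
    rcases not_and_or.1 hX with h1 | h1
    · exact Or.inl (le_antisymm (not_lt.1 h1) hI.1)
    · exact Or.inr (le_antisymm hI.2 (not_lt.1 h1))
  have hmin : min (XF m.p m.n q - m.a) (m.b - XF m.p m.n q) ≤ 0 := by
    rcases hcase with h1 | h1
    · exact (min_le_left _ _).trans (by rw [h1, sub_self])
    · exact (min_le_right _ _).trans (by rw [h1, sub_self])
  have h0 : m.pt (XF m.p m.n q) = q := dist_le_zero.1 (by
    rw [hd]; exact hZ.trans (mul_nonpos_of_nonneg_of_nonpos h.ε_pos.le hmin))
  rcases hcase with h1 | h1 <;> rw [h1] at h0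
  · exact Or.inl h0.symm
  · exact Or.inr h0.symm

lemma IsArcModif.eq_end_of_mem_K (h : IsArcModif E R K S L ε F η) {m : Arc} (hm : m ∈ S)
    {q : En 2} (hq : q ∈ m.lens ε) (hK : q ∈ K) : q = m.pt m.a ∨ q = m.pt m.b := by
  by_cases hX : XF m.p m.n q ∈ Ioo m.a m.b
  · exfalso
    have hnot : q ∉ m.curve := by
      rintro ⟨x, hx, rfl⟩
      exact h.notMem_K m hm x hx hK
    have hd := h.min_le_dist h.R_pos hm hq.1 (h.K_subset hK) hnot
    rw [Arc.dist_pt (h.chart m hm).unit] at hd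
    have hpos : 0 < min (XF m.p m.n q - m.a) (m.b - XF m.p m.n q) :=
      lt_min (sub_pos.2 hX.1) (sub_pos.2 hX.2)
    nlinarith [hq.2, h.ε_le, h.ε_pos]
  · exact h.eq_end_of_notMem_Ioo hm hq hX

lemma IsArcModif.mem_Ioo (h : IsArcModif E R K S L ε F η) {m : Arc} (hm : m ∈ S)
    {q : En 2} (hq : q ∈ m.lens ε) (hK : q ∉ K) : XF m.p m.n q ∈ Ioo m.a m.b := by
  by_contra hX
  rcases h.eq_end_of_notMem_Ioo hm hq hX with rfl | rfl
  · exact hK (h.pt_a m hm)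
  · exact hK (h.pt_b m hm)

lemma IsArcModif.lens_inter_subset (h : IsArcModif E R K S L ε F η) {m m' : Arc} (hm : m ∈ S)
    (hm' : m' ∈ S) (hne : m ≠ m') : m.lens ε ∩ m'.lens ε ⊆ K := by
  rintro q ⟨hq, hq'⟩
  by_contra hK
  have hX := h.mem_Ioo hm hq hK
  have hX' := h.mem_Ioo hm' hq' hK
  have hc : m.pt (XF m.p m.n q) ∈ m.curve := ⟨_, hX, rfl⟩
  have hc' : m'.pt (XF m'.p m'.n q) ∈ m'.curve := ⟨_, hX', rfl⟩
  have hfr : ∀ m ∈ S, ∀ x ∈ Icc m.a m.b, m.pt x ∈ frontier E := fun m hm x hx =>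
    (h.chart m hm).pt_mem_frontier (by linarith [h.abs_param_le hm hx, h.R_pos])
  have hd := h.min_le_dist h.R_pos hm hq.1 (hfr m' hm' _ hq'.1)
    (Set.disjoint_right.1 (h.disj m hm m' hm' hne) hc')
  have hd' := h.min_le_dist h.R_pos hm' hq'.1 (hfr m hm _ hq.1)
    (Set.disjoint_left.1 (h.disj m hm m' hm' hne) hc)
  rw [dist_comm] at hd'
  have htri := dist_triangle_right (m.pt (XF m.p m.n q)) (m'.pt (XF m'.p m'.n q)) q
  rw [Arc.dist_pt (h.chart m hm).unit, Arc.dist_pt (h.chart m' hm').unit] at htri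
  have hpos : 0 < min (XF m.p m.n q - m.a) (m.b - XF m.p m.n q) :=
    lt_min (sub_pos.2 hX.1) (sub_pos.2 hX.2)
  have hpos' : 0 < min (XF m'.p m'.n q - m'.a) (m'.b - XF m'.p m'.n q) :=
    lt_min (sub_pos.2 hX'.1) (sub_pos.2 hX'.2)
  nlinarith [hq.2, hq'.2, h.ε_le, h.ε_pos]

lemma IsArcModif.subgraphAt_of_mem_lens (h : IsArcModif E R K S L ε F η) {m : Arc} (hm : m ∈ S)
    {q : En 2} (hq : q ∈ m.lens ε) (hK : q ∉ K) :
    SubgraphAt (replaceArcs E S F) q m.p m.n (F m) := by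
  have hch := h.chart m hm
  refine ⟨hch.unit, (h.approx m hm).smooth, ?_⟩
  have e1 : ∀ᶠ q' in 𝓝 q, ∀ m' ∈ S, m' ≠ m → q' ∉ m'.lens ε := by
    refine (Filter.eventually_all_finite h.finite_S).2 fun m' hm' => ?_
    by_cases hne : m' = m
    · exact Eventually.of_forall fun _ h => absurd hne h
    · have hn : q ∉ m'.lens ε := fun hq' => hK (h.lens_inter_subset hm hm' (Ne.symm hne) ⟨hq, hq'⟩)
      filter_upwards [(h.isClosed_lens hm').isOpen_compl.mem_nhds hn] with q' hq' _
      exact hq'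
  have e2 : ∀ᶠ q' in 𝓝 q, XF m.p m.n q' ∈ Ioo m.a m.b :=
    (continuous_XF m.p m.n).continuousAt
      (Ioo_mem_nhds (h.mem_Ioo hm hq hK).1 (h.mem_Ioo hm hq hK).2)
  have e3 : ∀ᶠ q' in 𝓝 q, |ZF m.p m.n q'| < R / 4 :=
    (isOpen_lt (continuous_ZF m.p m.n).abs continuous_const).mem_nhds (h.mem_lens_box hm hq).2
  filter_upwards [e1, e2, e3] with q' h1 h2 h3
  have h4 : |XF m.p m.n q'| < R / 4 := by
    linarith [h.abs_param_le hm (Ioo_subset_Icc_self h2), h.R_pos]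
  have hE := hch.mem_iff _ _ h4 h3
  rw [ptF_XF_ZF hch.unit] at hE
  have hW : (∃ m' ∈ S, q' ∈ m'.wedge (F m')) ↔ q' ∈ m.wedge (F m) := by
    refine ⟨fun ⟨m', hm', hw⟩ => ?_, fun hw => ⟨m, hm, hw⟩⟩
    by_cases hne : m' = m
    · exact hne ▸ hw
    · exact absurd (h.wedge_subset_lens hm' hw) (h1 m' hm' hne)
  have hw : q' ∈ m.wedge (F m) ↔ _ := and_iff_right h2
  rw [replaceArcs, Set.mem_ofPred_eq, hW, hE, hw]
  exact not_iff_between _ _ _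

lemma IsArcModif.wedge_iff_of_mem_K (h : IsArcModif E R K S L ε F η) {m : Arc} (hm : m ∈ S)
    {c : ℝ} (hc : c = m.a ∨ c = m.b) {nk : En 2} (hnk : SphereN E R (m.pt c) nk) :
    ∀ᶠ q in 𝓝 (m.pt c), XF m.p m.n q ∈ Ioo m.a m.b →
      (q ∈ m.wedge (F m) ↔ ¬ (q ∈ E ↔ ZF (m.pt c) nk q ≤ 0)) := by
  have hch := h.chart m hm
  have hlt := h.lt m hm
  have hcI : c ∈ Icc m.a m.b := by
    rcases hc with rfl | rfl
    · exact left_mem_Icc.2 hlt.le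
    · exact right_mem_Icc.2 hlt.le
  have hc4 : |c| < R / 4 := by linarith [h.abs_param_le hm hcI, h.R_pos]
  have hη := (h.approx m hm).pos
  have hXc : XF m.p m.n (m.pt c) = c := XF_ptF hch.unit _ _
  have hZc : ZF m.p m.n (m.pt c) = m.f c := ZF_ptF hch.unit _ _
  have e2 : ∀ᶠ q' in 𝓝 (m.pt c), XF m.p m.n q' ∈ Ioo (c - η m) (c + η m) :=
    (continuous_XF m.p m.n).continuousAt
      (Ioo_mem_nhds (by rw [hXc]; linarith) (by rw [hXc]; linarith))
  have e3 : ∀ᶠ q' in 𝓝 (m.pt c), |ZF m.p m.n q'| < R / 4 :=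
    (isOpen_lt (continuous_ZF m.p m.n).abs continuous_const).mem_nhds (by
      rw [Set.mem_ofPred_eq, hZc]; exact (hch.abs_le c hc4).trans_lt hc4)
  filter_upwards [e2, e3] with q h2 h3 hI
  have h4 : |XF m.p m.n q| < R / 4 := by
    linarith [h.abs_param_le hm (Ioo_subset_Icc_self hI), h.R_pos]
  have hE := hch.mem_iff _ _ h4 h3
  rw [ptF_XF_ZF hch.unit] at hE
  have hF : F m (XF m.p m.n q) = m.f c + deriv m.f c * (XF m.p m.n q - c) := by
    rcases hc with rfl | rfl
    · exact (h.approx m hm).left _ h2.2.le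
    · exact (h.approx m hm).right _ h2.1.le
  rw [hnk.zF_nonpos_iff hch hc4 rfl q, ← hF, hE]
  exact (and_iff_right hI).trans (between_iff_not_iff _ _ _)

lemma IsArcModif.subgraphAt_of_mem_K (h : IsArcModif E R K S L ε F η) {k : En 2} (hk : k ∈ K) :
    ∃ n, SubgraphAt (replaceArcs E S F) k k n fun _ => 0 := by
  have hR := h.R_pos
  obtain ⟨nk, hnk⟩ := exists_sphereN hR h.mem_UR.2.2 (h.K_subset hk)
  refine ⟨nk, hnk.1, contDiff_const, ?_⟩
  obtain ⟨⟨ma, hma, hka⟩, mb, hmb, hkb⟩ := h.exists_arc_ends hR h.mem_UR hk hnk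
  have e1 : ∀ᶠ q in 𝓝 k, ∀ m ∈ S, XF m.p m.n q ∈ Ioo m.a m.b →
      (q ∈ m.wedge (F m) → ¬ (q ∈ E ↔ ZF k nk q ≤ 0)) := by
    refine (Filter.eventually_all_finite h.finite_S).2 fun m hm => ?_
    by_cases hkm : k ∈ m.lens ε
    · rcases h.eq_end_of_mem_K hm hkm hk with rfl | rfl
      · filter_upwards [h.wedge_iff_of_mem_K hm (Or.inl rfl) hnk] with q hq hI
        exact (hq hI).1
      · filter_upwards [h.wedge_iff_of_mem_K hm (Or.inr rfl) hnk] with q hq hI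
        exact (hq hI).1
    · filter_upwards [(h.isClosed_lens hm).isOpen_compl.mem_nhds hkm] with q hq _ hw
      exact absurd (h.wedge_subset_lens hm hw) hq
  have e2 : ∀ᶠ q in 𝓝 k, ma.a < XF ma.p ma.n q → ¬ (q ∈ E ↔ ZF k nk q ≤ 0) →
      q ∈ ma.wedge (F ma) := by
    have h1 : ∀ᶠ q in 𝓝 k, XF ma.p ma.n q < ma.b :=
      (isOpen_lt (continuous_XF _ _) continuous_const).mem_nhds (by
        rw [Set.mem_ofPred_eq, ← hka]
        exact (XF_ptF (h.chart ma hma).unit _ _).trans_lt (h.lt ma hma))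
    have h2 := h.wedge_iff_of_mem_K hma (Or.inl rfl) (by rw [hka]; exact hnk)
    rw [hka] at h2
    filter_upwards [h1, h2] with q h1 h2 hlt hx
    exact (h2 ⟨hlt, h1⟩).2 hx
  have e3 : ∀ᶠ q in 𝓝 k, XF mb.p mb.n q < mb.b → ¬ (q ∈ E ↔ ZF k nk q ≤ 0) →
      q ∈ mb.wedge (F mb) := by
    have h1 : ∀ᶠ q in 𝓝 k, mb.a < XF mb.p mb.n q :=
      (isOpen_lt continuous_const (continuous_XF _ _)).mem_nhds (by
        rw [Set.mem_ofPred_eq, ← hkb]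
        exact (h.lt mb hmb).trans_eq (XF_ptF (h.chart mb hmb).unit _ _).symm)
    have h2 := h.wedge_iff_of_mem_K hmb (Or.inr rfl) (by rw [hkb]; exact hnk)
    rw [hkb] at h2
    filter_upwards [h1, h2] with q h1 h2 hlt hx
    exact (h2 ⟨h1, hlt⟩).2 hx
  have e4 : ∀ᶠ q in 𝓝 k, dist q k < R := ball_mem_nhds k hR
  have hkE : k ∈ E := h.mem_UR.1.frontier_subset (h.K_subset hk)
  filter_upwards [e1, e2, e3, e4] with q h1 h2 h3 h4
  by_cases hx : q ∈ E ↔ ZF k nk q ≤ 0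
  · have hno : ¬ ∃ m ∈ S, q ∈ m.wedge (F m) := fun ⟨m, hm, hw⟩ => h1 m hm hw.1 hw hx
    simp only [replaceArcs, Set.mem_ofPred_eq, hno, iff_false, not_not]
    exact hx
  · have hne : q ≠ k := by
      rintro rfl
      refine hx ⟨fun _ => by simp [ZF], fun _ => hkE⟩
    have hq : |2 * R * ZF k nk q| ≤ dist q k ^ 2 := by
      obtain ⟨s1, s2⟩ := hnk.2 q
      rw [_root_.abs_le]
      by_cases hq : q ∈ E
      · have hz : 0 < ZF k nk q := by
          by_contra! hz
          exact hx ⟨fun _ => hz, fun _ => hq⟩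
        have : 0 < 2 * R * ZF k nk q := by positivity
        constructor
        · nlinarith [sq_nonneg (dist q k)]
        · exact not_lt.1 fun hc => s2 hc hq
      · have hz : ZF k nk q ≤ 0 := by
          by_contra! hz
          exact hx ⟨fun h => absurd h hq, fun h => absurd h (not_le.2 hz)⟩
        have : 2 * R * ZF k nk q ≤ 0 := mul_nonpos_of_nonneg_of_nonpos (by positivity) hz
        constructor
        · have := not_lt.1 fun hc => hq (s1 hc)
          linarith
        · nlinarith [sq_nonneg (dist q k)]
    have hex : ∃ m ∈ S, q ∈ m.wedge (F m) := by
      have ha4 : |ma.a| < R / 4 := by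
        linarith [h.abs_param_le hma (left_mem_Icc.2 (h.lt ma hma).le)]
      have hb4 : |mb.b| < R / 4 := by
        linarith [h.abs_param_le hmb (right_mem_Icc.2 (h.lt mb hmb).le)]
      rcases hnk.side hR (h.chart ma hma) ha4 hka hq h4 hne with s | s
      · exact ⟨ma, hma, h2 s.2 hx⟩
      · rcases hnk.side hR (h.chart mb hmb) hb4 hkb hq h4 hne with s' | s'
        · linarith [s.1, s'.1]
        · exact ⟨mb, hmb, h3 s'.2 hx⟩
    simp only [replaceArcs, Set.mem_ofPred_eq, hex, iff_true]
    by_cases hq : q ∈ E <;> simp only [hq, true_iff, false_iff, not_true_eq_false, not_not,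
      not_false_eq_true, false_iff, true_iff] at hx ⊢
    · exact hx
    · exact hx

lemma IsArcModif.frontier_subset_lens (h : IsArcModif E R K S L ε F η) :
    ∀ q ∈ frontier E, q ∈ K ∨ ∃ m ∈ S, q ∈ m.lens ε := by
  intro q hq
  refine (h.cover q hq).imp id ?_
  rintro ⟨m, hm, x, hx, rfl⟩
  refine ⟨m, hm, ?_⟩
  have e1 : XF m.p m.n (m.pt x) = x := XF_ptF (h.chart m hm).unit _ _
  have e2 : ZF m.p m.n (m.pt x) = m.f x := ZF_ptF (h.chart m hm).unit _ _
  simp only [Arc.lens, Set.mem_ofPred_eq, e1, e2, sub_self, abs_zero]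
  exact ⟨Ioo_subset_Icc_self hx, mul_nonneg h.ε_pos.le
    (le_min (sub_nonneg.2 hx.1.le) (sub_nonneg.2 hx.2.le))⟩

lemma IsArcModif.subgraphAt_of_notMem (h : IsArcModif E R K S L ε F η) {q : En 2} (hK : q ∉ K)
    (hq : ∀ m ∈ S, q ∉ m.lens ε) :
    ∃ c : ℝ, c ≠ 0 ∧ SubgraphAt (replaceArcs E S F) q q (mk2 0 1) fun _ => c := by
  have hu : UnitV (mk2 0 1) := by simp [UnitV]
  have e1 : ∀ᶠ q' in 𝓝 q, ∀ m ∈ S, q' ∉ m.lens ε :=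
    (Filter.eventually_all_finite h.finite_S).2 fun m hm =>
      (h.isClosed_lens hm).isOpen_compl.mem_nhds (hq m hm)
  have e2 : ∀ᶠ q' in 𝓝 q, (q' ∈ replaceArcs E S F ↔ q' ∈ E) := by
    filter_upwards [e1] with q' h1
    have hno : ¬ ∃ m ∈ S, q' ∈ m.wedge (F m) := fun ⟨m, hm, hw⟩ =>
      h1 m hm (h.wedge_subset_lens hm hw)
    simp only [replaceArcs, Set.mem_ofPred_eq, hno, iff_false, not_not]
  have hfr : q ∉ frontier E := fun hfr => by
    rcases h.frontier_subset_lens q hfr with h1 | ⟨m, hm, h1⟩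
    · exact hK h1
    · exact hq m hm h1
  have hZ : Tendsto (ZF q (mk2 0 1)) (𝓝 q) (𝓝 0) := by
    have := (continuous_ZF q (mk2 0 1)).tendsto q
    simpa [ZF] using this
  by_cases hqE : q ∈ E
  · have hu_int : q ∈ interior E := by
      by_contra hni
      exact hfr ⟨subset_closure hqE, hni⟩
    refine ⟨1, one_ne_zero, hu, contDiff_const, ?_⟩
    filter_upwards [e2, mem_interior_iff_mem_nhds.1 hu_int, hZ.eventually (gt_mem_nhds zero_lt_one)]
      with q' h1 h2 h3
    rw [h1]
    exact ⟨fun _ => h3.le, fun _ => h2⟩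
  · refine ⟨-1, by norm_num, hu, contDiff_const, ?_⟩
    filter_upwards [e2, h.mem_UR.1.isOpen_compl.mem_nhds hqE,
      hZ.eventually (lt_mem_nhds (by norm_num : (-1 : ℝ) < 0))] with q' h1 h2 h3
    rw [h1]
    exact ⟨fun h => absurd h h2, fun h => absurd h (not_le.2 h3)⟩

lemma IsArcModif.symmDiff_subset (h : IsArcModif E R K S L ε F η) :
    symmDiff (replaceArcs E S F) E ⊆ cthickening (ε * R) (frontier E) := by
  intro q hq
  have hex : ∃ m ∈ S, q ∈ m.wedge (F m) := by
    by_contra hno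
    have : q ∈ replaceArcs E S F ↔ q ∈ E := by
      simp only [replaceArcs, Set.mem_ofPred_eq, hno, iff_false, not_not]
    rw [Set.mem_symmDiff, this] at hq
    tauto
  obtain ⟨m, hm, hw⟩ := hex
  have hl := h.wedge_subset_lens hm hw
  refine mem_cthickening_of_dist_le q (m.pt (XF m.p m.n q)) _ _
    ((h.chart m hm).pt_mem_frontier (h.mem_lens_box hm hl).1) ?_
  rw [dist_comm, Arc.dist_pt (h.chart m hm).unit]
  refine hl.2.trans (mul_le_mul_of_nonneg_left ?_ h.ε_pos.le)
  linarith [h.min_le hm (x := XF m.p m.n q), h.R_pos]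

lemma IsArcModif.isC2Set (h : IsArcModif E R K S L ε F η) : IsC2Set (replaceArcs E S F) := by
  refine isC2Set_of_subgraphAt ?_ fun q => ?_
  · have hb : Bornology.IsBounded (E ∪ cthickening (ε * R) (frontier E)) := by
      refine h.mem_UR.2.1.union (Bornology.IsBounded.cthickening ?_)
      exact h.mem_UR.2.1.subset h.mem_UR.1.frontier_subset
    refine hb.subset fun q hq => ?_
    by_cases hE : q ∈ E
    · exact Or.inl hE
    · exact Or.inr (h.symmDiff_subset (Or.inl ⟨hq, hE⟩))
  · by_cases hK : q ∈ K
    · obtain ⟨n, hn⟩ := h.subgraphAt_of_mem_K hK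
      exact ⟨_, _, _, hn⟩
    by_cases hl : ∃ m ∈ S, q ∈ m.lens ε
    · obtain ⟨m, hm, hq⟩ := hl
      exact ⟨_, _, _, h.subgraphAt_of_mem_lens hm hq hK⟩
    · push Not at hl
      obtain ⟨c, -, hc⟩ := h.subgraphAt_of_notMem hK hl
      exact ⟨_, _, _, hc⟩

lemma IsArcModif.frontier_subset (h : IsArcModif E R K S L ε F η) :
    frontier (replaceArcs E S F) ⊆
      K ∪ ⋃ m ∈ S, (fun x => ptF m.p m.n x (F m x)) '' Ioo m.a m.b := by
  intro q hq
  by_cases hK : q ∈ K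
  · exact Or.inl hK
  right
  by_cases hl : ∃ m ∈ S, q ∈ m.lens ε
  · obtain ⟨m, hm, hq'⟩ := hl
    have hz := (h.subgraphAt_of_mem_lens hm hq' hK).zF_eq hq
    refine mem_iUnion₂.2 ⟨m, hm, _, h.mem_Ioo hm hq' hK, ?_⟩
    simp only
    rw [← hz]
    exact ptF_XF_ZF (h.chart m hm).unit q
  · push Not at hl
    obtain ⟨c, hc0, hc⟩ := h.subgraphAt_of_notMem hK hl
    have hz := hc.zF_eq hq
    refine absurd hz.symm ?_
    simpa [ZF] using hc0

lemma IsArcModif.curv_eq (h : IsArcModif E R K S L ε F η) {κ : En 2 → ℝ}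
    (hκ : IsCurvFun (replaceArcs E S F) κ) {m : Arc} (hm : m ∈ S) {x : ℝ}
    (hx : x ∈ Ioo m.a m.b) : κ (ptF m.p m.n x (F m x)) = curvGraph (F m) x := by
  have hu := (h.chart m hm).unit
  have e1 : XF m.p m.n (ptF m.p m.n x (F m x)) = x := XF_ptF hu _ _
  have e2 : ZF m.p m.n (ptF m.p m.n x (F m x)) = F m x := ZF_ptF hu _ _
  have hl : ptF m.p m.n x (F m x) ∈ m.lens ε := by
    simp only [Arc.lens, Set.mem_ofPred_eq, e1, e2]
    exact ⟨Ioo_subset_Icc_self hx, h.abs_F_sub_le hm (Ioo_subset_Icc_self hx)⟩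
  have hK : ptF m.p m.n x (F m x) ∉ K := by
    intro hK
    rcases h.eq_end_of_mem_K hm hl hK with e | e
    · rw [e] at e1
      have : m.a = x := (XF_ptF hu _ _).symm.trans e1
      exact hx.1.ne this
    · rw [e] at e1
      have : m.b = x := (XF_ptF hu _ _).symm.trans e1
      exact hx.2.ne this.symm
  have := (h.subgraphAt_of_mem_lens hm hl hK).curv_eq (by rw [e1, e2]) hκ
  rwa [e1] at this

end Modif

lemma abs_rpow_neg_sub_le (s t : ℝ) :
    |(1 + s ^ 2) ^ (-((3 : ℝ) / 2)) - (1 + t ^ 2) ^ (-((3 : ℝ) / 2))| ≤ 3 * |s - t| := by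
  have hpos : ∀ x : ℝ, 1 ≤ 1 + x ^ 2 := fun x => by nlinarith [sq_nonneg x]
  refine convex_univ.norm_image_sub_le_of_norm_hasDerivWithin_le
    (f := fun x : ℝ => (1 + x ^ 2) ^ (-((3 : ℝ) / 2)))
    (f' := fun x : ℝ => (2 * x) * (-((3 : ℝ) / 2)) * (1 + x ^ 2) ^ (-((3 : ℝ) / 2) - 1))
    (fun x _ => ?_) (fun x _ => ?_) (mem_univ t) (mem_univ s)
  · have h1 : HasDerivAt (fun x : ℝ => 1 + x ^ 2) (2 * x) x := by
      simpa using ((hasDerivAt_id x).pow 2).const_add 1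
    exact (h1.rpow_const (Or.inl (by linarith [hpos x]))).hasDerivWithinAt
  · rw [Real.norm_eq_abs, abs_mul, abs_mul, abs_mul, abs_of_pos (by norm_num : (0 : ℝ) < 2),
      abs_neg, abs_of_pos (by norm_num : (0 : ℝ) < 3 / 2),
      abs_of_pos (Real.rpow_pos_of_pos (by linarith [hpos x]) _)]
    have h2 : (1 + x ^ 2) ^ (-((3 : ℝ) / 2) - 1) ≤ (1 + x ^ 2) ^ (-(1 : ℝ)) :=
      Real.rpow_le_rpow_of_exponent_le (hpos x) (by norm_num)
    rw [Real.rpow_neg_one] at h2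
    have h3 : |x| * (1 + x ^ 2)⁻¹ ≤ 1 := by
      rw [mul_inv_le_iff₀ (by linarith [hpos x])]
      nlinarith [sq_abs x, sq_nonneg (|x| - 1)]
    nlinarith [abs_nonneg x, mul_le_mul_of_nonneg_left h2 (abs_nonneg x)]

lemma curvGraph_eq_mul (f : ℝ → ℝ) (x : ℝ) :
    curvGraph f x = deriv (deriv f) x * (1 + deriv f x ^ 2) ^ (-((3 : ℝ) / 2)) := by
  rw [Real.rpow_neg (by positivity), curvGraph, div_eq_mul_inv]

lemma rpow_neg_le_one (s : ℝ) : (1 + s ^ 2) ^ (-((3 : ℝ) / 2)) ≤ 1 :=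
  Real.rpow_le_one_of_one_le_of_nonpos (by nlinarith [sq_nonneg s]) (by norm_num)

lemma abs_curvGraph_le (f : ℝ → ℝ) (x : ℝ) : |curvGraph f x| ≤ |deriv (deriv f) x| := by
  rw [curvGraph_eq_mul, abs_mul, abs_of_pos (Real.rpow_pos_of_pos (by positivity) _)]
  exact mul_le_of_le_one_right (abs_nonneg _) (rpow_neg_le_one _)

lemma abs_curvGraph_sub_le (f g : ℝ → ℝ) (x : ℝ) :
    |curvGraph f x - curvGraph g x| ≤ |deriv (deriv f) x - deriv (deriv g) x| +
      3 * |deriv (deriv g) x| * |deriv f x - deriv g x| := by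
  rw [curvGraph_eq_mul, curvGraph_eq_mul]
  obtain ⟨u, hu⟩ : ∃ u, u = (1 + deriv f x ^ 2) ^ (-((3 : ℝ) / 2)) := ⟨_, rfl⟩
  obtain ⟨v, hv⟩ : ∃ v, v = (1 + deriv g x ^ 2) ^ (-((3 : ℝ) / 2)) := ⟨_, rfl⟩
  have h1 : |u - v| ≤ 3 * |deriv f x - deriv g x| := by
    rw [hu, hv]; exact abs_rpow_neg_sub_le _ _
  have h2 : |u| ≤ 1 := by
    rw [hu, abs_of_pos (Real.rpow_pos_of_pos (by positivity) _)]; exact rpow_neg_le_one _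
  rw [← hu, ← hv]
  calc |deriv (deriv f) x * u - deriv (deriv g) x * v|
      = |(deriv (deriv f) x - deriv (deriv g) x) * u + deriv (deriv g) x * (u - v)| := by
        congr 1; ring
    _ ≤ |deriv (deriv f) x - deriv (deriv g) x| * |u| + |deriv (deriv g) x| * |u - v| := by
        rw [← abs_mul, ← abs_mul]; exact abs_add_le _ _
    _ ≤ |deriv (deriv f) x - deriv (deriv g) x| * 1 +
        |deriv (deriv g) x| * (3 * |deriv f x - deriv g x|) := by gcongr
    _ = _ := by ring

lemma exists_abs_rpow_le {p : ℝ} (hp : 1 < p) (M : ℝ) : ∃ C ≥ 0, ∀ u v : ℝ, |u| ≤ M → |v| ≤ M →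
    |u| ^ p ≤ |v| ^ p + C * |u - v| := by
  rcases lt_or_ge M 0 with hM | hM
  · exact ⟨0, le_rfl, fun u v hu => absurd (hu.trans_lt hM) (not_lt.2 (abs_nonneg u))⟩
  refine ⟨p * M ^ (p - 1), by positivity, fun u v hu hv => ?_⟩
  have h := (convex_Icc (0 : ℝ) M).norm_image_sub_le_of_norm_hasDerivWithin_le
    (f := fun x : ℝ => x ^ p) (f' := fun x : ℝ => p * x ^ (p - 1)) (C := p * M ^ (p - 1))
    (fun x _ => (Real.hasDerivAt_rpow_const (Or.inr hp.le)).hasDerivWithinAt)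
    (fun x hx => ?_) ⟨abs_nonneg v, hv⟩ ⟨abs_nonneg u, hu⟩
  · rw [Real.norm_eq_abs, Real.norm_eq_abs] at h
    have h2 := mul_le_mul_of_nonneg_left (abs_abs_sub_abs_le_abs_sub u v)
      (by positivity : 0 ≤ p * M ^ (p - 1))
    linarith [le_abs_self (|u| ^ p - |v| ^ p)]
  · have := hx.1
    rw [Real.norm_eq_abs, abs_of_nonneg (by positivity)]
    exact mul_le_mul_of_nonneg_left (Real.rpow_le_rpow hx.1 hx.2 (by linarith)) (by linarith)

lemma measurable_curvGraph (f : ℝ → ℝ) : Measurable (curvGraph f) := by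
  have h1 := measurable_deriv f
  have h2 := measurable_deriv (deriv f)
  unfold curvGraph
  exact h2.div ((measurable_const.add (h1.pow_const 2)).pow_const _)

/-- The length measure of a graph over `(a, b)`, projected to the line. -/
def graphMeasure (p n : En 2) (φ : ℝ → ℝ) (a b : ℝ) : Measure ℝ :=
  ((μH[(1 : ℝ)] : Measure (En 2)).restrict ((fun x => ptF p n x (φ x)) '' Ioo a b)).map (XF p n)

lemma graphMeasure_apply {p n : En 2} (hn : UnitV n) (φ : ℝ → ℝ) (a b : ℝ) {A : Set ℝ}
    (hA : MeasurableSet A) :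
    graphMeasure p n φ a b A = μH[(1 : ℝ)] ((fun x => ptF p n x (φ x)) '' (A ∩ Ioo a b)) := by
  have hX := (continuous_XF p n).measurable
  rw [graphMeasure, Measure.map_apply hX hA, Measure.restrict_apply (hX hA)]
  congr 1
  ext q
  constructor
  · rintro ⟨hq, x, hx, rfl⟩
    refine ⟨x, ⟨?_, hx⟩, rfl⟩
    rwa [mem_preimage, XF_ptF hn] at hq
  · rintro ⟨x, ⟨hA, hx⟩, rfl⟩
    exact ⟨by rwa [mem_preimage, XF_ptF hn], x, hx, rfl⟩

lemma lintegral_graphMeasure {p n : En 2} (φ : ℝ → ℝ) (a b : ℝ) {G : ℝ → ℝ≥0∞}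
    (hG : Measurable G) :
    ∫⁻ x, G x ∂graphMeasure p n φ a b =
      ∫⁻ q in (fun x => ptF p n x (φ x)) '' Ioo a b, G (XF p n q) ∂(μH[(1 : ℝ)]) :=
  lintegral_map hG (continuous_XF p n).measurable

lemma graphMeasure_le_smul {p n : En 2} (hn : UnitV n) {φ χ : ℝ → ℝ} {a b : ℝ} {c : ℝ≥0}
    (hc : ∀ x ∈ Ioo a b, ∀ y ∈ Ioo a b,
      dist (ptF p n x (χ x)) (ptF p n y (χ y)) ≤ c * dist (ptF p n x (φ x)) (ptF p n y (φ y))) :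
    graphMeasure p n χ a b ≤ c • graphMeasure p n φ a b := by
  refine Measure.le_iff.2 fun A hA => ?_
  rw [Measure.smul_apply, graphMeasure_apply hn _ _ _ hA, graphMeasure_apply hn _ _ _ hA]
  have hlip : LipschitzOnWith c (fun q => ptF p n (XF p n q) (χ (XF p n q)))
      ((fun x => ptF p n x (φ x)) '' (A ∩ Ioo a b)) := by
    refine LipschitzOnWith.of_dist_le_mul ?_
    rintro _ ⟨x, hx, rfl⟩ _ ⟨y, hy, rfl⟩
    simp only [XF_ptF hn]
    exact hc x hx.2 y hy.2
  have := hlip.hausdorffMeasure_image_le zero_le_one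
  rw [image_image] at this
  simp only [XF_ptF hn, ENNReal.rpow_one] at this
  exact this

lemma graphMeasure_le_volume {p n : En 2} (hn : UnitV n) {φ : ℝ → ℝ} {a b : ℝ} {c : ℝ≥0}
    (hc : ∀ x ∈ Ioo a b, ∀ y ∈ Ioo a b,
      dist (ptF p n x (φ x)) (ptF p n y (φ y)) ≤ c * dist x y) :
    graphMeasure p n φ a b ≤ c • (volume.restrict (Ioo a b)) := by
  refine Measure.le_iff.2 fun A hA => ?_
  rw [Measure.smul_apply, graphMeasure_apply hn _ _ _ hA, Measure.restrict_apply hA]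
  have hlip : LipschitzOnWith c (fun x => ptF p n x (φ x)) (A ∩ Ioo a b) :=
    LipschitzOnWith.of_dist_le_mul fun x hx y hy => hc x hx.2 y hy.2
  have := hlip.hausdorffMeasure_image_le zero_le_one
  rw [ENNReal.rpow_one, hausdorffMeasure_real] at this
  exact this

lemma measurableSet_ptF_graph {p n : En 2} (hn : UnitV n) {φ : ℝ → ℝ} {a b : ℝ}
    (hφ : ContinuousOn φ (Icc a b)) :
    MeasurableSet ((fun x => ptF p n x (φ x)) '' Ioo a b) := by
  have hcl : IsClosed ((fun x => ptF p n x (φ x)) '' Icc a b) :=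
    (isCompact_Icc.image_of_continuousOn
      ((continuous_ptF p n).comp_continuousOn (continuousOn_id.prodMk hφ))).isClosed
  have : (fun x => ptF p n x (φ x)) '' Ioo a b =
      (fun x => ptF p n x (φ x)) '' Icc a b ∩ XF p n ⁻¹' Ioo a b := by
    ext q
    constructor
    · rintro ⟨x, hx, rfl⟩
      refine ⟨⟨x, Ioo_subset_Icc_self hx, rfl⟩, ?_⟩
      rw [mem_preimage, XF_ptF hn]; exact hx
    · rintro ⟨⟨x, hx, rfl⟩, hq⟩
      rw [mem_preimage, XF_ptF hn] at hq
      exact ⟨x, hq, rfl⟩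
  rw [this]
  exact hcl.measurableSet.inter (isOpen_Ioo.preimage (continuous_XF _ _)).measurableSet

section Modif

variable {E : Set (En 2)} {R : ℝ} {K : Set (En 2)} {S : Set Arc} {L ε : ℝ}
  {F : Arc → ℝ → ℝ} {η : Arc → ℝ}

lemma IsArcModif.abs_param_lt (h : IsArcModif E R K S L ε F η) {m : Arc} (hm : m ∈ S) {x : ℝ}
    (hx : x ∈ Icc m.a m.b) : |x| < R / 4 := by
  linarith [h.abs_param_le hm hx, h.R_pos]

lemma IsArcModif.graphMeasure_le (h : IsArcModif E R K S L ε F η) {m : Arc} (hm : m ∈ S) :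
    graphMeasure m.p m.n (F m) m.a m.b ≤ (1 + ε).toNNReal • graphMeasure m.p m.n m.f m.a m.b := by
  have hch := h.chart m hm
  have hε := h.ε_pos
  refine graphMeasure_le_smul hch.unit fun x hx y hy => ?_
  rw [Real.coe_toNNReal _ (by linarith)]
  have hd : ∀ t ∈ Icc m.a m.b, HasDerivAt (fun t => F m t - m.f t)
      (deriv (F m) t - deriv m.f t) t :=
    fun t ht => ((h.approx m hm).smooth.differentiable (by norm_num) t).hasDerivAt.sub
      (hch.diff t (h.abs_param_lt hm ht))
  have h1 := abs_sub_le_of_deriv_le hd (fun t ht => (h.approx m hm).deriv_close t ht)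
    (Ioo_subset_Icc_self hy) (Ioo_subset_Icc_self hx)
  refine abs_le_of_sq_le_sq' ?_ (by positivity) |>.2
  rw [mul_pow, dist_ptF_sq hch.unit, dist_ptF_sq hch.unit]
  obtain ⟨v, hv⟩ : ∃ v, v = m.f x - m.f y := ⟨_, rfl⟩
  obtain ⟨w, hw⟩ : ∃ w, w = F m x - F m y := ⟨_, rfl⟩
  obtain ⟨u, hu⟩ : ∃ u, u = x - y := ⟨_, rfl⟩
  have h2 : |w - v| ≤ ε * |u| := by
    have : w - v = F m x - m.f x - (F m y - m.f y) := by rw [hv, hw]; ring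
    rw [this, hu]; exact h1
  rw [← hv, ← hw, ← hu]
  have h3 : |w| ≤ |v| + ε * |u| := by
    have := abs_add_le v (w - v)
    rw [add_sub_cancel] at this
    linarith
  have h4 : w ^ 2 ≤ (|v| + ε * |u|) ^ 2 := by
    rw [← sq_abs w]; exact pow_le_pow_left₀ (abs_nonneg w) h3 2
  have h5 := sq_abs u
  have h6 := sq_abs v
  nlinarith [mul_nonneg hε.le (sq_nonneg (|u| - |v|)), mul_nonneg (sq_nonneg ε) (sq_nonneg v)]

lemma IsArcModif.graphMeasure_le_volume (h : IsArcModif E R K S L ε F η) {m : Arc} (hm : m ∈ S) :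
    graphMeasure m.p m.n m.f m.a m.b ≤ (2 : ℝ≥0) • volume.restrict (Ioo m.a m.b) := by
  have hch := h.chart m hm
  refine _root_.graphMeasure_le_volume hch.unit fun x hx y hy => ?_
  have h1 := abs_sub_le_of_deriv_le (fun t ht => hch.diff t (h.abs_param_lt hm ht))
    (fun t ht => hch.deriv_le t (h.abs_param_lt hm ht))
    (Ioo_subset_Icc_self hy) (Ioo_subset_Icc_self hx)
  refine abs_le_of_sq_le_sq' ?_ (by positivity) |>.2
  rw [dist_ptF_sq hch.unit, Real.dist_eq, mul_pow, sq_abs]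
  rw [one_mul] at h1
  have := sq_le_sq.2 h1
  push_cast
  nlinarith [sq_nonneg (x - y)]

lemma IsArcModif.measurableSet_curve (h : IsArcModif E R K S L ε F η) {m : Arc} (hm : m ∈ S) :
    MeasurableSet m.curve :=
  measurableSet_ptF_graph (h.chart m hm).unit fun x hx =>
    ((h.chart m hm).diff x (h.abs_param_lt hm hx)).continuousAt.continuousWithinAt

lemma IsArcModif.ae_curv_eq (h : IsArcModif E R K S L ε F η) {κ : En 2 → ℝ} (hκ : IsCurvFun E κ)
    {m : Arc} (hm : m ∈ S) :
    ∀ᵐ q ∂((μH[(1 : ℝ)] : Measure (En 2)).restrict m.curve),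
      κ q = curvGraph m.f (XF m.p m.n q) := by
  have hch := h.chart m hm
  have hlip : LipschitzOnWith (4 / R).toNNReal (deriv m.f) (Ioo m.a m.b) := by
    refine LipschitzOnWith.of_dist_le_mul fun x hx y hy => ?_
    rw [Real.coe_toNNReal _ (by have := h.R_pos; positivity)]
    exact hch.lip x y (h.abs_param_lt hm (Ioo_subset_Icc_self hx))
      (h.abs_param_lt hm (Ioo_subset_Icc_self hy))
  have h1 : ∀ᵐ x ∂(volume.restrict (Ioo m.a m.b)),
      x ∈ Ioo m.a m.b → DifferentiableAt ℝ (deriv m.f) x := by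
    filter_upwards [ae_restrict_of_ae hlip.ae_differentiableWithinAt_of_mem_real] with x hx hI
    exact (hx hI).differentiableAt (Ioo_mem_nhds hI.1 hI.2)
  have h2 : ∀ᵐ x ∂(graphMeasure m.p m.n m.f m.a m.b),
      x ∈ Ioo m.a m.b → DifferentiableAt ℝ (deriv m.f) x :=
    (Measure.absolutelyContinuous_of_le_smul (c := (2 : ℝ≥0))
      (h.graphMeasure_le_volume hm)).ae_le h1
  have h3 := ae_of_ae_map (continuous_XF m.p m.n).measurable.aemeasurable h2
  filter_upwards [h3, ae_restrict_mem (h.measurableSet_curve hm)] with q hq hqc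
  obtain ⟨x, hx, rfl⟩ := hqc
  have e1 : XF m.p m.n (m.pt x) = x := XF_ptF hch.unit _ _
  rw [e1] at hq ⊢
  have hx4 := h.abs_param_lt hm (Ioo_subset_Icc_self hx)
  have hf := (hch.abs_le x hx4).trans_lt hx4
  obtain ⟨δ, hδ⟩ : ∃ δ, δ = min (R / 4 - |x|) (R / 4 - |m.f x|) := ⟨_, rfl⟩
  have hb : ∀ y, |y - x| < δ → |y| < R / 4 := fun y hy => by
    have := hy.trans_le (hδ.le.trans (min_le_left _ _))
    linarith [abs_sub_abs_le_abs_sub y x]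
  refine hκ.eq_curvGraph hch.unit (δ := δ) (C := 4 / R) ?_ ?_ ?_ ?_ (hq hx)
  · rw [hδ]; exact lt_min (by linarith) (by linarith)
  · intro y z hy hz
    refine hch.mem_iff y z (hb y hy) ?_
    have := hz.trans_le (hδ.le.trans (min_le_right _ _))
    linarith [abs_sub_abs_le_abs_sub z (m.f x)]
  · exact fun y hy => (hch.diff y (hb y hy)).differentiableAt
  · exact fun y z hy hz => hch.lip y z (hb y hy) (hb z hz)

end Modif

section Modif

variable {E : Set (En 2)} {R : ℝ} {K : Set (En 2)} {S : Set Arc} {L ε : ℝ}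
  {F : Arc → ℝ → ℝ} {η : Arc → ℝ}

lemma IsArcModif.abs_deriv_deriv_le (h : IsArcModif E R K S L ε F η) {m : Arc} (hm : m ∈ S)
    {x : ℝ} (hx : x ∈ Ioo m.a m.b) : |deriv (deriv m.f) x| ≤ 4 / R := by
  have hR := h.R_pos
  have hlip : LipschitzOnWith (4 / R).toNNReal (deriv m.f) (Ioo m.a m.b) := by
    refine LipschitzOnWith.of_dist_le_mul fun x hx y hy => ?_
    rw [Real.coe_toNNReal _ (by positivity)]
    exact (h.chart m hm).lip x y (h.abs_param_lt hm (Ioo_subset_Icc_self hx))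
      (h.abs_param_lt hm (Ioo_subset_Icc_self hy))
  have := norm_deriv_le_of_lipschitzOn (Ioo_mem_nhds hx.1 hx.2) hlip
  rwa [Real.coe_toNNReal _ (by positivity)] at this

/-- The energy of a modified arc is controlled by that of the original one. -/
lemma IsArcModif.lintegral_arc_le (h : IsArcModif E R K S (4 / R) ε F η) {p C : ℝ}
    (hC0 : 0 ≤ C) (hC : ∀ u v : ℝ, |u| ≤ 4 / R + 1 → |v| ≤ 4 / R + 1 →
      |u| ^ p ≤ |v| ^ p + C * |u - v|)
    {κ κ' : En 2 → ℝ} (hκ : IsCurvFun E κ) (hκ' : IsCurvFun (replaceArcs E S F) κ')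
    {m : Arc} (hm : m ∈ S) :
    ∫⁻ q in (fun x => ptF m.p m.n x (F m x)) '' Ioo m.a m.b,
        ENNReal.ofReal (1 + |κ' q| ^ p) ∂(μH[(1 : ℝ)]) ≤
      ENNReal.ofReal (1 + ε) * ((∫⁻ q in m.curve, ENNReal.ofReal (1 + |κ q| ^ p) ∂(μH[(1 : ℝ)])) +
        ENNReal.ofReal (8 * C * ε)) := by
  have hR := h.R_pos
  have hε := h.ε_pos
  have hε4 := h.ε_le
  have hch := h.chart m hm
  have hap := h.approx m hm
  have hG : Measurable fun x => ENNReal.ofReal (1 + |curvGraph (F m) x| ^ p) :=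
    ENNReal.measurable_ofReal.comp
      (measurable_const.add ((measurable_curvGraph _).abs.pow_const p))
  have hg : Measurable fun x => ENNReal.ofReal (1 + |curvGraph m.f x| ^ p) :=
    ENNReal.measurable_ofReal.comp
      (measurable_const.add ((measurable_curvGraph _).abs.pow_const p))
  obtain ⟨u, hu⟩ : ∃ u : ℝ → ℝ, u = fun x => |deriv (deriv (F m)) x - deriv (deriv m.f) x| :=
    ⟨_, rfl⟩
  have hum : Measurable u := by
    rw [hu]; exact ((measurable_deriv _).sub (measurable_deriv _)).abs
  have h1 : ∫⁻ q in (fun x => ptF m.p m.n x (F m x)) '' Ioo m.a m.b,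
        ENNReal.ofReal (1 + |κ' q| ^ p) ∂(μH[(1 : ℝ)]) =
      ∫⁻ x, ENNReal.ofReal (1 + |curvGraph (F m) x| ^ p)
        ∂graphMeasure m.p m.n (F m) m.a m.b := by
    rw [lintegral_graphMeasure _ _ _ hG]
    refine setLIntegral_congr_fun
      (measurableSet_ptF_graph hch.unit hap.smooth.continuous.continuousOn) ?_
    rintro _ ⟨x, hx, rfl⟩
    simp only [h.curv_eq hκ' hm hx, XF_ptF hch.unit]
  have h2 : ∫⁻ x, ENNReal.ofReal (1 + |curvGraph m.f x| ^ p)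
        ∂graphMeasure m.p m.n m.f m.a m.b =
      ∫⁻ q in m.curve, ENNReal.ofReal (1 + |κ q| ^ p) ∂(μH[(1 : ℝ)]) := by
    rw [lintegral_graphMeasure _ _ _ hg]
    refine lintegral_congr_ae ?_
    filter_upwards [h.ae_curv_eq hκ hm] with q hq
    rw [hq]
  have hIoo : ∀ᵐ x ∂(graphMeasure m.p m.n m.f m.a m.b), x ∈ Ioo m.a m.b :=
    (Measure.absolutelyContinuous_of_le_smul (c := (2 : ℝ≥0)) (h.graphMeasure_le_volume hm)).ae_le
      (ae_restrict_mem measurableSet_Ioo)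
  have hpt : ∀ x ∈ Ioo m.a m.b, ENNReal.ofReal (1 + |curvGraph (F m) x| ^ p) ≤
      ENNReal.ofReal (1 + |curvGraph m.f x| ^ p) +
        ENNReal.ofReal (C * (u x + 3 * (4 / R) * ε)) := by
    intro x hx
    have hx' := Ioo_subset_Icc_self hx
    have e1 := h.abs_deriv_deriv_le hm hx
    have e2 := hap.second_le x hx'
    have e3 := hC (curvGraph (F m) x) (curvGraph m.f x)
      ((abs_curvGraph_le _ _).trans (by linarith)) ((abs_curvGraph_le _ _).trans (by linarith))
    have e4 := abs_curvGraph_sub_le (F m) m.f x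
    have e5 : 3 * |deriv (deriv m.f) x| * |deriv (F m) x - deriv m.f x| ≤ 3 * (4 / R) * ε := by
      have := hap.deriv_close x hx'
      gcongr
    have e6 : C * |curvGraph (F m) x - curvGraph m.f x| ≤ C * (u x + 3 * (4 / R) * ε) := by
      refine mul_le_mul_of_nonneg_left ?_ hC0
      rw [hu]
      exact e4.trans (by linarith)
    have e7 : 0 ≤ C * |curvGraph (F m) x - curvGraph m.f x| := by positivity
    rw [← ENNReal.ofReal_add (by positivity) (e7.trans e6)]
    exact ENNReal.ofReal_le_ofReal (by linarith)
  have hvm : Measurable fun x => ENNReal.ofReal (C * (u x + 3 * (4 / R) * ε)) :=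
    ENNReal.measurable_ofReal.comp (measurable_const.mul (hum.add_const _))
  have hu_int : IntegrableOn u (Ioo m.a m.b) := by
    refine Measure.integrableOn_of_bounded (M := 8 / R + 1) measure_Ioo_lt_top.ne
      hum.aestronglyMeasurable ?_
    filter_upwards [ae_restrict_mem measurableSet_Ioo] with x hx
    have e1 := h.abs_deriv_deriv_le hm hx
    have e2 := hap.second_le x (Ioo_subset_Icc_self hx)
    have e3 := abs_sub (deriv (deriv (F m)) x) (deriv (deriv m.f) x)
    have e4 : 8 / R = 4 / R + 4 / R := by ring
    rw [Real.norm_eq_abs, hu, abs_abs]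
    linarith
  have hlen : m.b - m.a ≤ R / 4 := by linarith [h.le_a m hm, h.b_le m hm]
  have h3 : ∫⁻ x, ENNReal.ofReal (C * (u x + 3 * (4 / R) * ε))
      ∂graphMeasure m.p m.n m.f m.a m.b ≤ ENNReal.ofReal (8 * C * ε) := by
    have huC' : IntegrableOn (fun x => C * (u x + 3 * (4 / R) * ε)) (Ioo m.a m.b) :=
      (hu_int.add (integrableOn_const measure_Ioo_lt_top.ne)).const_mul C
    calc _ ≤ ∫⁻ x, ENNReal.ofReal (C * (u x + 3 * (4 / R) * ε))
          ∂((2 : ℝ≥0) • volume.restrict (Ioo m.a m.b)) :=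
          lintegral_mono' (h.graphMeasure_le_volume hm) le_rfl
      _ = 2 * ENNReal.ofReal (∫ x in Ioo m.a m.b, C * (u x + 3 * (4 / R) * ε)) := by
          rw [lintegral_smul_measure, ofReal_integral_eq_lintegral_ofReal huC'
            (Eventually.of_forall fun x => by rw [hu]; positivity)]
          rfl
      _ ≤ 2 * ENNReal.ofReal (4 * C * ε) := by
          gcongr
          rw [integral_const_mul, integral_add hu_int (integrableOn_const measure_Ioo_lt_top.ne),
            setIntegral_const, Real.volume_real_Ioo_of_le (h.lt m hm).le, smul_eq_mul]
          have e1 := hap.second_close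
          rw [show (∫ x in Ioo m.a m.b, |deriv (deriv (F m)) x - deriv (deriv m.f) x|) =
            ∫ x in Ioo m.a m.b, u x by rw [hu]] at e1
          have e2 : (m.b - m.a) * (3 * (4 / R) * ε) ≤ 3 * ε := by
            calc _ ≤ R / 4 * (3 * (4 / R) * ε) := by gcongr
              _ = 3 * ε := by field_simp
          nlinarith
      _ = _ := by
          rw [← ENNReal.ofReal_ofNat, ← ENNReal.ofReal_mul (by norm_num)]
          congr 1; ring
  rw [h1]
  calc _ ≤ ∫⁻ x, ENNReal.ofReal (1 + |curvGraph (F m) x| ^ p)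
        ∂((1 + ε).toNNReal • graphMeasure m.p m.n m.f m.a m.b) :=
        lintegral_mono' (h.graphMeasure_le hm) le_rfl
    _ = ENNReal.ofReal (1 + ε) * ∫⁻ x, ENNReal.ofReal (1 + |curvGraph (F m) x| ^ p)
        ∂graphMeasure m.p m.n m.f m.a m.b := by
        rw [lintegral_smul_measure]; rfl
    _ ≤ ENNReal.ofReal (1 + ε) * (∫⁻ x, (ENNReal.ofReal (1 + |curvGraph m.f x| ^ p) +
        ENNReal.ofReal (C * (u x + 3 * (4 / R) * ε))) ∂graphMeasure m.p m.n m.f m.a m.b) := by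
        gcongr 1
        exact lintegral_mono_ae (hIoo.mono hpt)
    _ ≤ _ := by
        rw [lintegral_add_left hg, h2]
        gcongr

/-- The energy of the modified set is controlled by that of the original one. -/
lemma IsArcModif.F0_le (h : IsArcModif E R K S (4 / R) ε F η) {p C : ℝ}
    (hC0 : 0 ≤ C) (hC : ∀ u v : ℝ, |u| ≤ 4 / R + 1 → |v| ≤ 4 / R + 1 →
      |u| ^ p ≤ |v| ^ p + C * |u - v|)
    {κ : En 2 → ℝ} (hκ : IsCurvFun E κ) :
    F0 p (replaceArcs E S F) ≤ ENNReal.ofReal (1 + ε) *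
      ((∫⁻ q in frontier E, ENNReal.ofReal (1 + |κ q| ^ p) ∂(μH[(1 : ℝ)])) +
        S.ncard * ENNReal.ofReal (8 * C * ε)) := by
  obtain ⟨κ', hκ'⟩ := exists_isCurvFun (replaceArcs E S F)
  have hfin := h.finite_S
  obtain ⟨T, rfl⟩ : ∃ T : Finset Arc, S = T := ⟨hfin.toFinset, hfin.coe_toFinset.symm⟩
  obtain ⟨G, hG⟩ : ∃ G : En 2 → ℝ≥0∞, G = fun q => ENNReal.ofReal (1 + |κ' q| ^ p) := ⟨_, rfl⟩
  obtain ⟨g, hg⟩ : ∃ g : En 2 → ℝ≥0∞, g = fun q => ENNReal.ofReal (1 + |κ q| ^ p) := ⟨_, rfl⟩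
  have : NullSingletonClass (μH[(1 : ℝ)] : Measure (En 2)) :=
    Measure.nullSingletonClass_hausdorff _ one_pos
  rw [F0, if_pos h.isC2Set]
  refine (iInf₂_le κ' hκ').trans ?_
  have harc : ∀ m ∈ T, ∫⁻ q in (fun x => ptF m.p m.n x (F m x)) '' Ioo m.a m.b, G q ∂(μH[(1 : ℝ)])
      ≤ ENNReal.ofReal (1 + ε) * ((∫⁻ q in m.curve, g q ∂(μH[(1 : ℝ)])) +
        ENNReal.ofReal (8 * C * ε)) := fun m hm => by
    rw [hG, hg]; exact h.lintegral_arc_le hC0 hC hκ hκ' hm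
  rw [← hG, ← hg, ncard_coe_finset]
  have hK : ∫⁻ q in K, G q ∂(μH[(1 : ℝ)]) = 0 :=
    setLIntegral_measure_zero _ _ (h.finite_K.measure_zero _)
  calc ∫⁻ q in frontier (replaceArcs E T F), G q ∂(μH[(1 : ℝ)])
      ≤ ∫⁻ q in K ∪ ⋃ m ∈ T, (fun x => ptF m.p m.n x (F m x)) '' Ioo m.a m.b, G q
          ∂(μH[(1 : ℝ)]) := lintegral_mono_set h.frontier_subset
    _ ≤ ∫⁻ q in ⋃ m ∈ T, (fun x => ptF m.p m.n x (F m x)) '' Ioo m.a m.b, G q ∂(μH[(1 : ℝ)]) := by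
        refine (lintegral_union_le _ _ _).trans_eq ?_
        rw [hK, zero_add]
    _ ≤ ∑ m ∈ T, ∫⁻ q in (fun x => ptF m.p m.n x (F m x)) '' Ioo m.a m.b, G q ∂(μH[(1 : ℝ)]) := by
        refine (lintegral_mono' (Measure.restrict_biUnion_le (Countable.to_set
          T.countable_toSet)) le_rfl).trans_eq ?_
        rw [lintegral_sum_measure]
        exact Finset.tsum_subtype T fun m : Arc => ∫⁻ q in
          (fun x => ptF m.p m.n x (F m x)) '' Ioo m.a m.b, G q ∂(μH[(1 : ℝ)])
    _ ≤ ∑ m ∈ T, ENNReal.ofReal (1 + ε) * ((∫⁻ q in m.curve, g q ∂(μH[(1 : ℝ)])) +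
        ENNReal.ofReal (8 * C * ε)) := Finset.sum_le_sum harc
    _ = ENNReal.ofReal (1 + ε) * ((∫⁻ q in ⋃ m ∈ T, m.curve, g q ∂(μH[(1 : ℝ)])) +
        T.card * ENNReal.ofReal (8 * C * ε)) := by
        rw [← Finset.mul_sum, Finset.sum_add_distrib, Finset.sum_const, nsmul_eq_mul,
          lintegral_biUnion_finset (fun m hm m' hm' hne => h.disj m hm m' hm' hne)
            (fun m hm => h.measurableSet_curve hm)]
    _ ≤ _ := by
        gcongr
        refine iUnion₂_subset fun m hm => ?_
        rintro _ ⟨x, hx, rfl⟩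
        exact (h.chart m hm).pt_mem_frontier (h.abs_param_lt hm (Ioo_subset_Icc_self hx))

end Modif

lemma volume_eq_zero_of_hausdorffMeasure_one_ne_top {A : Set (En 2)}
    (hA : (μH[(1 : ℝ)] : Measure (En 2)) A ≠ ⊤) : volume A = 0 := by
  have h2 : (μH[(2 : ℝ)] : Measure (En 2)) A = 0 :=
    (Measure.hausdorffMeasure_zero_or_top (by norm_num : (1 : ℝ) < 2) A).resolve_right hA
  have hfin : Module.finrank ℝ (En 2) = 2 := finrank_euclideanSpace_fin
  have hH : (μH[(2 : ℝ)] : Measure (En 2)).IsAddHaarMeasure := by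
    have := isAddHaarMeasure_hausdorffMeasure (E := En 2)
    rw [hfin] at this
    exact_mod_cast this
  exact Measure.absolutelyContinuous_isAddHaarMeasure volume (μH[(2 : ℝ)]) h2

lemma distL1_eq_measure_symmDiff {A B : Set (En 2)} (hA : MeasurableSet A) (hB : MeasurableSet B) :
    distL1 A B = (volume (symmDiff A B)).toReal := by
  have : (fun x => |A.indicator (fun _ => (1 : ℝ)) x - B.indicator (fun _ => (1 : ℝ)) x|) =
      (symmDiff A B).indicator 1 := by
    ext x
    by_cases h1 : x ∈ A <;> by_cases h2 : x ∈ B <;> simp [h1, h2, mem_symmDiff, indicator]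
  rw [distL1, this, integral_indicator_one (hA.symmDiff hB)]
  rfl

lemma IsC2Set.mem_MM {A : Set (En 2)} (hA : IsC2Set A) : A ∈ MM :=
  ⟨hA.1.isClosed.measurableSet, hA.1.isBounded⟩

/-- Sets satisfying the sphere condition and with finite energy are approximated, in `L¹` and in
energy, by sets with `C²` boundary. -/
lemma exists_F0_le {E : Set (En 2)} {R p : ℝ} (hp : 1 < p) (hR : 0 < R) (hE : E ∈ UR 2 R)
    {κ : En 2 → ℝ} (hκ : IsCurvFun E κ)
    (hI : ∫⁻ q in frontier E, ENNReal.ofReal (1 + |κ q| ^ p) ∂(μH[(1 : ℝ)]) ≠ ⊤)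
    {δ : ℝ} (hδ : 0 < δ) :
    ∃ A ∈ MM, distL1 A E ≤ δ ∧
      F0 p A ≤ (∫⁻ q in frontier E, ENNReal.ofReal (1 + |κ q| ^ p) ∂(μH[(1 : ℝ)])) +
        ENNReal.ofReal δ := by
  obtain ⟨I, hIe⟩ : ∃ I, I = ∫⁻ q in frontier E, ENNReal.ofReal (1 + |κ q| ^ p) ∂(μH[(1 : ℝ)]) :=
    ⟨_, rfl⟩
  rw [← hIe] at hI ⊢
  have hEb : E ∈ MM := ⟨hE.1.measurableSet, hE.2.1⟩
  have hcomp : IsCompact (frontier E) :=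
    isCompact_of_isClosed_isBounded isClosed_frontier
      (hE.2.1.subset (frontier_subset_closure.trans hE.1.closure_eq.subset))
  have hH1 : (μH[(1 : ℝ)] : Measure (En 2)) (frontier E) ≠ ⊤ := by
    refine ne_top_of_le_ne_top hI ?_
    rw [hIe, ← setLIntegral_one]
    refine lintegral_mono fun q => ?_
    rw [← ENNReal.ofReal_one]
    exact ENNReal.ofReal_le_ofReal (le_add_of_nonneg_right (by positivity))
  have hvol := volume_eq_zero_of_hausdorffMeasure_one_ne_top hH1
  obtain ⟨K, S, hS⟩ := exists_isArcSystem hR hE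
  obtain ⟨C, hC0, hC⟩ := exists_abs_rpow_le hp (4 / R + 1)
  have hid : Tendsto (fun ε : ℝ => ε) (𝓝[>] 0) (𝓝 0) := nhdsWithin_le_nhds
  have t1 : Tendsto (fun ε : ℝ => ENNReal.ofReal (1 + ε) *
      (I + S.ncard * ENNReal.ofReal (8 * C * ε))) (𝓝[>] 0) (𝓝 I) := by
    have a1 : Tendsto (fun ε : ℝ => ENNReal.ofReal (1 + ε)) (𝓝[>] 0) (𝓝 1) := by
      simpa using ENNReal.tendsto_ofReal (hid.const_add 1)
    have a2 : Tendsto (fun ε : ℝ => ENNReal.ofReal (8 * C * ε)) (𝓝[>] 0) (𝓝 0) := by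
      simpa using ENNReal.tendsto_ofReal (hid.const_mul (8 * C))
    have a3 : Tendsto (fun ε : ℝ => I + S.ncard * ENNReal.ofReal (8 * C * ε)) (𝓝[>] 0) (𝓝 I) := by
      simpa using
        (ENNReal.Tendsto.const_mul a2 (Or.inr (ENNReal.natCast_ne_top S.ncard))).const_add I
    simpa using ENNReal.Tendsto.mul a1 (Or.inl one_ne_zero) a3 (Or.inr ENNReal.one_ne_top)
  have t2 : Tendsto (fun ε : ℝ => volume (cthickening (ε * R) (frontier E))) (𝓝[>] 0) (𝓝 0) := by
    have a1 := tendsto_measure_cthickening_of_isCompact (μ := volume) hcomp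
    rw [hvol] at a1
    exact a1.comp (by simpa using hid.mul_const R)
  have hδ' : 0 < ENNReal.ofReal δ := ENNReal.ofReal_pos.2 hδ
  obtain ⟨ε, ⟨⟨hε1, hε2⟩, hε4⟩, hε⟩ := ((((t1.eventually_lt_const
    (ENNReal.lt_add_right hI hδ'.ne')).and (t2.eventually_lt_const hδ')).and
    (hid.eventually_lt_const (by norm_num : (0 : ℝ) < 1 / 4))).and self_mem_nhdsWithin).exists
  have hex : ∀ m : Arc, ∃ (f : ℝ → ℝ) (η : ℝ), m ∈ S → IsArcApprox m.f m.a m.b (4 / R) ε f η := by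
    intro m
    by_cases hm : m ∈ S
    · have hx : ∀ x ∈ Icc m.a m.b, |x| < R / 4 := fun x hx =>
        (hS.abs_param_le hm hx).trans_lt (by linarith)
      obtain ⟨f, η, hf⟩ := exists_isArcApprox (hS.lt m hm) (by positivity : 0 ≤ 4 / R)
        (fun x h => (hS.chart m hm).diff x (hx x h))
        (fun x h y h' => (hS.chart m hm).lip x y (hx x h) (hx y h')) hε
      exact ⟨f, η, fun _ => hf⟩
    · exact ⟨0, 0, fun h => absurd h hm⟩
  choose F η hF using hex
  have hM : IsArcModif E R K S (4 / R) ε F η :=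
    { hS with R_pos := hR, mem_UR := hE, ε_pos := hε, ε_le := hε4.le, approx := hF }
  refine ⟨replaceArcs E S F, hM.isC2Set.mem_MM, ?_, ?_⟩
  · rw [distL1_eq_measure_symmDiff hM.isC2Set.mem_MM.1 hEb.1]
    exact ENNReal.toReal_le_of_le_ofReal hδ.le
      ((measure_mono hM.symmDiff_subset).trans hε2.le)
  · refine (hM.F0_le hC0 hC hκ).trans ?_
    rw [← hIe]
    exact hε1.le

lemma exists_F0_le_FR {p R : ℝ} (hp : 1 < p) (hR : 0 < R) {E : Set (En 2)} (h : FR p R E < ⊤)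
    {δ : ℝ} (hδ : 0 < δ) :
    ∃ A ∈ MM, distL1 A E ≤ δ ∧ F0 p A ≤ FR p R E + ENNReal.ofReal δ := by
  by_cases hE : E ∈ UR 2 R
  swap
  · simp [FR, hE] at h
  have hδ2 : 0 < δ / 2 := half_pos hδ
  have hlt := ENNReal.lt_add_right h.ne (ENNReal.ofReal_pos.2 hδ2).ne'
  conv_lhs at hlt => rw [FR, if_pos hE]
  simp only [iInf_lt_iff] at hlt
  obtain ⟨κ, hκ, hlt⟩ := hlt
  obtain ⟨A, hA, hd, hF⟩ := exists_F0_le hp hR hE hκ (hlt.trans_le le_top).ne hδ2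
  refine ⟨A, hA, by linarith, hF.trans ?_⟩
  calc _ ≤ FR p R E + ENNReal.ofReal (δ / 2) + ENNReal.ofReal (δ / 2) := by gcongr
    _ = _ := by rw [add_assoc, ← ENNReal.ofReal_add hδ2.le hδ2.le, add_halves]

theorem gamma_convergence (p : ℝ) (hp : 1 < p)
    (Rh : ℕ → ℝ) (hRh : ∀ h, 0 < Rh h) (hR0 : Tendsto Rh atTop (𝓝 0))
    (E : Set (En 2)) (hE : E ∈ MM) :
    (∀ Eh : ℕ → Set (En 2), (∀ h, Eh h ∈ MM) → L1Conv Eh E →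
      F0bar p E ≤ liminf (fun h => FR p (Rh h) (Eh h)) atTop) ∧
    (∃ Eh : ℕ → Set (En 2), (∀ h, Eh h ∈ MM) ∧ L1Conv Eh E ∧
      limsup (fun h => FR p (Rh h) (Eh h)) atTop ≤ F0bar p E) :=
  ⟨fun _ hEh hconv => F0bar_le_liminf hE hRh
    (fun _ hR _ _ hF _ hδ => exists_F0_le_FR hp hR hF hδ) hEh hconv,
    exists_recovery_sequence hE hRh hR0⟩
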